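/- There exists a function assigning to every ordinal γ < 1^∞ a respecting forest P(γ) of order 2 such that for all ordinals α < β < 1^∞ there is no covering of P(β) into P(α). Consequently, every strictly decreasing sequence of ordinals below 1^∞ produces an infinite bad sequence of respecting forests of order 2 with respect to coverings. -/

import Mathlib

open FirstOrder

/-- The relation symbols of the language of `ℛ₂`: three binary relations. -/
inductive ordRel : ℕ → Type
  | le : ordRel 2
  | le1 : ordRel 2
  | le2 : ordRel 2

/-- The first-order language with three binary relation symbols `≤`, `≤₁`, `≤₂`. -/
def ordLang : FirstOrder.Language := ⟨fun _ => Empty, ordRel⟩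

/-- The `ordLang`-structure on the set of ordinals below `β`, interpreting the three
relation symbols by `≤` and the given relations `le1`, `le2`. -/
def segStr (le1 le2 : Ordinal → Ordinal → Prop) (β : Ordinal) :
    ordLang.Structure {x : Ordinal // x < β} where
  funMap := fun f => Empty.elim f
  RelMap
    | .le => fun v => (v 0).1 ≤ (v 1).1
    | .le1 => fun v => le1 (v 0).1 (v 1).1
    | .le2 => fun v => le2 (v 0).1 (v 1).1

/-- Σ₁-formulas: a block of existential quantifiers applied to a quantifier-free formula. -/
inductive IsSigma1 {L : FirstOrder.Language} {α : Type} :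
    {n : ℕ} → L.BoundedFormula α n → Prop
  | of_isQF {n} {φ : L.BoundedFormula α n} (h : φ.IsQF) : IsSigma1 φ
  | ex {n} {φ : L.BoundedFormula α (n + 1)} (h : IsSigma1 φ) : IsSigma1 φ.ex

/-- Π₁-formulas: a block of universal quantifiers applied to a quantifier-free formula. -/
inductive IsPi1 {L : FirstOrder.Language} {α : Type} :
    {n : ℕ} → L.BoundedFormula α n → Prop
  | of_isQF {n} {φ : L.BoundedFormula α n} (h : φ.IsQF) : IsPi1 φ
  | all {n} {φ : L.BoundedFormula α (n + 1)} (h : IsPi1 φ) : IsPi1 φ.all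

/-- Σ₂-formulas: a block of existential quantifiers applied to a Π₁-formula. -/
inductive IsSigma2 {L : FirstOrder.Language} {α : Type} :
    {n : ℕ} → L.BoundedFormula α n → Prop
  | of_isPi1 {n} {φ : L.BoundedFormula α n} (h : IsPi1 φ) : IsSigma2 φ
  | ex {n} {φ : L.BoundedFormula α (n + 1)} (h : IsSigma2 φ) : IsSigma2 φ.ex

/-- Realization of a formula with `k` parameters in the segment structure below `β`. -/
def RealizeIn (le1 le2 : Ordinal → Ordinal → Prop) (β : Ordinal) {k : ℕ}
    (φ : ordLang.Formula (Fin k)) (v : Fin k → {x : Ordinal // x < β}) : Prop :=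
  letI := segStr le1 le2 β
  φ.Realize v

/-- `a ≤ b` and the segment below `a` is an elementary substructure of the segment below `b`
with respect to the class `C` of formulas (with parameters from below `a`). -/
def ElemSub (C : ∀ k : ℕ, ordLang.Formula (Fin k) → Prop)
    (le1 le2 : Ordinal → Ordinal → Prop) (a b : Ordinal) : Prop :=
  ∃ hab : a ≤ b,
    ∀ (k : ℕ) (φ : ordLang.Formula (Fin k)), C k φ →
      ∀ v : Fin k → {x : Ordinal // x < a},
        RealizeIn le1 le2 a φ v ↔
          RealizeIn le1 le2 b φ (fun j => ⟨(v j).1, lt_of_lt_of_le (v j).2 hab⟩)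

/-- The pair of relations `le1`, `le2` satisfies the simultaneous recursive definition of
`≤₁` and `≤₂` on the ordinals: `α ≤ᵢ β` iff `α ≤ β` and the segment below `α` is a
Σᵢ-elementary substructure of the segment below `β`. -/
def IsR2Pair (le1 le2 : Ordinal → Ordinal → Prop) : Prop :=
  (∀ a b, le1 a b ↔ ElemSub (fun _ φ => IsSigma1 φ) le1 le2 a b) ∧
  (∀ a b, le2 a b ↔ ElemSub (fun _ φ => IsSigma2 φ) le1 le2 a b)

/-- The strict part of `≤₁`. -/
def Lt1 (le1 : Ordinal → Ordinal → Prop) (a b : Ordinal) : Prop := le1 a b ∧ a ≠ b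

/-- The strict part of `≤₂`. -/
def Lt2 (le2 : Ordinal → Ordinal → Prop) (a b : Ordinal) : Prop := le2 a b ∧ a ≠ b

/-- `1^∞`: the least ordinal `ν` such that below `ν` there are `<₂`-chains of every finite
length. -/
noncomputable def OneInfty (le2 : Ordinal → Ordinal → Prop) : Ordinal :=
  sInf {ν : Ordinal | ∀ n : ℕ, ∃ β : Fin n → Ordinal,
    (∀ i, β i < ν) ∧
    ∀ (i : ℕ) (hi : i + 1 < n), Lt2 le2 (β ⟨i, Nat.lt_of_succ_lt hi⟩) (β ⟨i + 1, hi⟩)}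

/-- A respecting forest of order 2: a finite structure with a linear order `≤₀` and partial
orders `≤₁`, `≤₂` which are forests, with `≤₂ ⊆ ≤₁ ⊆ ≤₀`, and `≤ᵢ₊₁` respecting `≤ᵢ`. -/
structure RForest where
  P : Type
  [fintypeP : Fintype P]
  le0 : P → P → Prop
  le1 : P → P → Prop
  le2 : P → P → Prop
  le0_refl : ∀ p, le0 p p
  le0_trans : ∀ p q r, le0 p q → le0 q r → le0 p r
  le0_antisymm : ∀ p q, le0 p q → le0 q p → p = q
  le0_total : ∀ p q, le0 p q ∨ le0 q p
  le1_refl : ∀ p, le1 p p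
  le1_trans : ∀ p q r, le1 p q → le1 q r → le1 p r
  le1_antisymm : ∀ p q, le1 p q → le1 q p → p = q
  le2_refl : ∀ p, le2 p p
  le2_trans : ∀ p q r, le2 p q → le2 q r → le2 p r
  le2_antisymm : ∀ p q, le2 p q → le2 q p → p = q
  le2_sub_le1 : ∀ p q, le2 p q → le1 p q
  le1_sub_le0 : ∀ p q, le1 p q → le0 p q
  forest1 : ∀ p q r, le1 q p → le1 r p → le1 q r ∨ le1 r q
  forest2 : ∀ p q r, le2 q p → le2 r p → le2 q r ∨ le2 r q
  respects1 : ∀ p q r, le0 p q → le0 q r → le1 p r → le1 p q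
  respects2 : ∀ p q r, le1 p q → le1 q r → le2 p r → le2 p q

attribute [instance] RForest.fintypeP

/-- The finite set `X` of ordinals, with the relations induced from `ℛ₂`, is isomorphic to the
respecting forest `F`. -/
def Realizes (le1 le2 : Ordinal → Ordinal → Prop) (F : RForest) (X : Finset Ordinal) : Prop :=
  ∃ e : F.P ≃ {x // x ∈ X}, ∀ p q : F.P,
    (F.le0 p q ↔ ((e p : Ordinal) ≤ (e q : Ordinal))) ∧
    (F.le1 p q ↔ le1 (e p : Ordinal) (e q : Ordinal)) ∧
    (F.le2 p q ↔ le2 (e p : Ordinal) (e q : Ordinal))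

/-- Pointwise comparison of two finite sets of ordinals via their increasing enumerations. -/
def pwLE (X Y : Finset Ordinal) : Prop :=
  ∃ h : X.card = Y.card, ∀ i : Fin X.card,
    ((X.orderIsoOfFin rfl i : {x // x ∈ X}) : Ordinal) ≤
      ((Y.orderIsoOfFin h.symm i : {x // x ∈ Y}) : Ordinal)

/-- `X` is the isominimal realization of the respecting forest `F` in `ℛ₂`: it is isomorphic
to `F` and pointwise minimal among all finite substructures of `ℛ₂` isomorphic to `F`. -/
def IsIsominimalRealization (le1 le2 : Ordinal → Ordinal → Prop) (F : RForest)
    (X : Finset Ordinal) : Prop :=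
  Realizes le1 le2 F X ∧ ∀ Y : Finset Ordinal, Realizes le1 le2 F Y → pwLE X Y

/-- A covering of the respecting forest `F` into `ℛ₂`. -/
def IsCovering (le1 le2 : Ordinal → Ordinal → Prop) (F : RForest)
    (c : F.P → Ordinal) : Prop :=
  (∀ p q, F.le0 p q ↔ c p ≤ c q) ∧
  (∀ p q, F.le1 p q → le1 (c p) (c q)) ∧
  (∀ p q, F.le2 p q → le2 (c p) (c q))


/-- A covering of the respecting forest `F` into the respecting forest `G`. -/
def ForestCovering (F G : RForest) (f : F.P → G.P) : Prop :=
  (∀ p q, F.le0 p q ↔ G.le0 (f p) (f q)) ∧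
  (∀ p q, F.le1 p q → G.le1 (f p) (f q)) ∧
  (∀ p q, F.le2 p q → G.le2 (f p) (f q))

set_option autoImplicit false

namespace R2
open FirstOrder FirstOrder.Language

def cd (le1 le2 : Ordinal → Ordinal → Prop) {ι : Type} (u : ι → Ordinal) :
    ι → ι → Prop × Prop × Prop :=
  fun i j => (u i ≤ u j, le1 (u i) (u j), le2 (u i) (u j))

def RB (le1 le2 : Ordinal → Ordinal → Prop) (β : Ordinal) {α : Type} {n : ℕ}
    (φ : ordLang.BoundedFormula α n) (v : α → {x : Ordinal // x < β})
    (xs : Fin n → {x : Ordinal // x < β}) : Prop :=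
  @BoundedFormula.Realize ordLang {x // x < β} (segStr le1 le2 β) α n φ v xs

variable {le1 le2 : Ordinal → Ordinal → Prop}

lemma term_var {γ : Type} (t : ordLang.Term γ) : ∃ i, t = Term.var i := by
  cases t with
  | var i => exact ⟨i, rfl⟩
  | func f ts => exact Empty.elim f

lemma qf_code {α : Type} {n : ℕ} (φ : ordLang.BoundedFormula α n) (hφ : φ.IsQF) :
    ∃ A : Set ((α ⊕ Fin n) → (α ⊕ Fin n) → Prop × Prop × Prop), ∀ β v xs,
      RB le1 le2 β φ v xs ↔ cd le1 le2 (fun i => (Sum.elim v xs i).1) ∈ A := by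
  induction hφ with
  | falsum => exact ⟨∅, fun β v xs => by simp [RB, BoundedFormula.Realize]⟩
  | of_isAtomic h =>
    cases h with
    | equal t1 t2 =>
      obtain ⟨i, rfl⟩ := term_var t1
      obtain ⟨j, rfl⟩ := term_var t2
      refine ⟨{c | (c i j).1 ∧ (c j i).1}, fun β v xs => ?_⟩
      simp only [RB, Term.bdEqual, BoundedFormula.Realize, Term.realize, cd, Set.mem_ofPred_eq]
      rw [Subtype.ext_iff, le_antisymm_iff]
    | rel R ts =>
      rename_i l
      have hv : ∀ k, ∃ i, ts k = Term.var i := fun k => term_var (ts k)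
      choose g hg using hv
      obtain rfl : ts = fun k => Term.var (g k) := funext hg
      cases R with
      | le =>
        refine ⟨{c | (c (g 0) (g 1)).1}, fun β v xs => ?_⟩
        exact Iff.rfl
      | le1 =>
        refine ⟨{c | (c (g 0) (g 1)).2.1}, fun β v xs => ?_⟩
        exact Iff.rfl
      | le2 =>
        refine ⟨{c | (c (g 0) (g 1)).2.2}, fun β v xs => ?_⟩
        exact Iff.rfl
  | imp h1 h2 ih1 ih2 =>
    obtain ⟨A, hA⟩ := ih1
    obtain ⟨B, hB⟩ := ih2
    refine ⟨{c | c ∈ A → c ∈ B}, fun β v xs => ?_⟩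
    have e1 := hA β v xs
    have e2 := hB β v xs
    simp only [RB, BoundedFormula.Realize, Set.mem_ofPred_eq] at *
    rw [e1, e2]

/-- reindexing used when a quantifier is absorbed. -/
def reix {α δ : Type} (n : ℕ) : (α ⊕ Fin (n+1)) ⊕ δ → (α ⊕ Fin n) ⊕ (Unit ⊕ δ)
  | .inl (.inl a) => .inl (.inl a)
  | .inl (.inr i) => Fin.lastCases (.inr (.inl ())) (fun j => .inl (.inr j)) i
  | .inr d => .inr (.inr d)

lemma reix_elim {M : Type*} {α δ : Type} (n : ℕ) (v : α → M) (xs : Fin n → M) (x : M) (y : δ → M) :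
    (Sum.elim (Sum.elim v xs) (Sum.elim (fun _ => x) y)) ∘ reix n
     = Sum.elim (Sum.elim v (Fin.snoc xs x : Fin (n+1) → M)) y := by
  funext i
  rcases i with (a | i) | d
  · rfl
  · induction i using Fin.lastCases with
    | last => simp [reix]
    | cast j => simp [reix]
  · rfl

lemma sig1_code {α : Type} {n : ℕ} (φ : ordLang.BoundedFormula α n) (hφ : IsSigma1 φ) :
    ∃ (δ : Type) (_ : Finite δ) (A : Set (((α ⊕ Fin n) ⊕ δ) → ((α ⊕ Fin n) ⊕ δ) → Prop × Prop × Prop)),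
      ∀ β v xs, RB le1 le2 β φ v xs ↔
        ∃ y : δ → {x // x < β}, cd le1 le2 (fun i => (Sum.elim (Sum.elim v xs) y i).1) ∈ A := by
  induction hφ with
  | of_isQF h =>
    obtain ⟨A, hA⟩ := qf_code (le1 := le1) (le2 := le2) _ h
    refine ⟨Empty, inferInstance, {c | (fun i j => c (.inl i) (.inl j)) ∈ A}, fun β v xs => ?_⟩
    rw [hA]
    constructor
    · intro h; exact ⟨Empty.elim, h⟩
    · rintro ⟨y, h⟩; exact h
  | ex h ih =>
    rename_i n φ
    obtain ⟨δ, hδ, A, hA⟩ := ih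
    refine ⟨Unit ⊕ δ, inferInstance, {c | (fun i j => c (reix n i) (reix n j)) ∈ A}, fun β v xs => ?_⟩
    have : RB le1 le2 β φ.ex v xs ↔ ∃ a, RB le1 le2 β φ v (Fin.snoc xs a) := by
      letI := segStr le1 le2 β
      exact BoundedFormula.realize_ex
    rw [this]
    constructor
    · rintro ⟨a, ha⟩
      obtain ⟨y, hy⟩ := (hA _ _ _).1 ha
      refine ⟨Sum.elim (fun _ => a) y, ?_⟩
      rw [← reix_elim] at hy
      exact hy
    · rintro ⟨y, hy⟩
      refine ⟨y (.inl ()), (hA _ _ _).2 ⟨fun d => y (.inr d), ?_⟩⟩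
      rw [← reix_elim]
      have : Sum.elim (fun _ : Unit => y (.inl ())) (fun d => y (.inr d)) = y := by
        funext i; rcases i with i | i <;> rfl
      rw [this]
      exact hy

lemma pi1_code {α : Type} {n : ℕ} (φ : ordLang.BoundedFormula α n) (hφ : IsPi1 φ) :
    ∃ (δ : Type) (_ : Finite δ) (A : Set (((α ⊕ Fin n) ⊕ δ) → ((α ⊕ Fin n) ⊕ δ) → Prop × Prop × Prop)),
      ∀ β v xs, RB le1 le2 β φ v xs ↔
        ∀ y : δ → {x // x < β}, cd le1 le2 (fun i => (Sum.elim (Sum.elim v xs) y i).1) ∈ A := by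
  induction hφ with
  | of_isQF h =>
    obtain ⟨A, hA⟩ := qf_code (le1 := le1) (le2 := le2) _ h
    refine ⟨Empty, inferInstance, {c | (fun i j => c (.inl i) (.inl j)) ∈ A}, fun β v xs => ?_⟩
    rw [hA]
    constructor
    · intro h y; exact h
    · intro h; exact h Empty.elim
  | all h ih =>
    rename_i n φ
    obtain ⟨δ, hδ, A, hA⟩ := ih
    refine ⟨Unit ⊕ δ, inferInstance, {c | (fun i j => c (reix n i) (reix n j)) ∈ A}, fun β v xs => ?_⟩
    have : RB le1 le2 β φ.all v xs ↔ ∀ a, RB le1 le2 β φ v (Fin.snoc xs a) := by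
      letI := segStr le1 le2 β
      exact BoundedFormula.realize_all
    rw [this]
    constructor
    · intro ha y
      have hy := (hA _ _ _).1 (ha (y (.inl ()))) (fun d => y (.inr d))
      rw [← reix_elim] at hy
      have : Sum.elim (fun _ : Unit => y (.inl ())) (fun d => y (.inr d)) = y := by
        funext i; rcases i with i | i <;> rfl
      rw [this] at hy
      exact hy
    · intro hy a
      refine (hA _ _ _).2 fun y => ?_
      rw [← reix_elim]
      exact hy _

def reix2 {α δ ε : Type} (n : ℕ) : ((α ⊕ Fin (n+1)) ⊕ δ) ⊕ ε → ((α ⊕ Fin n) ⊕ (Unit ⊕ δ)) ⊕ ε :=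
  Sum.map (reix n) id

lemma sig2_code {α : Type} {n : ℕ} (φ : ordLang.BoundedFormula α n) (hφ : IsSigma2 φ) :
    ∃ (δ : Type) (_ : Finite δ) (ε : Type) (_ : Finite ε)
      (A : Set ((((α ⊕ Fin n) ⊕ δ) ⊕ ε) → (((α ⊕ Fin n) ⊕ δ) ⊕ ε) → Prop × Prop × Prop)),
      ∀ β v xs, RB le1 le2 β φ v xs ↔
        ∃ y : δ → {x // x < β}, ∀ w : ε → {x // x < β},
          cd le1 le2 (fun i => (Sum.elim (Sum.elim (Sum.elim v xs) y) w i).1) ∈ A := by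
  induction hφ with
  | of_isPi1 h =>
    obtain ⟨ε, hε, A, hA⟩ := pi1_code (le1 := le1) (le2 := le2) _ h
    refine ⟨Empty, inferInstance, ε, hε,
      {c | (fun i j => c (Sum.map .inl id i) (Sum.map .inl id j)) ∈ A}, fun β v xs => ?_⟩
    rw [hA]
    have key : ∀ (y : Empty → {x // x < β}) (w : ε → {x // x < β}),
      (fun i j => cd le1 le2 (fun i => (Sum.elim (Sum.elim (Sum.elim v xs) y) w i).1)
        (Sum.map .inl id i) (Sum.map .inl id j)) =
        cd le1 le2 (fun i => (Sum.elim (Sum.elim v xs) w i).1) := by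
      intro y w
      funext i j
      rcases i with i | i <;> rcases j with j | j <;> rfl
    constructor
    · intro h; refine ⟨Empty.elim, fun w => ?_⟩
      have := h w
      rw [← key Empty.elim] at this
      exact this
    · rintro ⟨y, h⟩ w
      rw [← key y]; exact h w
  | ex h ih =>
    rename_i n φ
    obtain ⟨δ, hδ, ε, hε, A, hA⟩ := ih
    refine ⟨Unit ⊕ δ, inferInstance, ε, hε,
      {c | (fun i j => c (reix2 n i) (reix2 n j)) ∈ A}, fun β v xs => ?_⟩
    have : RB le1 le2 β φ.ex v xs ↔ ∃ a, RB le1 le2 β φ v (Fin.snoc xs a) := by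
      letI := segStr le1 le2 β
      exact BoundedFormula.realize_ex
    rw [this]
    have key : ∀ a (y : δ → {x // x < β}) (w : ε → {x // x < β}),
       (fun i j => cd le1 le2 (fun i => (Sum.elim (Sum.elim (Sum.elim v xs) (Sum.elim (fun _ => a) y)) w i).1)
        (reix2 n i) (reix2 n j)) =
        cd le1 le2 (fun i => (Sum.elim (Sum.elim (Sum.elim v (Fin.snoc xs a : Fin (n+1) → {x // x < β})) y) w i).1) := by
      intro a y w
      rw [← reix_elim]
      funext i j
      rcases i with i | i <;> rcases j with j | j <;> rfl
    constructor
    · rintro ⟨a, ha⟩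
      obtain ⟨y, hy⟩ := (hA _ _ _).1 ha
      refine ⟨Sum.elim (fun _ => a) y, fun w => ?_⟩
      have := hy w
      rw [← key] at this
      exact this
    · rintro ⟨y, hy⟩
      refine ⟨y (.inl ()), (hA _ _ _).2 ⟨fun d => y (.inr d), fun w => ?_⟩⟩
      have : Sum.elim (fun _ : Unit => y (.inl ())) (fun d => y (.inr d)) = y := by
        funext i; rcases i with i | i <;> rfl
      rw [← key, this]
      exact hy w

end R2


namespace R2
open FirstOrder FirstOrder.Language
variable {le1 le2 : Ordinal → Ordinal → Prop}

lemma code_lit {α : Type} {n : ℕ} (i j : α ⊕ Fin n) (c : Prop × Prop × Prop) :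
    ∃ φ : ordLang.BoundedFormula α n, φ.IsQF ∧ ∀ β v xs, RB le1 le2 β φ v xs ↔
      cd le1 le2 (fun i => (Sum.elim v xs i).1) i j = c := by
  have lit : ∀ (R : ordRel 2) (p : Prop), ∃ φ : ordLang.BoundedFormula α n, φ.IsQF ∧
      ∀ β v xs, RB le1 le2 β φ v xs ↔
       ((segStr le1 le2 β).RelMap R ![Sum.elim v xs i, Sum.elim v xs j] ↔ p) := by
    intro R p
    have hq : (BoundedFormula.rel (L := ordLang) (α := α) (n := n) R
      ![Term.var i, Term.var j]).IsQF := BoundedFormula.IsQF.of_isAtomic (BoundedFormula.IsAtomic.rel _ _)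
    have hr : ∀ β v xs, RB le1 le2 β (BoundedFormula.rel (L := ordLang) (α := α) (n := n) R
      ![Term.var i, Term.var j]) v xs ↔ (segStr le1 le2 β).RelMap R ![Sum.elim v xs i, Sum.elim v xs j] := by
      intro β v xs
      simp only [RB, BoundedFormula.Realize]
      have : (fun k => @Term.realize ordLang _ (segStr le1 le2 β) _ (Sum.elim v xs)
        ((![Term.var i, Term.var j] : Fin 2 → ordLang.Term (α ⊕ Fin n)) k)) = ![Sum.elim v xs i, Sum.elim v xs j] := by
        funext k
        fin_cases k <;> rfl
      rw [this]
    by_cases hp : p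
    · refine ⟨_, hq, fun β v xs => ?_⟩
      rw [hr]; simp [hp]
    · refine ⟨_, hq.not, fun β v xs => ?_⟩
      have : RB le1 le2 β (BoundedFormula.not (BoundedFormula.rel (L := ordLang) (α := α) (n := n) R
      ![Term.var i, Term.var j])) v xs ↔ ¬ RB le1 le2 β ((BoundedFormula.rel (L := ordLang) (α := α) (n := n) R
      ![Term.var i, Term.var j])) v xs := Iff.rfl
      rw [this, hr]; simp [hp]
  obtain ⟨f0, h0, r0⟩ := lit .le c.1
  obtain ⟨f1, h1, r1⟩ := lit .le1 c.2.1
  obtain ⟨f2, h2, r2⟩ := lit .le2 c.2.2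
  refine ⟨f0 ⊓ (f1 ⊓ f2), h0.inf (h1.inf h2), fun β v xs => ?_⟩
  have : RB le1 le2 β (f0 ⊓ (f1 ⊓ f2)) v xs ↔ RB le1 le2 β f0 v xs ∧ RB le1 le2 β f1 v xs ∧ RB le1 le2 β f2 v xs := by
    let _ := segStr le1 le2 β
    simp only [RB]
    rw [BoundedFormula.realize_inf, BoundedFormula.realize_inf]
  rw [this, r0, r1, r2]
  obtain ⟨c0, c1, c2⟩ := c
  simp only [cd, Prod.mk.injEq, eq_iff_iff]
  exact Iff.rfl

lemma code_inf {α : Type} {n : ℕ} {ι : Type} (s : Finset ι) (Q : ι → ∀ β : Ordinal,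
    (α → {x // x < β}) → (Fin n → {x // x < β}) → Prop)
    (hQ : ∀ i, ∃ φ : ordLang.BoundedFormula α n, φ.IsQF ∧ ∀ β v xs, RB le1 le2 β φ v xs ↔ Q i β v xs) :
    ∃ φ : ordLang.BoundedFormula α n, φ.IsQF ∧ ∀ β v xs, RB le1 le2 β φ v xs ↔ ∀ i ∈ s, Q i β v xs := by
  classical
  induction s using Finset.induction_on with
  | empty => exact ⟨⊤, BoundedFormula.IsQF.top, fun β v xs => by
      let _ := segStr le1 le2 β
      simp [RB]⟩
  | insert a s ha ih =>
    obtain ⟨f, hf, rf⟩ := ih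
    obtain ⟨g, hg, rg⟩ := hQ a
    refine ⟨g ⊓ f, hg.inf hf, fun β v xs => ?_⟩
    have : RB le1 le2 β (g ⊓ f) v xs ↔ RB le1 le2 β g v xs ∧ RB le1 le2 β f v xs := by
      let _ := segStr le1 le2 β
      simp only [RB]
      rw [BoundedFormula.realize_inf]
    rw [this, rf, rg]; simp

lemma code_sup {α : Type} {n : ℕ} {ι : Type} (s : Finset ι) (Q : ι → ∀ β : Ordinal,
    (α → {x // x < β}) → (Fin n → {x // x < β}) → Prop)
    (hQ : ∀ i, ∃ φ : ordLang.BoundedFormula α n, φ.IsQF ∧ ∀ β v xs, RB le1 le2 β φ v xs ↔ Q i β v xs) :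
    ∃ φ : ordLang.BoundedFormula α n, φ.IsQF ∧ ∀ β v xs, RB le1 le2 β φ v xs ↔ ∃ i ∈ s, Q i β v xs := by
  obtain ⟨f, hf, rf⟩ := code_inf (le1 := le1) (le2 := le2) s (fun i β v xs => ¬ Q i β v xs) (fun i => by
    obtain ⟨g, hg, rg⟩ := hQ i
    refine ⟨g.not, hg.not, fun β v xs => ?_⟩
    rw [← rg]; exact Iff.rfl)
  refine ⟨f.not, hf.not, fun β v xs => ?_⟩
  have : RB le1 le2 β f.not v xs ↔ ¬ RB le1 le2 β f v xs := Iff.rfl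
  rw [this, rf]; push Not; rfl

lemma code_qf {α : Type} [Finite α] {n : ℕ} (A : Set ((α ⊕ Fin n) → (α ⊕ Fin n) → Prop × Prop × Prop)) :
    ∃ φ : ordLang.BoundedFormula α n, φ.IsQF ∧ ∀ β v xs, RB le1 le2 β φ v xs ↔
      cd le1 le2 (fun i => (Sum.elim v xs i).1) ∈ A := by
  classical
  have hA : A.Finite := Set.toFinite A
  obtain ⟨_⟩ := nonempty_fintype α
  obtain ⟨f, hf, rf⟩ := code_sup (le1 := le1) (le2 := le2) hA.toFinset
    (fun c β v xs => ∀ p ∈ (Finset.univ : Finset ((α ⊕ Fin n) × (α ⊕ Fin n))),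
      cd le1 le2 (fun i => (Sum.elim v xs i).1) p.1 p.2 = c p.1 p.2) (fun c =>
      code_inf _ _ (fun p => code_lit _ _ _))
  refine ⟨f, hf, fun β v xs => ?_⟩
  rw [rf]
  constructor
  · rintro ⟨c, hc, h⟩
    have : cd le1 le2 (fun i => (Sum.elim v xs i).1) = c := by
      funext i j; exact h (i, j) (Finset.mem_univ _)
    rw [this]; simpa using hc
  · intro h
    exact ⟨_, by simpa using h, fun p _ => rfl⟩

lemma sigma1_exs {α : Type} : ∀ {n : ℕ} (φ : ordLang.BoundedFormula α n), IsSigma1 φ → IsSigma1 φ.exs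
  | 0, φ, h => h
  | n + 1, φ, h => sigma1_exs φ.ex (.ex h)

lemma sigma2_exs {α : Type} : ∀ {n : ℕ} (φ : ordLang.BoundedFormula α n), IsSigma2 φ → IsSigma2 φ.exs
  | 0, φ, h => h
  | n + 1, φ, h => sigma2_exs φ.ex (.ex h)

lemma pi1_alls {α : Type} {d : ℕ} : ∀ {e : ℕ} (φ : ordLang.BoundedFormula α (d + e)), IsPi1 φ →
    ∃ χ : ordLang.BoundedFormula α d, IsPi1 χ ∧ ∀ β v xs, RB le1 le2 β χ v xs ↔
      ∀ ws : Fin e → {x // x < β}, RB le1 le2 β φ v (Fin.append xs ws)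
  | 0, φ, h => by
    refine ⟨φ, h, fun β v xs => ?_⟩
    have : ∀ ws : Fin 0 → {x // x < β}, Fin.append xs ws = xs := by
      intro ws; funext i
      exact Fin.append_left xs ws i
    constructor
    · intro h ws; rw [this]; exact h
    · intro h
      have h' := h Fin.elim0
      rw [this] at h'; exact h'
  | e + 1, φ, h => by
    obtain ⟨χ, hχ, r⟩ := pi1_alls (d := d) (e := e) (BoundedFormula.all (n := d + e) φ) (.all h)
    refine ⟨χ, hχ, fun β v xs => ?_⟩
    rw [r]
    have : ∀ ws, RB le1 le2 β (BoundedFormula.all (n := d + e) φ) v (Fin.append xs ws) ↔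
       ∀ a, RB le1 le2 β (n := d + e + 1) φ v (Fin.snoc (Fin.append xs ws) a) := by
      intro ws
      let _ := segStr le1 le2 β
      exact BoundedFormula.realize_all
    constructor
    · intro h ws
      have h' := (this _).1 (h (Fin.init ws)) (ws (Fin.last _))
      rw [← Fin.append_snoc, Fin.snoc_init_self] at h'
      exact h'
    · intro h ws
      rw [this]
      intro a
      rw [← Fin.append_snoc]
      exact h _

abbrev Lo (a : Ordinal) := {x : Ordinal // x < a}

/-- R1 -/
lemma le1_reflect (h : IsR2Pair le1 le2) {a b : Ordinal} (hab : le1 a b) {κ δ : Type} [Finite κ] [Finite δ]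
    (x : κ → Ordinal) (y : δ → Ordinal) (hx : ∀ i, x i < a) (hy : ∀ i, y i < b) :
    ∃ y' : δ → Ordinal, (∀ i, y' i < a) ∧ cd le1 le2 (Sum.elim x y') = cd le1 le2 (Sum.elim x y) := by
  obtain ⟨k, ⟨ek⟩⟩ := Finite.exists_equiv_fin κ
  obtain ⟨d, ⟨ed⟩⟩ := Finite.exists_equiv_fin δ
  obtain ⟨φ, hφ, rφ⟩ := code_qf (le1 := le1) (le2 := le2) (α := Fin k) (n := d)
    {c | (fun i j => c (Sum.map ek ed i) (Sum.map ek ed j)) = cd le1 le2 (Sum.elim x y)}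
  obtain ⟨hle, H⟩ := (h.1 a b).1 hab
  have H := H k φ.exs (sigma1_exs _ (.of_isQF hφ)) (fun i => ⟨x (ek.symm i), hx _⟩)
  have key : ∀ β (v : Fin k → Lo β), RealizeIn le1 le2 β φ.exs v ↔ ∃ xs, RB le1 le2 β φ v xs := by
    intro β v
    let _ := segStr le1 le2 β
    exact BoundedFormula.realize_exs
  rw [key, key] at H
  obtain ⟨xs, hxs⟩ := H.2 ⟨fun i => ⟨y (ed.symm i), hy _⟩, (rφ _ _ _).2 (by
    simp only [Set.mem_ofPred_eq]
    funext i j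
    rcases i with i | i <;> rcases j with j | j <;> simp [cd])⟩
  have h2 := (rφ _ _ _).1 hxs
  refine ⟨fun i => (xs (ed i)).1, fun i => (xs (ed i)).2, ?_⟩
  simp only [Set.mem_ofPred_eq] at h2
  rw [← h2]
  funext i j
  rcases i with i | i <;> rcases j with j | j <;> simp [cd]

/-- R2 -/
lemma le2_reflect (h : IsR2Pair le1 le2) {a b : Ordinal} (hab : le2 a b) {κ δ ε : Type} [Finite κ] [Finite δ]
    [Finite ε] (x : κ → Ordinal) (y : δ → Ordinal) (hx : ∀ i, x i < a) (hy : ∀ i, y i < b) :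
    ∃ y' : δ → Ordinal, (∀ i, y' i < a) ∧ ∀ w' : ε → Ordinal, (∀ i, w' i < a) →
      ∃ w : ε → Ordinal, (∀ i, w i < b) ∧
        cd le1 le2 (Sum.elim (Sum.elim x y') w') = cd le1 le2 (Sum.elim (Sum.elim x y) w) := by
  obtain ⟨k, ⟨ek⟩⟩ := Finite.exists_equiv_fin κ
  obtain ⟨d, ⟨ed⟩⟩ := Finite.exists_equiv_fin δ
  obtain ⟨e, ⟨ee⟩⟩ := Finite.exists_equiv_fin ε
  let r : (κ ⊕ δ) ⊕ ε → Fin k ⊕ Fin (d + e) :=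
    Sum.elim (Sum.elim (fun i => .inl (ek i)) (fun i => .inr (Fin.castAdd e (ed i))))
      (fun i => .inr (Fin.natAdd d (ee i)))
  obtain ⟨φ, hφ, rφ⟩ := code_qf (le1 := le1) (le2 := le2) (α := Fin k) (n := d + e)
    {c | ∃ w : ε → Ordinal, (∀ i, w i < b) ∧
      (fun i j => c (r i) (r j)) = cd le1 le2 (Sum.elim (Sum.elim x y) w)}
  obtain ⟨χ, hχ, rχ⟩ := pi1_alls (le1 := le1) (le2 := le2) φ (.of_isQF hφ)
  obtain ⟨hle, H⟩ := (h.2 a b).1 hab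
  have H := H k χ.exs (sigma2_exs _ (.of_isPi1 hχ)) (fun i => ⟨x (ek.symm i), hx _⟩)
  have key : ∀ β (v : Fin k → Lo β), RealizeIn le1 le2 β χ.exs v ↔ ∃ xs, RB le1 le2 β χ v xs := by
    intro β v
    let _ := segStr le1 le2 β
    exact BoundedFormula.realize_exs
  rw [key, key] at H
  obtain ⟨xs, hxs⟩ := H.2 ⟨fun i => ⟨y (ed.symm i), hy _⟩, (rχ _ _ _).2 (by
    intro ws
    refine (rφ _ _ _).2 ⟨fun i => (ws (ee i)).1, fun i => (ws (ee i)).2, ?_⟩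
    funext i j
    rcases i with (i | i) | i <;> rcases j with (j | j) | j <;> simp [cd, r])⟩
  refine ⟨fun i => (xs (ed i)).1, fun i => (xs (ed i)).2, fun w' hw' => ?_⟩
  obtain ⟨w, hw, h2⟩ := (rφ _ _ _).1 ((rχ _ _ _).1 hxs (fun i => ⟨w' (ee.symm i), hw' _⟩))
  refine ⟨w, hw, ?_⟩
  rw [← h2]
  funext i j
  rcases i with (i | i) | i <;> rcases j with (j | j) | j <;> simp [cd, r]

def Refl1 (le1 le2 : Ordinal → Ordinal → Prop) (a b : Ordinal) : Prop :=
  ∀ (κ δ : Type) [Finite κ] [Finite δ] (x : κ → Ordinal) (y : δ → Ordinal), (∀ i, x i < a) → (∀ i, y i < b) →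
    ∃ y' : δ → Ordinal, (∀ i, y' i < a) ∧ cd le1 le2 (Sum.elim x y') = cd le1 le2 (Sum.elim x y)

def Refl2 (le1 le2 : Ordinal → Ordinal → Prop) (a b : Ordinal) : Prop :=
  ∀ (κ δ ε : Type) [Finite κ] [Finite δ] [Finite ε] (x : κ → Ordinal) (y : δ → Ordinal),
    (∀ i, x i < a) → (∀ i, y i < b) →
    ∃ y' : δ → Ordinal, (∀ i, y' i < a) ∧ ∀ w' : ε → Ordinal, (∀ i, w' i < a) →
      ∃ w : ε → Ordinal, (∀ i, w i < b) ∧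
        cd le1 le2 (Sum.elim (Sum.elim x y') w') = cd le1 le2 (Sum.elim (Sum.elim x y) w)

lemma le1_of_refl (h : IsR2Pair le1 le2) {a b : Ordinal} (hab : a ≤ b) (H : Refl1 le1 le2 a b) : le1 a b := by
  rw [h.1]
  refine ⟨hab, fun k φ hφ v => ?_⟩
  obtain ⟨δ, hδ, A, hA⟩ := sig1_code (le1 := le1) (le2 := le2) φ hφ
  have key : ∀ β v, RealizeIn le1 le2 β φ v ↔ RB le1 le2 β φ v default := fun _ _ => Iff.rfl
  rw [key, key, hA, hA]
  constructor
  · rintro ⟨y, hy⟩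
    refine ⟨fun i => ⟨(y i).1, (y i).2.trans_le hab⟩, ?_⟩
    convert hy using 3 with i j
    rcases i with (i | i) | i
    · rfl
    · exact i.elim0
    · rfl
  · rintro ⟨y, hy⟩
    obtain ⟨y', hy', e⟩ := H (Fin k ⊕ Fin 0) δ (Sum.elim (fun i => (v i).1) (fun i => i.elim0)) (fun i => (y i).1)
      (by rintro (i | i); exact (v i).2; exact i.elim0) (fun i => (y i).2)
    refine ⟨fun i => ⟨y' i, hy' i⟩, ?_⟩
    convert hy using 1
    have : ∀ i j, _ := fun i j => congrFun (congrFun e i) j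
    funext i j
    have := this i j
    rcases i with (i | i) | i
    · rcases j with (j | j) | j
      · exact this
      · exact j.elim0
      · exact this
    · exact i.elim0
    · rcases j with (j | j) | j
      · exact this
      · exact j.elim0
      · exact this

lemma le2_of_refl (h : IsR2Pair le1 le2) {a b : Ordinal} (hab : a ≤ b) (H1 : Refl1 le1 le2 a b)
    (H : Refl2 le1 le2 a b) : le2 a b := by
  rw [h.2]
  refine ⟨hab, fun k φ hφ v => ?_⟩
  obtain ⟨δ, hδ, ε, hε, A, hA⟩ := sig2_code (le1 := le1) (le2 := le2) φ hφ
  have key : ∀ β v, RealizeIn le1 le2 β φ v ↔ RB le1 le2 β φ v default := fun _ _ => Iff.rfl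
  rw [key, key, hA, hA]
  constructor
  · rintro ⟨y, hy⟩
    refine ⟨fun i => ⟨(y i).1, (y i).2.trans_le hab⟩, fun w => ?_⟩
    obtain ⟨w', hw', e⟩ := H1 (Fin k ⊕ δ) ε (Sum.elim (fun i => (v i).1) (fun i => (y i).1)) (fun i => (w i).1)
      (by rintro (i | i); exact (v i).2; exact (y i).2) (fun i => (w i).2)
    convert hy (fun i => ⟨w' i, hw' i⟩) using 1
    have this : ∀ i j, _ := fun i j => congrFun (congrFun e.symm i) j
    let r : ((Fin k ⊕ Fin 0) ⊕ δ) ⊕ ε → (Fin k ⊕ δ) ⊕ ε :=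
      Sum.elim (Sum.elim (Sum.elim (fun i => .inl (.inl i)) (fun i => i.elim0)) (fun i => .inl (.inr i))) .inr
    funext i j
    have := this (r i) (r j)
    rcases i with ((i | i) | i) | i
    · rcases j with ((j | j) | j) | j
      · exact this
      · exact j.elim0
      · exact this
      · exact this
    · exact i.elim0
    · rcases j with ((j | j) | j) | j
      · exact this
      · exact j.elim0
      · exact this
      · exact this
    · rcases j with ((j | j) | j) | j
      · exact this
      · exact j.elim0
      · exact this
      · exact this
  · rintro ⟨y, hy⟩
    obtain ⟨y', hy', e⟩ := H (Fin k ⊕ Fin 0) δ ε (Sum.elim (fun i => (v i).1) (fun i => i.elim0)) (fun i => (y i).1)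
      (by rintro (i | i); exact (v i).2; exact i.elim0) (fun i => (y i).2)
    refine ⟨fun i => ⟨y' i, hy' i⟩, fun w => ?_⟩
    obtain ⟨w', hw', e⟩ := e (fun i => (w i).1) (fun i => (w i).2)
    convert hy (fun i => ⟨w' i, hw' i⟩) using 1
    have this : ∀ i j, _ := fun i j => congrFun (congrFun e i) j
    funext i j
    have := this i j
    rcases i with ((i | i) | i) | i
    · rcases j with ((j | j) | j) | j
      · exact this
      · exact j.elim0
      · exact this
      · exact this
    · exact i.elim0
    · rcases j with ((j | j) | j) | j
      · exact this
      · exact j.elim0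
      · exact this
      · exact this
    · rcases j with ((j | j) | j) | j
      · exact this
      · exact j.elim0
      · exact this
      · exact this

end R2


namespace R2
open FirstOrder FirstOrder.Language

/-- a positive copy of the pattern `(O, D1, D2, E)` strictly between `Bd` and `p`. -/
structure Copy {T : Type*} [LinearOrder T] (W1 W2 : T → T → Prop) (O : Finset ℚ) (D1 D2 : ℚ → ℚ → Prop)
    (X : Finset T) (E : T → ℚ → Prop) (p : T) (Bd : Finset T) (ν : ℚ → T) : Prop where
  lt : ∀ o ∈ O, ν o < p
  gt : ∀ o ∈ O, ∀ b ∈ Bd, b < ν o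
  mono : ∀ o ∈ O, ∀ o' ∈ O, o < o' → ν o < ν o'
  d1 : ∀ o ∈ O, ∀ o' ∈ O, D1 o o' → W1 (ν o) (ν o')
  d2 : ∀ o ∈ O, ∀ o' ∈ O, D2 o o' → W2 (ν o) (ν o')
  e : ∀ x ∈ X, ∀ o ∈ O, E x o → W2 x (ν o)

structure Tgt {T : Type*} [LinearOrder T] (W1 W2 : T → T → Prop) : Prop where
  refl : ∀ x, W2 x x
  sub21 : ∀ x y, W2 x y → W1 x y
  sub10 : ∀ x y, W1 x y → x ≤ y
  trans1 : ∀ x y z, W1 x y → W1 y z → W1 x z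
  resp1 : ∀ x y z, x ≤ y → y ≤ z → W1 x z → W1 x y
  ax1 : ∀ p r, W1 p r → ∀ (O : Finset ℚ) (y : ℚ → T), (∀ o ∈ O, p ≤ y o ∧ y o < r) →
    (∀ o ∈ O, ∀ o' ∈ O, o < o' → y o < y o') → ∀ X : Finset T, (∀ x ∈ X, x < p) →
    ∃ ν, Copy W1 W2 O (fun o o' => W1 (y o) (y o')) (fun o o' => W2 (y o) (y o')) X
      (fun x o => W2 x (y o)) p X ν
  ax2 : ∀ p r, W2 p r → ∀ (O : Finset ℚ) (y : ℚ → T), (∀ o ∈ O, p ≤ y o ∧ y o < r) →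
    (∀ o ∈ O, ∀ o' ∈ O, o < o' → y o < y o') → ∀ X : Finset T, (∀ x ∈ X, x < p) →
    ∃ ν, Copy W1 W2 O (fun o o' => W1 (y o) (y o')) (fun o o' => W2 (y o) (y o')) X
      (fun x o => W2 x (y o)) p X ν ∧ ∀ o ∈ O, W1 (y o) r → W1 (ν o) p
  ax3 : ∀ p q, W2 p q → ∀ (O : Finset ℚ) (D1 D2 : ℚ → ℚ → Prop) (X : Finset T) (E : T → ℚ → Prop),
    (∀ x ∈ X, x < p) →
    (∀ Bd : Finset T, (∀ b ∈ Bd, b < p) → ∃ ν, Copy W1 W2 O D1 D2 X E p Bd ν) →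
    ∀ Bd : Finset T, (∀ b ∈ Bd, b < q) → ∃ ν, Copy W1 W2 O D1 D2 X E q Bd ν

variable {le1 le2 : Ordinal → Ordinal → Prop}

lemma sigma1_sigma2 {α : Type} {n : ℕ} {φ : ordLang.BoundedFormula α n} (h : IsSigma1 φ) : IsSigma2 φ := by
  induction h with
  | of_isQF h => exact .of_isPi1 (.of_isQF h)
  | ex h ih => exact .ex ih

lemma ord_sub21 (h : IsR2Pair le1 le2) (x y : Ordinal) (hxy : le2 x y) : le1 x y := by
  obtain ⟨hab, H⟩ := (h.2 _ _).1 hxy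
  exact (h.1 _ _).2 ⟨hab, fun k φ hφ => H k φ (sigma1_sigma2 hφ)⟩

lemma ord_sub10 (h : IsR2Pair le1 le2) (x y : Ordinal) (hxy : le1 x y) : x ≤ y :=
  ((h.1 _ _).1 hxy).1

lemma ord_refl2 (h : IsR2Pair le1 le2) (x : Ordinal) : le2 x x :=
  (h.2 _ _).2 ⟨le_rfl, fun _ _ _ _ => Iff.rfl⟩

lemma elem_trans (C : ∀ k : ℕ, ordLang.Formula (Fin k) → Prop) (a b c : Ordinal) (h1 : ElemSub C le1 le2 a b)
   (h2 : ElemSub C le1 le2 b c) : ElemSub C le1 le2 a c := by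
  obtain ⟨l1, h1⟩ := h1
  obtain ⟨l2, h2⟩ := h2
  exact ⟨l1.trans l2, fun k φ hφ v => (h1 k φ hφ v).trans (h2 k φ hφ _)⟩

lemma ord_trans1 (h : IsR2Pair le1 le2) (x y z : Ordinal) (h1 : le1 x y) (h2 : le1 y z) : le1 x z :=
  (h.1 _ _).2 (elem_trans _ _ _ _ ((h.1 _ _).1 h1) ((h.1 _ _).1 h2))

lemma ord_trans2 (h : IsR2Pair le1 le2) (x y z : Ordinal) (h1 : le2 x y) (h2 : le2 y z) : le2 x z :=
  (h.2 _ _).2 (elem_trans _ _ _ _ ((h.2 _ _).1 h1) ((h.2 _ _).1 h2))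

lemma ord_resp1 (h : IsR2Pair le1 le2) (x y z : Ordinal) (h1 : x ≤ y) (h2 : y ≤ z) (h3 : le1 x z) : le1 x y :=
  le1_of_refl h h1 fun _ _ _ _ u v hu hv => le1_reflect h h3 u v hu (fun i => (hv i).trans_le h2)

lemma cd_iff {ι : Type} {u v : ι → Ordinal} (h : cd le1 le2 u = cd le1 le2 v) (i j : ι) :
    (u i ≤ u j ↔ v i ≤ v j) ∧ (u i < u j ↔ v i < v j) ∧ (le1 (u i) (u j) ↔ le1 (v i) (v j)) ∧ (le2 (u i) (u j) ↔ le2 (v i) (v j)) := by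
  have h1 := congrFun (congrFun h i) j
  have h2 := congrFun (congrFun h j) i
  simp only [cd, Prod.mk.injEq, eq_iff_iff] at h1 h2
  refine ⟨h1.1, ?_, h1.2.1, h1.2.2⟩
  rw [← not_le, ← not_le, h2.1]

lemma ord_above (h : IsR2Pair le1 le2) {p r : Ordinal} (hpr : le1 p r) (hlt : p < r) {κ : Type} [Finite κ]
    (x : κ → Ordinal) (hx : ∀ i, x i < p) : ∃ z < p, ∀ i, x i < z := by
  obtain ⟨y', hy', e⟩ := le1_reflect h hpr x (fun _ : Unit => p) hx (fun _ => hlt)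
  exact ⟨y' (), hy' (), fun i => (cd_iff e (.inl i) (.inr ())).2.1.2 (hx i)⟩

open Classical in
lemma ord_ax1 (h : IsR2Pair le1 le2) (p r : Ordinal) (hpr : le1 p r) (O : Finset ℚ) (y : ℚ → Ordinal)
    (hy : ∀ o ∈ O, p ≤ y o ∧ y o < r)
    (hm : ∀ o ∈ O, ∀ o' ∈ O, o < o' → y o < y o') (X : Finset Ordinal) (hX : ∀ x ∈ X, x < p) :
    ∃ ν, Copy le1 le2 O (fun o o' => le1 (y o) (y o')) (fun o o' => le2 (y o) (y o')) X
      (fun x o => le2 x (y o)) p X ν := by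
  obtain ⟨n, ⟨eX⟩⟩ := Finite.exists_equiv_fin {x // x ∈ X}
  obtain ⟨y', hy', e⟩ := le1_reflect h hpr (fun i : Fin n => (eX.symm i).1) (fun o : {o // o ∈ O} => y o.1)
    (fun i => hX _ (eX.symm i).2) (fun i => (hy _ i.2).2)
  have hx : ∀ x ∈ X, ∃ i, (eX.symm i).1 = x := fun x hx => ⟨eX ⟨x, hx⟩, by simp⟩
  refine ⟨fun o => if ho : o ∈ O then y' ⟨o, ho⟩ else p, ?_, ?_, ?_, ?_, ?_, ?_⟩
  · intro o ho; simp only [ho, dite_true]; exact hy' _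
  · intro o ho x hxX; simp only [ho, dite_true]
    obtain ⟨i, rfl⟩ := hx x hxX
    exact (cd_iff e (.inl i) (.inr ⟨o, ho⟩)).2.1.2 ((hX _ hxX).trans_le (hy o ho).1)
  · intro o ho o' ho' hoo; simp only [ho, ho', dite_true]
    exact (cd_iff e (.inr ⟨o, ho⟩) (.inr ⟨o', ho'⟩)).2.1.2 (hm o ho o' ho' hoo)
  · intro o ho o' ho' hoo; simp only [ho, ho', dite_true]
    exact (cd_iff e (.inr ⟨o, ho⟩) (.inr ⟨o', ho'⟩)).2.2.1.2 hoo
  · intro o ho o' ho' hoo; simp only [ho, ho', dite_true]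
    exact (cd_iff e (.inr ⟨o, ho⟩) (.inr ⟨o', ho'⟩)).2.2.2.2 hoo
  · intro x hxX o ho hxo; simp only [ho, dite_true]
    obtain ⟨i, rfl⟩ := hx x hxX
    exact (cd_iff e (.inl i) (.inr ⟨o, ho⟩)).2.2.2.2 hxo

/-- marks -/
lemma ord_marks (h : IsR2Pair le1 le2) {p r : Ordinal} (hpr : le2 p r) (hlt : p < r) {κ δ : Type}
    [Finite κ] [Finite δ] (x : κ → Ordinal) (y : δ → Ordinal) (hx : ∀ i, x i < p) (hy : ∀ i, y i < r) :
    ∃ y' : δ → Ordinal, (∀ i, y' i < p) ∧ cd le1 le2 (Sum.elim x y') = cd le1 le2 (Sum.elim x y) ∧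
      ∀ i, le1 (y i) r → le1 (y' i) p := by
  obtain ⟨y', hy', H⟩ := le2_reflect h hpr (ε := Unit) x y hx hy
  have hp1 := ord_sub21 h _ _ hpr
  obtain ⟨z0, hz0, -⟩ := ord_above h hp1 hlt y' hy'
  refine ⟨y', hy', ?_, fun i hi => ?_⟩
  · obtain ⟨w, hw, e⟩ := H (fun _ => z0) (fun _ => hz0)
    funext i j
    have := congrFun (congrFun e (.inl i)) (.inl j)
    rcases i with i | i <;> rcases j with j | j <;> exact this
  · have key : ∀ w', y' i ≤ w' → w' < p → le1 (y' i) w' := by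
      intro w' h1 h2
      obtain ⟨w, hw, e⟩ := H (fun _ => w') (fun _ => h2)
      have := cd_iff e (.inl (.inr i)) (.inr ())
      exact this.2.2.1.2 (ord_resp1 h _ _ _ (this.1.1 h1) (hw ()).le hi)
    refine le1_of_refl h (hy' i).le fun κ' δ' _ _ u v hu hv => ?_
    obtain ⟨z, hz, hz'⟩ := ord_above h hp1 hlt (Sum.elim v (fun _ : Unit => y' i))
      (by rintro (j | j); exact hv j; exact hy' i)
    exact le1_reflect h (key z (hz' (.inr ())).le hz) u v hu (fun j => hz' (.inl j))

open Classical in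
lemma ord_ax2 (h : IsR2Pair le1 le2) (p r : Ordinal) (hpr : le2 p r) (O : Finset ℚ) (y : ℚ → Ordinal)
    (hy : ∀ o ∈ O, p ≤ y o ∧ y o < r)
    (hm : ∀ o ∈ O, ∀ o' ∈ O, o < o' → y o < y o') (X : Finset Ordinal) (hX : ∀ x ∈ X, x < p) :
    ∃ ν, Copy le1 le2 O (fun o o' => le1 (y o) (y o')) (fun o o' => le2 (y o) (y o')) X
      (fun x o => le2 x (y o)) p X ν ∧ ∀ o ∈ O, le1 (y o) r → le1 (ν o) p := by
  rcases (ord_sub10 h _ _ (ord_sub21 h _ _ hpr)).eq_or_lt with rfl | hlt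
  · have : O = ∅ := by
      by_contra hne
      obtain ⟨o, ho⟩ := Finset.nonempty_iff_ne_empty.2 hne
      exact absurd (hy o ho).2 (not_lt.2 (hy o ho).1)
    subst this
    exact ⟨fun _ => p, ⟨by simp, by simp, by simp, by simp, by simp, by simp⟩, by simp⟩
  obtain ⟨n, ⟨eX⟩⟩ := Finite.exists_equiv_fin {x // x ∈ X}
  obtain ⟨y', hy', e, hmk⟩ := ord_marks h hpr hlt (fun i : Fin n => (eX.symm i).1) (fun o : {o // o ∈ O} => y o.1)
    (fun i => hX _ (eX.symm i).2) (fun i => (hy _ i.2).2)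
  have hx : ∀ x ∈ X, ∃ i, (eX.symm i).1 = x := fun x hx => ⟨eX ⟨x, hx⟩, by simp⟩
  refine ⟨fun o => if ho : o ∈ O then y' ⟨o, ho⟩ else p, ⟨?_, ?_, ?_, ?_, ?_, ?_⟩, ?_⟩
  · intro o ho; simp only [ho, dite_true]; exact hy' _
  · intro o ho x hxX; simp only [ho, dite_true]
    obtain ⟨i, rfl⟩ := hx x hxX
    exact (cd_iff e (.inl i) (.inr ⟨o, ho⟩)).2.1.2 ((hX _ hxX).trans_le (hy o ho).1)
  · intro o ho o' ho' hoo; simp only [ho, ho', dite_true]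
    exact (cd_iff e (.inr ⟨o, ho⟩) (.inr ⟨o', ho'⟩)).2.1.2 (hm o ho o' ho' hoo)
  · intro o ho o' ho' hoo; simp only [ho, ho', dite_true]
    exact (cd_iff e (.inr ⟨o, ho⟩) (.inr ⟨o', ho'⟩)).2.2.1.2 hoo
  · intro o ho o' ho' hoo; simp only [ho, ho', dite_true]
    exact (cd_iff e (.inr ⟨o, ho⟩) (.inr ⟨o', ho'⟩)).2.2.2.2 hoo
  · intro x hxX o ho hxo; simp only [ho, dite_true]
    obtain ⟨i, rfl⟩ := hx x hxX
    exact (cd_iff e (.inl i) (.inr ⟨o, ho⟩)).2.2.2.2 hxo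
  · intro o ho hor; simp only [ho, dite_true]
    exact hmk ⟨o, ho⟩ hor

open Classical in
lemma ord_ax3 (h : IsR2Pair le1 le2) (p q : Ordinal) (hpq : le2 p q) (O : Finset ℚ) (D1 D2 : ℚ → ℚ → Prop)
    (X : Finset Ordinal) (E : Ordinal → ℚ → Prop) (hX : ∀ x ∈ X, x < p)
    (hc : ∀ Bd : Finset Ordinal, (∀ b ∈ Bd, b < p) → ∃ ν, Copy le1 le2 O D1 D2 X E p Bd ν)
    (Bd : Finset Ordinal) (hBd : ∀ b ∈ Bd, b < q) : ∃ ν, Copy le1 le2 O D1 D2 X E q Bd ν := by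
  obtain ⟨n, ⟨eX⟩⟩ := Finite.exists_equiv_fin {x // x ∈ X}
  obtain ⟨m, ⟨eB⟩⟩ := Finite.exists_equiv_fin {x // x ∈ Bd}
  obtain ⟨y', hy', H⟩ := le2_reflect h hpq (ε := {o // o ∈ O}) (fun i : Fin n => (eX.symm i).1)
    (fun i : Fin m => (eB.symm i).1) (fun i => hX _ (eX.symm i).2) (fun i => hBd _ (eB.symm i).2)
  have hx : ∀ x ∈ X, ∃ i, (eX.symm i).1 = x := fun x hx => ⟨eX ⟨x, hx⟩, by simp⟩
  have hb : ∀ x ∈ Bd, ∃ i, (eB.symm i).1 = x := fun x hx => ⟨eB ⟨x, hx⟩, by simp⟩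
  obtain ⟨ν, hν⟩ := hc (Finset.univ.image y') (by simpa using hy')
  obtain ⟨w, hw, e⟩ := H (fun o => ν o.1) (fun o => hν.lt _ o.2)
  refine ⟨fun o => if ho : o ∈ O then w ⟨o, ho⟩ else p, ?_, ?_, ?_, ?_, ?_, ?_⟩
  · intro o ho; simp only [ho, dite_true]; exact hw _
  · intro o ho x hxX; simp only [ho, dite_true]
    obtain ⟨i, rfl⟩ := hb x hxX
    exact (cd_iff e (.inl (.inr i)) (.inr ⟨o, ho⟩)).2.1.1 (hν.gt o ho _ (by simp))
  · intro o ho o' ho' hoo; simp only [ho, ho', dite_true]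
    exact (cd_iff e (.inr ⟨o, ho⟩) (.inr ⟨o', ho'⟩)).2.1.1 (hν.mono o ho o' ho' hoo)
  · intro o ho o' ho' hoo; simp only [ho, ho', dite_true]
    exact (cd_iff e (.inr ⟨o, ho⟩) (.inr ⟨o', ho'⟩)).2.2.1.1 (hν.d1 o ho o' ho' hoo)
  · intro o ho o' ho' hoo; simp only [ho, ho', dite_true]
    exact (cd_iff e (.inr ⟨o, ho⟩) (.inr ⟨o', ho'⟩)).2.2.2.1 (hν.d2 o ho o' ho' hoo)
  · intro x hxX o ho hxo; simp only [ho, dite_true]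
    have := hν.e x hxX o ho hxo
    obtain ⟨i, rfl⟩ := hx x hxX
    exact (cd_iff e (.inl (.inl i)) (.inr ⟨o, ho⟩)).2.2.2.1 this

lemma ord_tgt (h : IsR2Pair le1 le2) : Tgt le1 le2 where
  refl := ord_refl2 h
  sub21 := ord_sub21 h
  sub10 := ord_sub10 h
  trans1 := ord_trans1 h
  resp1 := ord_resp1 h
  ax1 := ord_ax1 h
  ax2 := ord_ax2 h
  ax3 := ord_ax3 h

end R2

namespace R2

inductive Task
  | t1 (q r : ℚ) | t2 (q r : ℚ) | t3 (p q : ℚ) (l : ℕ)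

def young (S : ℕ → Finset ℚ) (l n : ℕ) (p : ℚ) : Finset ℚ :=
  (S n).filter (fun x => x < p ∧ ∀ y ∈ S l, y < p → y < x)

def Task.place : Task → ℚ
  | .t1 q _ => q
  | .t2 q _ => q
  | .t3 _ q _ => q

def Task.O (S : ℕ → Finset ℚ) (n : ℕ) : Task → Finset ℚ
  | .t1 q r => (S n).filter (fun x => q ≤ x ∧ x < r)
  | .t2 q r => (S n).filter (fun x => q ≤ x ∧ x < r)
  | .t3 p _ l => young S l n p

def Task.low (S : ℕ → Finset ℚ) : Task → ℚ → Prop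
  | .t1 q _ => fun x => x < q
  | .t2 q _ => fun x => x < q
  | .t3 p _ l => fun x => ∃ y ∈ S l, y < p ∧ x ≤ y

def Task.mu (R1 : ℚ → ℚ → Prop) : Task → ℚ → Prop
  | .t1 _ _ => fun _ => False
  | .t2 _ r => fun o => R1 o r
  | .t3 _ _ _ => fun _ => False

def Task.Valid (S : ℕ → Finset ℚ) (R1 R2 : ℚ → ℚ → Prop) (n : ℕ) : Task → Prop
  | .t1 q r => q ∈ S n ∧ r ∈ S n ∧ q < r ∧ R1 q r
  | .t2 q r => q ∈ S n ∧ r ∈ S n ∧ q < r ∧ R2 q r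
  | .t3 p q l => l ≤ n ∧ p ∈ S l ∧ q ∈ S n ∧ p < q ∧ R2 p q

structure IsStep (S : ℕ → Finset ℚ) (R1 R2 : ℚ → ℚ → Prop) (n : ℕ) (τ : Task) (f : ℚ → ℚ) : Prop where
  valid : τ.Valid S R1 R2 n
  mono : StrictMono f
  lt : ∀ o, f o < τ.place
  gt : ∀ o, ∀ x ∈ S n, x < τ.place → x < f o
  S_eq : S (n + 1) = S n ∪ (τ.O S n).image f
  F1 : ∀ x ∈ S n, ∀ o ∈ τ.O S n, (R1 x (f o) ↔ x < τ.place ∧ R1 x τ.place)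
  F2 : ∀ x ∈ S n, ∀ o ∈ τ.O S n, (R2 x (f o) ↔ x < τ.place ∧ τ.low S x ∧ R2 x o)
  F31 : ∀ o ∈ τ.O S n, ∀ o' ∈ τ.O S n, (R1 (f o) (f o') ↔ R1 o o')
  F32 : ∀ o ∈ τ.O S n, ∀ o' ∈ τ.O S n, (R2 (f o) (f o') ↔ R2 o o')
  F4 : ∀ y ∈ S n, ∀ o ∈ τ.O S n, (R1 (f o) y ↔ τ.place ≤ y ∧ τ.mu R1 o ∧ R1 τ.place y)
  F5 : ∀ y ∈ S n, ∀ o ∈ τ.O S n, ¬ R2 (f o) y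

structure Gen (M : ℕ) where
  S : ℕ → Finset ℚ
  R1 : ℚ → ℚ → Prop
  R2 : ℚ → ℚ → Prop
  S0 : S 0 = (Finset.range M).image (fun i : ℕ => (i : ℚ))
  R10 : ∀ x ∈ S 0, ∀ y ∈ S 0, (R1 x y ↔ x ≤ y)
  R20 : ∀ x ∈ S 0, ∀ y ∈ S 0, (R2 x y ↔ x ≤ y)
  step : ∀ n, S (n + 1) = S n ∨ ∃ τ f, IsStep S R1 R2 n τ f
  fair : ∀ τ m, Task.Valid S R1 R2 m τ → ∃ n ≥ m, ∃ f, IsStep S R1 R2 n τ f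

structure St where
  S : ℕ → Finset ℚ
  r1 : ℚ → ℚ → Prop
  r2 : ℚ → ℚ → Prop

lemma exists_f (F : Finset ℚ) (q : ℚ) : ∃ f : ℚ → ℚ, StrictMono f ∧ (∀ o, f o < q) ∧
    ∀ o, ∀ x ∈ F, x < q → x < f o := by
  obtain ⟨b, hb, hb'⟩ : ∃ b < q, ∀ x ∈ F, x < q → x ≤ b := by
    by_cases h : (F.filter (· < q)).Nonempty
    · refine ⟨(F.filter (· < q)).max' h, ?_, fun x hx hxq => Finset.le_max' _ _ (by simp [hx, hxq])⟩
      have := Finset.max'_mem _ h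
      simp only [Finset.mem_filter] at this
      exact this.2
    · refine ⟨q - 1, by linarith, fun x hx hxq => ?_⟩
      exact absurd ⟨x, by simp [hx, hxq]⟩ h
  have : Nontrivial (Set.Ioo b q) := by
    obtain ⟨c, h1, h2⟩ := exists_between hb
    obtain ⟨d, h3, h4⟩ := exists_between h1
    exact ⟨⟨c, h1, h2⟩, ⟨d, h3, h4.trans h2⟩, fun e => by
      have := congrArg Subtype.val e
      simp only at this
      linarith⟩
  obtain ⟨e⟩ := Order.embedding_from_countable_to_dense ℚ (Set.Ioo b q)
  exact ⟨fun o => (e o).1, fun x y h => e.strictMono h, fun o => (e o).2.2,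
    fun o x hx hxq => (hb' x hx hxq).trans_lt (e o).2.1⟩

noncomputable def ff (F : Finset ℚ) (q : ℚ) : ℚ → ℚ := (exists_f F q).choose

open Classical in
noncomputable def nextS (n : ℕ) (s : St) (τ : Task) : St :=
  if τ.Valid s.S s.r1 s.r2 n then
    { S := fun m => if m ≤ n then s.S m else s.S n ∪ (τ.O s.S n).image (ff (s.S n) τ.place)
      r1 := fun x y => s.r1 x y ∨
        (∃ o ∈ τ.O s.S n, y = ff (s.S n) τ.place o ∧ x ∈ s.S n ∧ x < τ.place ∧ s.r1 x τ.place) ∨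
        (∃ o ∈ τ.O s.S n, ∃ o' ∈ τ.O s.S n, x = ff (s.S n) τ.place o ∧ y = ff (s.S n) τ.place o' ∧ s.r1 o o') ∨
        (∃ o ∈ τ.O s.S n, x = ff (s.S n) τ.place o ∧ y ∈ s.S n ∧ τ.place ≤ y ∧ τ.mu s.r1 o ∧ s.r1 τ.place y)
      r2 := fun x y => s.r2 x y ∨
        (∃ o ∈ τ.O s.S n, y = ff (s.S n) τ.place o ∧ x ∈ s.S n ∧ x < τ.place ∧ τ.low s.S x ∧ s.r2 x o) ∨
        (∃ o ∈ τ.O s.S n, ∃ o' ∈ τ.O s.S n, x = ff (s.S n) τ.place o ∧ y = ff (s.S n) τ.place o' ∧ s.r2 o o') }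
  else { S := fun m => if m ≤ n then s.S m else s.S n, r1 := s.r1, r2 := s.r2 }

noncomputable def stS (M : ℕ) (t : ℕ → Task) : ℕ → St
  | 0 => { S := fun _ => (Finset.range M).image (fun i : ℕ => (i : ℚ))
           r1 := fun x y => x ∈ (Finset.range M).image (fun i : ℕ => (i : ℚ)) ∧
            y ∈ (Finset.range M).image (fun i : ℕ => (i : ℚ)) ∧ x ≤ y
           r2 := fun x y => x ∈ (Finset.range M).image (fun i : ℕ => (i : ℚ)) ∧
            y ∈ (Finset.range M).image (fun i : ℕ => (i : ℚ)) ∧ x ≤ y }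
  | n + 1 => nextS n (stS M t n) (t n)

lemma Task.O_sub (S : ℕ → Finset ℚ) (n : ℕ) (τ : Task) : τ.O S n ⊆ S n := by
  cases τ <;> exact Finset.filter_subset _ _

lemma nextS_S (n : ℕ) (s : St) (τ : Task) (m : ℕ) (h : m ≤ n) : (nextS n s τ).S m = s.S m := by
  unfold nextS; split_ifs <;> simp [h]

def Sup (s : St) (n : ℕ) : Prop := ∀ x y, (s.r1 x y ∨ s.r2 x y) → x ∈ s.S n ∧ y ∈ s.S n

lemma ff_notMem (F : Finset ℚ) (q o : ℚ) : ff F q o ∉ F := by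
  intro h
  have h2 := (exists_f F q).choose_spec
  exact lt_irrefl _ (h2.2.2 o _ h (h2.2.1 o))

lemma nextS_Sub (n : ℕ) (s : St) (τ : Task) : s.S n ⊆ (nextS n s τ).S (n + 1) := by
  classical
  unfold nextS; split_ifs
  · simp
  · simp

lemma Task.O_sub' {S : ℕ → Finset ℚ} {n : ℕ} {τ : Task} {o : ℚ} (h : o ∈ τ.O S n) : o ∈ S n :=
  Task.O_sub S n τ h

lemma Task.place_mem {S : ℕ → Finset ℚ} {R1 R2 : ℚ → ℚ → Prop} {n : ℕ} {τ : Task}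
    (h : τ.Valid S R1 R2 n) : τ.place ∈ S n := by
  cases τ with
  | t1 q r => exact h.1
  | t2 q r => exact h.1
  | t3 p q l => exact h.2.2.1

lemma nextS_sup (n : ℕ) (s : St) (τ : Task) (hs : Sup s n) : Sup (nextS n s τ) (n + 1) := by
  classical
  intro x y h
  unfold nextS at h ⊢
  split_ifs at h ⊢ with hv
  · simp only [Nat.not_succ_le_self, if_false, Finset.mem_union, Finset.mem_image]
    rcases h with (h | ⟨o, ho, rfl, hx, -⟩ | ⟨o, ho, o', ho', rfl, rfl, -⟩ | ⟨o, ho, rfl, hx, -⟩) |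
      (h | ⟨o, ho, rfl, hx, -⟩ | ⟨o, ho, o', ho', rfl, rfl, -⟩)
    · exact ⟨.inl (hs _ _ (.inl h)).1, .inl (hs _ _ (.inl h)).2⟩
    · exact ⟨.inl hx, .inr ⟨o, ho, rfl⟩⟩
    · exact ⟨.inr ⟨o, ho, rfl⟩, .inr ⟨o', ho', rfl⟩⟩
    · exact ⟨.inr ⟨o, ho, rfl⟩, .inl hx⟩
    · exact ⟨.inl (hs _ _ (.inr h)).1, .inl (hs _ _ (.inr h)).2⟩
    · exact ⟨.inl hx, .inr ⟨o, ho, rfl⟩⟩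
    · exact ⟨.inr ⟨o, ho, rfl⟩, .inr ⟨o', ho', rfl⟩⟩
  · simp only [Nat.not_succ_le_self, if_false]
    exact hs _ _ h

lemma nextS_old (n : ℕ) (s : St) (τ : Task) (x y : ℚ) (hx : x ∈ s.S n) (hy : y ∈ s.S n) :
    ((nextS n s τ).r1 x y ↔ s.r1 x y) ∧ ((nextS n s τ).r2 x y ↔ s.r2 x y) := by
  classical
  unfold nextS
  split_ifs with hv
  · refine ⟨⟨?_, .inl⟩, ⟨?_, .inl⟩⟩
    · rintro (h | ⟨o, ho, rfl, -⟩ | ⟨o, ho, o', ho', rfl, -⟩ | ⟨o, ho, rfl, -⟩)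
      · exact h
      · exact absurd hy (ff_notMem _ _ _)
      · exact absurd hx (ff_notMem _ _ _)
      · exact absurd hx (ff_notMem _ _ _)
    · rintro (h | ⟨o, ho, rfl, -⟩ | ⟨o, ho, o', ho', rfl, -⟩)
      · exact h
      · exact absurd hy (ff_notMem _ _ _)
      · exact absurd hx (ff_notMem _ _ _)
  · exact ⟨Iff.rfl, Iff.rfl⟩

lemma nextS_step (n : ℕ) (s : St) (τ : Task) (hs : Sup s n) (hv : τ.Valid s.S s.r1 s.r2 n) :
    IsStep (nextS n s τ).S (nextS n s τ).r1 (nextS n s τ).r2 n τ (ff (s.S n) τ.place) := by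
  classical
  have hf := (exists_f (s.S n) τ.place).choose_spec
  have eS : ∀ m ≤ n, (nextS n s τ).S m = s.S m := fun m h => nextS_S n s τ m h
  have eO : τ.O (nextS n s τ).S n = τ.O s.S n := by
    cases τ with
    | t1 q r => simp [Task.O, eS]
    | t2 q r => simp [Task.O, eS]
    | t3 p q l => simp [Task.O, young, eS n le_rfl, eS l hv.1]
  have eL : τ.low (nextS n s τ).S = τ.low s.S := by
    cases τ with
    | t1 q r => rfl
    | t2 q r => rfl
    | t3 p q l => simp [Task.low, eS l hv.1]
  have hold := fun x y hx hy => nextS_old n s τ x y hx hy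
  have hpl : τ.place ∈ s.S n := Task.place_mem hv
  have emu : ∀ o ∈ τ.O s.S n, (τ.mu (nextS n s τ).r1 o ↔ τ.mu s.r1 o) := by
    intro o ho
    cases τ with
    | t1 q r => rfl
    | t2 q r => exact (hold o r (Task.O_sub' ho) hv.2.1).1
    | t3 p q l => rfl
  have ev : τ.Valid (nextS n s τ).S (nextS n s τ).r1 (nextS n s τ).r2 n := by
    cases τ with
    | t1 q r =>
      simp only [Task.Valid, eS n le_rfl]
      exact ⟨hv.1, hv.2.1, hv.2.2.1, (hold _ _ hv.1 hv.2.1).1.2 hv.2.2.2⟩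
    | t2 q r =>
      simp only [Task.Valid, eS n le_rfl]
      exact ⟨hv.1, hv.2.1, hv.2.2.1, (hold _ _ hv.1 hv.2.1).2.2 hv.2.2.2⟩
    | t3 p q l =>
      simp only [Task.Valid, eS n le_rfl, eS l hv.1]
      refine ⟨hv.1, hv.2.1, hv.2.2.1, hv.2.2.2.1, ?_⟩
      have := hv.2.2.2.2
      exact (hold _ _ (hs _ _ (.inr this)).1 (hs _ _ (.inr this)).2).2.2 this
  have inj : Function.Injective (ff (s.S n) τ.place) := hf.1.injective
  have nm := ff_notMem (s.S n) τ.place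
  have e1 : ∀ x y, (nextS n s τ).r1 x y ↔ (s.r1 x y ∨
        (∃ o ∈ τ.O s.S n, y = ff (s.S n) τ.place o ∧ x ∈ s.S n ∧ x < τ.place ∧ s.r1 x τ.place) ∨
        (∃ o ∈ τ.O s.S n, ∃ o' ∈ τ.O s.S n, x = ff (s.S n) τ.place o ∧ y = ff (s.S n) τ.place o' ∧ s.r1 o o') ∨
        (∃ o ∈ τ.O s.S n, x = ff (s.S n) τ.place o ∧ y ∈ s.S n ∧ τ.place ≤ y ∧ τ.mu s.r1 o ∧ s.r1 τ.place y)) := by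
    intro x y
    rw [nextS, if_pos hv]
  have e2 : ∀ x y, (nextS n s τ).r2 x y ↔ (s.r2 x y ∨
        (∃ o ∈ τ.O s.S n, y = ff (s.S n) τ.place o ∧ x ∈ s.S n ∧ x < τ.place ∧ τ.low s.S x ∧ s.r2 x o) ∨
        (∃ o ∈ τ.O s.S n, ∃ o' ∈ τ.O s.S n, x = ff (s.S n) τ.place o ∧ y = ff (s.S n) τ.place o' ∧ s.r2 o o')) := by
    intro x y
    rw [nextS, if_pos hv]
  have n1 : ∀ o y, ¬ s.r1 (ff (s.S n) τ.place o) y := fun o y h => nm _ (hs _ _ (.inl h)).1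
  have n2 : ∀ o y, ¬ s.r1 y (ff (s.S n) τ.place o) := fun o y h => nm _ (hs _ _ (.inl h)).2
  have n3 : ∀ o y, ¬ s.r2 (ff (s.S n) τ.place o) y := fun o y h => nm _ (hs _ _ (.inr h)).1
  have n4 : ∀ o y, ¬ s.r2 y (ff (s.S n) τ.place o) := fun o y h => nm _ (hs _ _ (.inr h)).2
  refine ⟨ev, hf.1, hf.2.1, ?_, ?_, ?_, ?_, ?_, ?_, ?_, ?_⟩
  · rw [eS n le_rfl]; exact hf.2.2
  · rw [eO, eS n le_rfl, nextS, if_pos hv]; simp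
  · rw [eO, eS n le_rfl]
    intro x hx o ho
    rw [e1, (hold x _ hx hpl).1]
    constructor
    · rintro (h | ⟨o', ho', he, -, h⟩ | ⟨o', ho', o'', ho'', rfl, -⟩ | ⟨o', ho', rfl, -⟩)
      · exact absurd h (n2 _ _)
      · exact h
      · exact absurd hx (nm _)
      · exact absurd hx (nm _)
    · intro h
      exact .inr (.inl ⟨o, ho, rfl, hx, h⟩)
  · rw [eO, eS n le_rfl, eL]
    intro x hx o ho
    rw [e2, (hold x _ hx (Task.O_sub' ho)).2]
    constructor
    · rintro (h | ⟨o', ho', he, -, h⟩ | ⟨o', ho', o'', ho'', rfl, -⟩)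
      · exact absurd h (n4 _ _)
      · rw [inj he]; exact h
      · exact absurd hx (nm _)
    · intro h
      exact .inr (.inl ⟨o, ho, rfl, hx, h⟩)
  · rw [eO]
    intro o ho o' ho'
    rw [e1, (hold o o' (Task.O_sub' ho) (Task.O_sub' ho')).1]
    constructor
    · rintro (h | ⟨_, _, he, h, -⟩ | ⟨o1, ho1, o2, ho2, h1, h2, h⟩ | ⟨_, _, he, h, -⟩)
      · exact absurd h (n1 _ _)
      · exact absurd h (nm _)
      · rw [inj h1, inj h2]; exact h
      · exact absurd h (nm _)
    · intro h
      exact .inr (.inr (.inl ⟨o, ho, o', ho', rfl, rfl, h⟩))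
  · rw [eO]
    intro o ho o' ho'
    rw [e2, (hold o o' (Task.O_sub' ho) (Task.O_sub' ho')).2]
    constructor
    · rintro (h | ⟨_, _, he, h, -⟩ | ⟨o1, ho1, o2, ho2, h1, h2, h⟩)
      · exact absurd h (n3 _ _)
      · exact absurd h (nm _)
      · rw [inj h1, inj h2]; exact h
    · intro h
      exact .inr (.inr ⟨o, ho, o', ho', rfl, rfl, h⟩)
  · rw [eO, eS n le_rfl]
    intro y hy o ho
    rw [e1, (hold _ y hpl hy).1, emu o ho]
    constructor
    · rintro (h | ⟨o', ho', rfl, -⟩ | ⟨o', ho', o'', ho'', -, rfl, -⟩ | ⟨o', ho', he, -, h⟩)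
      · exact absurd h (n1 _ _)
      · exact absurd hy (nm _)
      · exact absurd hy (nm _)
      · rw [inj he]; exact h
    · intro h
      exact .inr (.inr (.inr ⟨o, ho, rfl, hy, h⟩))
  · rw [eO, eS n le_rfl]
    intro y hy o ho
    rw [e2]
    rintro (h | ⟨o', ho', rfl, -⟩ | ⟨o', ho', o'', ho'', -, rfl, -⟩)
    · exact absurd h (n3 _ _)
    · exact absurd hy (nm _)
    · exact absurd hy (nm _)

lemma IsStep.congr {S S' : ℕ → Finset ℚ} {R1 R2 R1' R2' : ℚ → ℚ → Prop} {n : ℕ} {τ : Task} {f : ℚ → ℚ}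
    (h : IsStep S R1 R2 n τ f) (hS : ∀ m ≤ n + 1, S' m = S m) (hsub : S n ⊆ S (n+1))
    (h1 : ∀ x ∈ S (n+1), ∀ y ∈ S (n+1), (R1' x y ↔ R1 x y))
    (h2 : ∀ x ∈ S (n+1), ∀ y ∈ S (n+1), (R2' x y ↔ R2 x y))
    (hv : τ.Valid S' R1' R2' n) : IsStep S' R1' R2' n τ f := by
  have eS : ∀ m ≤ n, S' m = S m := fun m h => hS m (by omega)
  have eO : τ.O S' n = τ.O S n := by
    cases τ with
    | t1 q r => simp [Task.O, eS]
    | t2 q r => simp [Task.O, eS]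
    | t3 p q l => simp [Task.O, young, eS n le_rfl, eS l hv.1]
  have eL : τ.low S' = τ.low S := by
    cases τ with
    | t1 q r => rfl
    | t2 q r => rfl
    | t3 p q l => simp [Task.low, eS l hv.1]
  have hpl : τ.place ∈ S (n+1) := hsub (Task.place_mem h.valid)
  have hO : ∀ o ∈ τ.O S n, o ∈ S (n+1) := fun o ho => hsub (Task.O_sub' ho)
  have hfO : ∀ o ∈ τ.O S n, f o ∈ S (n+1) := fun o ho => by
    rw [h.S_eq]; simp only [Finset.mem_union, Finset.mem_image]; exact .inr ⟨o, ho, rfl⟩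
  have emu : ∀ o ∈ τ.O S n, (τ.mu R1' o ↔ τ.mu R1 o) := by
    intro o ho
    cases τ with
    | t1 q r => rfl
    | t2 q r => exact h1 o (hO o ho) r (hsub h.valid.2.1)
    | t3 p q l => rfl
  refine ⟨hv, h.mono, h.lt, ?_, ?_, ?_, ?_, ?_, ?_, ?_, ?_⟩
  · rw [eS n le_rfl]; exact h.gt
  · rw [hS _ le_rfl, eO, eS n le_rfl]; exact h.S_eq
  · rw [eO, eS n le_rfl]
    intro x hx o ho
    rw [h1 _ (hsub hx) _ (hfO o ho), h1 _ (hsub hx) _ hpl]; exact h.F1 x hx o ho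
  · rw [eO, eS n le_rfl, eL]
    intro x hx o ho
    rw [h2 _ (hsub hx) _ (hfO o ho), h2 _ (hsub hx) _ (hO o ho)]; exact h.F2 x hx o ho
  · rw [eO]
    intro o ho o' ho'
    rw [h1 _ (hfO o ho) _ (hfO o' ho'), h1 _ (hO o ho) _ (hO o' ho')]; exact h.F31 o ho o' ho'
  · rw [eO]
    intro o ho o' ho'
    rw [h2 _ (hfO o ho) _ (hfO o' ho'), h2 _ (hO o ho) _ (hO o' ho')]; exact h.F32 o ho o' ho'
  · rw [eO, eS n le_rfl]
    intro y hy o ho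
    rw [h1 _ (hfO o ho) _ (hsub hy), h1 _ hpl _ (hsub hy), emu o ho]; exact h.F4 y hy o ho
  · rw [eO, eS n le_rfl]
    intro y hy o ho
    rw [h2 _ (hfO o ho) _ (hsub hy)]; exact h.F5 y hy o ho

instance : Countable Task := by
  let g : Task → (ℚ × ℚ) ⊕ (ℚ × ℚ) ⊕ (ℚ × ℚ × ℕ) := fun τ => match τ with
    | .t1 q r => .inl (q, r)
    | .t2 q r => .inr (.inl (q, r))
    | .t3 p q l => .inr (.inr (p, q, l))
  have : Function.Injective g := by
    intro a b h
    cases a <;> cases b <;> simp_all [g]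
  exact this.countable

lemma exists_sched : ∃ t : ℕ → Task, ∀ τ m, ∃ n ≥ m, t n = τ := by
  have : Nonempty (Task × ℕ) := ⟨(.t1 0 0, 0)⟩
  obtain ⟨g, hg⟩ := exists_surjective_nat (Task × ℕ)
  refine ⟨fun n => (g n).1, fun τ m => ?_⟩
  choose k hk using fun i => hg (τ, i)
  have hinj : Function.Injective k := by
    intro i j h
    have := (hk i).symm.trans ((congrArg g h).trans (hk j))
    exact (Prod.mk.inj this).2
  obtain ⟨i, hi⟩ := (hinj.nat_tendsto_atTop.eventually_ge_atTop m).exists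
  exact ⟨k i, hi, by simp [hk]⟩

theorem exists_gen (M : ℕ) : Nonempty (Gen M) := by
  obtain ⟨t, ht⟩ := exists_sched
  set s := stS M t with hs
  have s1 : ∀ n, s (n+1) = nextS n (s n) (t n) := fun n => rfl
  have hsup : ∀ n, Sup (s n) n := by
    intro n
    induction n with
    | zero =>
      intro x y h
      rcases h with h | h <;> exact ⟨h.1, h.2.1⟩
    | succ n ih => rw [s1]; exact nextS_sup n _ _ ih
  have hS : ∀ l n, l ≤ n → (s n).S l = (s l).S l := by
    intro l n h
    induction n, h using Nat.le_induction with
    | base => rfl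
    | succ n h ih => rw [s1, nextS_S _ _ _ _ h, ih]
  have hsub1 : ∀ n, (s n).S n ⊆ (s (n+1)).S (n+1) := fun n => by rw [s1]; exact nextS_Sub _ _ _
  have hsub : ∀ l n, l ≤ n → (s l).S l ⊆ (s n).S n := by
    intro l n h
    induction n, h using Nat.le_induction with
    | base => rfl
    | succ n h ih => exact ih.trans (hsub1 n)
  have hst : ∀ l n, l ≤ n → ∀ x ∈ (s l).S l, ∀ y ∈ (s l).S l, ((s n).r1 x y ↔ (s l).r1 x y) ∧
      ((s n).r2 x y ↔ (s l).r2 x y) := by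
    intro l n h x hx y hy
    induction n, h using Nat.le_induction with
    | base => exact ⟨Iff.rfl, Iff.rfl⟩
    | succ n h ih =>
      have := nextS_old n (s n) (t n) x y (hsub l n h hx) (hsub l n h hy)
      rw [← s1] at this
      exact ⟨this.1.trans ih.1, this.2.trans ih.2⟩
  let S : ℕ → Finset ℚ := fun n => (s n).S n
  let R1 : ℚ → ℚ → Prop := fun x y => ∃ n, (s n).r1 x y
  let R2 : ℚ → ℚ → Prop := fun x y => ∃ n, (s n).r2 x y
  have hR1 : ∀ n, ∀ x ∈ S n, ∀ y ∈ S n, (R1 x y ↔ (s n).r1 x y) := by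
    intro n x hx y hy
    refine ⟨?_, fun h => ⟨n, h⟩⟩
    rintro ⟨m, hm⟩
    rcases le_total m n with h | h
    · have := hsup m x y (.inl hm)
      exact (hst m n h x this.1 y this.2).1.2 hm
    · exact (hst n m h x hx y hy).1.1 hm
  have hR2 : ∀ n, ∀ x ∈ S n, ∀ y ∈ S n, (R2 x y ↔ (s n).r2 x y) := by
    intro n x hx y hy
    refine ⟨?_, fun h => ⟨n, h⟩⟩
    rintro ⟨m, hm⟩
    rcases le_total m n with h | h
    · have := hsup m x y (.inr hm)
      exact (hst m n h x this.1 y this.2).2.2 hm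
    · exact (hst n m h x hx y hy).2.1 hm
  have hval : ∀ n τ, Task.Valid S R1 R2 n τ ↔ Task.Valid (s n).S (s n).r1 (s n).r2 n τ := by
    intro n τ
    cases τ with
    | t1 q r =>
      constructor
      · rintro ⟨a, b, c, d⟩; exact ⟨a, b, c, (hR1 n _ a _ b).1 d⟩
      · rintro ⟨a, b, c, d⟩; exact ⟨a, b, c, (hR1 n _ a _ b).2 d⟩
    | t2 q r =>
      constructor
      · rintro ⟨a, b, c, d⟩; exact ⟨a, b, c, (hR2 n _ a _ b).1 d⟩
      · rintro ⟨a, b, c, d⟩; exact ⟨a, b, c, (hR2 n _ a _ b).2 d⟩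
    | t3 p q l =>
      constructor
      · rintro ⟨a, b, c, d, e⟩
        exact ⟨a, by rw [hS l n a]; exact b, c, d, (hR2 n _ (hsub l n a b) _ c).1 e⟩
      · rintro ⟨a, b, c, d, e⟩
        rw [hS l n a] at b
        exact ⟨a, b, c, d, (hR2 n _ (hsub l n a b) _ c).2 e⟩
  have hstep : ∀ n, Task.Valid S R1 R2 n (t n) → ∃ f, IsStep S R1 R2 n (t n) f := by
    intro n hv
    have h := nextS_step n (s n) (t n) (hsup n) ((hval n _).1 hv)
    rw [← s1] at h
    have e : (s (n+1)).S n = (s n).S n := hS n (n+1) (by omega)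
    refine ⟨_, h.congr (fun m hm => (hS m (n+1) hm).symm) (by rw [e]; exact hsub1 n) (hR1 (n+1)) (hR2 (n+1)) hv⟩
  have hvm : ∀ τ m n, m ≤ n → Task.Valid S R1 R2 m τ → Task.Valid S R1 R2 n τ := by
    intro τ m n h hv
    cases τ with
    | t1 q r => exact ⟨hsub m n h hv.1, hsub m n h hv.2.1, hv.2.2⟩
    | t2 q r => exact ⟨hsub m n h hv.1, hsub m n h hv.2.1, hv.2.2⟩
    | t3 p q l => exact ⟨hv.1.trans h, hv.2.1, hsub m n h hv.2.2.1, hv.2.2.2⟩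
  refine ⟨⟨S, R1, R2, rfl, ?_, ?_, ?_, ?_⟩⟩
  · intro x hx y hy
    rw [hR1 0 x hx y hy]
    exact ⟨fun h => h.2.2, fun h => ⟨hx, hy, h⟩⟩
  · intro x hx y hy
    rw [hR2 0 x hx y hy]
    exact ⟨fun h => h.2.2, fun h => ⟨hx, hy, h⟩⟩
  · intro n
    by_cases hv : Task.Valid S R1 R2 n (t n)
    · obtain ⟨f, hf⟩ := hstep n hv
      exact .inr ⟨_, f, hf⟩
    · left
      have : ¬ Task.Valid (s n).S (s n).r1 (s n).r2 n (t n) := fun h => hv ((hval n _).2 h)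
      change (s (n+1)).S (n+1) = _
      rw [s1, nextS, if_neg this]
      simp [S]
  · intro τ m hv
    obtain ⟨n, hn, rfl⟩ := ht τ m
    obtain ⟨f, hf⟩ := hstep n (hvm _ m n hn hv)
    exact ⟨n, hn, f, hf⟩

end R2

namespace R2

structure AxOn (F : Finset ℚ) (R1 R2 : ℚ → ℚ → Prop) : Prop where
  refl : ∀ x ∈ F, R2 x x
  sub21 : ∀ x ∈ F, ∀ y ∈ F, R2 x y → R1 x y
  sub10 : ∀ x ∈ F, ∀ y ∈ F, R1 x y → x ≤ y
  tr1 : ∀ x ∈ F, ∀ y ∈ F, ∀ z ∈ F, R1 x y → R1 y z → R1 x z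
  tr2 : ∀ x ∈ F, ∀ y ∈ F, ∀ z ∈ F, R2 x y → R2 y z → R2 x z
  resp1 : ∀ x ∈ F, ∀ y ∈ F, ∀ z ∈ F, x ≤ y → y ≤ z → R1 x z → R1 x y
  resp2 : ∀ x ∈ F, ∀ y ∈ F, ∀ z ∈ F, R1 x y → R1 y z → R2 x z → R2 x y

/-- Admissibility of an insertion step. -/
structure SC (S : ℕ → Finset ℚ) (R1 R2 : ℚ → ℚ → Prop) (n : ℕ) (τ : Task) : Prop where
  dc : ∀ x y, x ≤ y → τ.low S y → τ.low S x
  c1 : ∀ x ∈ S n, τ.low S x → ∀ o ∈ τ.O S n, (R1 x o ↔ R1 x τ.place)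
  c2 : ∀ x ∈ S n, τ.low S x → ∀ o ∈ τ.O S n, R2 x o → R2 x τ.place
  c3 : ∀ o ∈ τ.O S n, ∀ o' ∈ τ.O S n, R1 o' o → τ.mu R1 o → τ.mu R1 o'
  c4 : ∀ o ∈ τ.O S n, ∀ o' ∈ τ.O S n, τ.mu R1 o → o < o' → R1 o o'
  c5 : ∀ o ∈ τ.O S n, τ.mu R1 o → ∀ x ∈ S n, x < τ.place → R2 x τ.place → τ.low S x ∧ R2 x o

structure Str (S : ℕ → Finset ℚ) (R1 R2 : ℚ → ℚ → Prop) (l n : ℕ) (p : ℚ) : Prop where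
  c1 : ∀ o ∈ young S l n p, ∀ x ∈ S n, ∀ y ∈ S l, y < p → x ≤ y → (R1 x o ↔ R1 x p)
  c2 : ∀ o ∈ young S l n p, ∀ x ∈ S n, ∀ y ∈ S l, y < p → x ≤ y → R2 x o → R2 x p
  c6 : ∀ o ∈ young S l n p, ∀ y ∈ S n, p ≤ y → R1 o y → R1 p y
  c7 : ∀ o ∈ young S l n p, ∀ y ∈ S n, p ≤ y → ¬ R2 o y

lemma mem_young {S : ℕ → Finset ℚ} {l n : ℕ} {p x : ℚ} :
    x ∈ young S l n p ↔ x ∈ S n ∧ x < p ∧ ∀ y ∈ S l, y < p → y < x := by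
  simp [young]

section
variable {S : ℕ → Finset ℚ} {R1 R2 : ℚ → ℚ → Prop} {n : ℕ} {τ : Task} {f : ℚ → ℚ}

lemma sc_of (hA : AxOn (S n) R1 R2) (hv : τ.Valid S R1 R2 n) (hS : ∀ l ≤ n, S l ⊆ S n)
    (hstr : ∀ l ≤ n, ∀ p ∈ S l, Str S R1 R2 l n p) : SC S R1 R2 n τ := by
  cases τ with
  | t1 q r =>
    obtain ⟨hq, hr, hqr, h1⟩ := hv
    have key : ∀ x ∈ S n, x < q → ∀ o ∈ S n, q ≤ o → o < r → (R1 x o ↔ R1 x q) := by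
      intro x hx hxq o ho hqo hor
      exact ⟨hA.resp1 x hx q hq o ho hxq.le hqo, fun h =>
        hA.resp1 x hx o ho r hr (hxq.le.trans hqo) hor.le (hA.tr1 x hx q hq r hr h h1)⟩
    refine ⟨fun x y h h' => lt_of_le_of_lt h h', ?_, ?_, ?_, ?_, ?_⟩
    · intro x hx hxl o ho
      simp only [Task.O, Finset.mem_filter] at ho
      exact key x hx hxl o ho.1 ho.2.1 ho.2.2
    · intro x hx hxl o ho h
      simp only [Task.O, Finset.mem_filter] at ho
      exact hA.resp2 x hx q hq o ho.1 ((key x hx hxl o ho.1 ho.2.1 ho.2.2).1 (hA.sub21 x hx o ho.1 h))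
        (hA.resp1 q hq o ho.1 r hr ho.2.1 ho.2.2.le h1) h
    · intro o _ o' _ _ h; exact h
    · intro o _ o' _ h; exact h.elim
    · intro o _ h; exact h.elim
  | t2 q r =>
    obtain ⟨hq, hr, hqr, h2⟩ := hv
    have h1 := hA.sub21 q hq r hr h2
    have key : ∀ x ∈ S n, x < q → ∀ o ∈ S n, q ≤ o → o < r → (R1 x o ↔ R1 x q) := by
      intro x hx hxq o ho hqo hor
      exact ⟨hA.resp1 x hx q hq o ho hxq.le hqo, fun h =>
        hA.resp1 x hx o ho r hr (hxq.le.trans hqo) hor.le (hA.tr1 x hx q hq r hr h h1)⟩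
    refine ⟨fun x y h h' => lt_of_le_of_lt h h', ?_, ?_, ?_, ?_, ?_⟩
    · intro x hx hxl o ho
      simp only [Task.O, Finset.mem_filter] at ho
      exact key x hx hxl o ho.1 ho.2.1 ho.2.2
    · intro x hx hxl o ho h
      simp only [Task.O, Finset.mem_filter] at ho
      exact hA.resp2 x hx q hq o ho.1 ((key x hx hxl o ho.1 ho.2.1 ho.2.2).1 (hA.sub21 x hx o ho.1 h))
        (hA.resp1 q hq o ho.1 r hr ho.2.1 ho.2.2.le h1) h
    · intro o ho o' ho' h hm
      exact hA.tr1 _ (Task.O_sub' ho') _ (Task.O_sub' ho) _ hr h hm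
    · intro o ho o' ho' hm h
      have hlt := ho'
      simp only [Task.O, Finset.mem_filter] at hlt
      exact hA.resp1 _ (Task.O_sub' ho) _ (Task.O_sub' ho') _ hr h.le hlt.2.2.le hm
    · intro o ho hm x hx hxq h
      simp only [Task.O, Finset.mem_filter] at ho
      refine ⟨hxq, hA.resp2 x hx o ho.1 r hr ?_ hm (hA.tr2 x hx q hq r hr h h2)⟩
      exact (key x hx hxq o ho.1 ho.2.1 ho.2.2).2 (hA.sub21 x hx q hq h)
  | t3 p q l =>
    obtain ⟨hl, hp, hq, hpq, h2⟩ := hv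
    have hpn := hS l hl hp
    have h1 := hA.sub21 p hpn q hq h2
    have hs := hstr l hl p hp
    refine ⟨?_, ?_, ?_, ?_, ?_, ?_⟩
    · rintro x y h ⟨z, hz, hzp, hyz⟩; exact ⟨z, hz, hzp, h.trans hyz⟩
    · rintro x hx ⟨y, hy, hyp, hxy⟩ o ho
      rw [hs.c1 o ho x hx y hy hyp hxy]
      exact ⟨fun h => hA.tr1 x hx p hpn q hq h h1, hA.resp1 x hx p hpn q hq (hxy.trans hyp.le) hpq.le⟩
    · rintro x hx ⟨y, hy, hyp, hxy⟩ o ho h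
      exact hA.tr2 x hx p hpn q hq (hs.c2 o ho x hx y hy hyp hxy h) h2
    · intro o _ o' _ _ h; exact h
    · intro o _ o' _ h; exact h.elim
    · intro o _ h; exact h.elim

lemma IsStep.mem_iff (h : IsStep S R1 R2 n τ f) (x : ℚ) :
    x ∈ S (n+1) ↔ x ∈ S n ∨ ∃ o ∈ τ.O S n, f o = x := by
  rw [h.S_eq]; simp

lemma axOn_step (h : IsStep S R1 R2 n τ f) (hA : AxOn (S n) R1 R2) (hc : SC S R1 R2 n τ) :
    AxOn (S (n+1)) R1 R2 := by
  have hq := Task.place_mem h.valid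
  have hO : ∀ o ∈ τ.O S n, o ∈ S n := fun o => Task.O_sub'
  have hge : ∀ y ∈ S n, ∀ o, f o ≤ y → τ.place ≤ y := fun y hy o hoy => by
    by_contra hlt
    exact absurd (h.gt o y hy (not_le.1 hlt)) (not_lt.2 hoy)
  have hm : ∀ o o', f o ≤ f o' ↔ o ≤ o' := fun o o' => h.mono.le_iff_le
  have hr1 : ∀ x ∈ S n, R1 x x := fun x hx => hA.sub21 x hx x hx (hA.refl x hx)
  constructor
  · intro x hx
    rcases (h.mem_iff x).1 hx with hx | ⟨o, ho, rfl⟩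
    · exact hA.refl x hx
    · exact (h.F32 o ho o ho).2 (hA.refl o (hO o ho))
  · intro x hx y hy
    rcases (h.mem_iff x).1 hx with hx | ⟨o, ho, rfl⟩ <;> rcases (h.mem_iff y).1 hy with hy | ⟨o', ho', rfl⟩
    · exact hA.sub21 x hx y hy
    · rw [h.F1 x hx o' ho', h.F2 x hx o' ho']
      rintro ⟨a, b, c⟩
      exact ⟨a, (hc.c1 x hx b o' ho').1 (hA.sub21 x hx o' (hO _ ho') c)⟩
    · intro h'; exact absurd h' (h.F5 y hy o ho)
    · rw [h.F31 o ho o' ho', h.F32 o ho o' ho']; exact hA.sub21 _ (hO _ ho) _ (hO _ ho')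
  · intro x hx y hy
    rcases (h.mem_iff x).1 hx with hx | ⟨o, ho, rfl⟩ <;> rcases (h.mem_iff y).1 hy with hy | ⟨o', ho', rfl⟩
    · exact hA.sub10 x hx y hy
    · rw [h.F1 x hx o' ho']
      rintro ⟨a, -⟩
      exact (h.gt o' x hx a).le
    · rw [h.F4 y hy o ho]
      rintro ⟨a, -⟩
      exact (h.lt o).le.trans a
    · rw [h.F31 o ho o' ho', hm]; exact hA.sub10 _ (hO _ ho) _ (hO _ ho')
  · intro x hx y hy z hz
    rcases (h.mem_iff x).1 hx with hx | ⟨o, ho, rfl⟩ <;> rcases (h.mem_iff y).1 hy with hy | ⟨o', ho', rfl⟩ <;>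
      rcases (h.mem_iff z).1 hz with hz | ⟨o'', ho'', rfl⟩
    · exact hA.tr1 x hx y hy z hz
    · rw [h.F1 y hy o'' ho'', h.F1 x hx o'' ho'']
      rintro h1 ⟨h2, h3⟩
      exact ⟨(hA.sub10 x hx y hy h1).trans_lt h2, hA.tr1 x hx y hy _ hq h1 h3⟩
    · rw [h.F1 x hx o' ho', h.F4 z hz o' ho']
      rintro ⟨h1, h2⟩ ⟨h3, h4, h5⟩
      exact hA.tr1 x hx _ hq z hz h2 h5
    · rw [h.F1 x hx o' ho', h.F1 x hx o'' ho'']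
      exact fun h _ => h
    · rw [h.F4 y hy o ho, h.F4 z hz o ho]
      rintro ⟨h1, h2, h3⟩ h4
      exact ⟨h1.trans (hA.sub10 y hy z hz h4), h2, hA.tr1 _ hq y hy z hz h3 h4⟩
    · rw [h.F4 y hy o ho, h.F1 y hy o'' ho'']
      rintro ⟨h1, -⟩ ⟨h2, -⟩
      exact absurd h2 (not_lt.2 h1)
    · rw [h.F31 o ho o' ho', h.F4 z hz o' ho', h.F4 z hz o ho]
      rintro h1 ⟨h2, h3, h4⟩
      exact ⟨h2, hc.c3 o' ho' o ho h1 h3, h4⟩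
    · rw [h.F31 o ho o' ho', h.F31 o' ho' o'' ho'', h.F31 o ho o'' ho'']
      exact hA.tr1 _ (hO _ ho) _ (hO _ ho') _ (hO _ ho'')
  · intro x hx y hy z hz
    rcases (h.mem_iff x).1 hx with hx | ⟨o, ho, rfl⟩ <;> rcases (h.mem_iff y).1 hy with hy | ⟨o', ho', rfl⟩ <;>
      rcases (h.mem_iff z).1 hz with hz | ⟨o'', ho'', rfl⟩
    · exact hA.tr2 x hx y hy z hz
    · rw [h.F2 y hy o'' ho'', h.F2 x hx o'' ho'']
      rintro h1 ⟨h2, h3, h4⟩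
      have hxy := hA.sub10 x hx y hy (hA.sub21 x hx y hy h1)
      exact ⟨hxy.trans_lt h2, hc.dc _ _ hxy h3, hA.tr2 x hx y hy _ (hO _ ho'') h1 h4⟩
    · intro _ h'; exact absurd h' (h.F5 z hz o' ho')
    · rw [h.F2 x hx o' ho', h.F2 x hx o'' ho'', h.F32 o' ho' o'' ho'']
      rintro ⟨h1, h2, h3⟩ h4
      exact ⟨h1, h2, hA.tr2 x hx _ (hO _ ho') _ (hO _ ho'') h3 h4⟩
    · intro h'; exact absurd h' (h.F5 y hy o ho)
    · intro h'; exact absurd h' (h.F5 y hy o ho)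
    · intro _ h'; exact absurd h' (h.F5 z hz o' ho')
    · rw [h.F32 o ho o' ho', h.F32 o' ho' o'' ho'', h.F32 o ho o'' ho'']
      exact hA.tr2 _ (hO _ ho) _ (hO _ ho') _ (hO _ ho'')
  · intro x hx y hy z hz
    rcases (h.mem_iff x).1 hx with hx | ⟨o, ho, rfl⟩ <;> rcases (h.mem_iff y).1 hy with hy | ⟨o', ho', rfl⟩ <;>
      rcases (h.mem_iff z).1 hz with hz | ⟨o'', ho'', rfl⟩
    · exact hA.resp1 x hx y hy z hz
    · rw [h.F1 x hx o'' ho'']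
      rintro h1 h2 ⟨h3, h4⟩
      exact hA.resp1 x hx y hy _ hq h1 (h2.trans (h.lt _).le) h4
    · rw [h.F1 x hx o' ho']
      intro h1 h2 h3
      have hxq := h1.trans_lt (h.lt o')
      exact ⟨hxq, hA.resp1 x hx _ hq z hz hxq.le (hge z hz o' h2) h3⟩
    · rw [h.F1 x hx o' ho', h.F1 x hx o'' ho'']
      exact fun _ _ h => h
    · rw [h.F4 y hy o ho, h.F4 z hz o ho]
      rintro h1 h2 ⟨h3, h4, h5⟩
      exact ⟨hge y hy o h1, h4, hA.resp1 _ hq y hy z hz (hge y hy o h1) h2 h5⟩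
    · intro h1 h2
      exact absurd (hge y hy o h1) (not_le.2 (h2.trans_lt (h.lt _)))
    · rw [h.F31 o ho o' ho', h.F4 z hz o ho, hm]
      rintro h1 h2 ⟨h3, h4, h5⟩
      rcases h1.eq_or_lt with rfl | h1
      · exact hr1 _ (hO _ ho)
      · exact hc.c4 o ho o' ho' h4 h1
    · rw [h.F31 o ho o' ho', h.F31 o ho o'' ho'', hm, hm]
      exact hA.resp1 _ (hO _ ho) _ (hO _ ho') _ (hO _ ho'')
  · intro x hx y hy z hz
    rcases (h.mem_iff x).1 hx with hx | ⟨o, ho, rfl⟩ <;> rcases (h.mem_iff y).1 hy with hy | ⟨o', ho', rfl⟩ <;>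
      rcases (h.mem_iff z).1 hz with hz | ⟨o'', ho'', rfl⟩
    · exact hA.resp2 x hx y hy z hz
    · rw [h.F1 y hy o'' ho'', h.F2 x hx o'' ho'']
      rintro h1 ⟨h2, h3⟩ ⟨h4, h5, h6⟩
      exact hA.resp2 x hx y hy _ hq h1 h3 (hc.c2 x hx h5 o'' ho'' h6)
    · rw [h.F1 x hx o' ho', h.F4 z hz o' ho', h.F2 x hx o' ho']
      rintro ⟨h1, h2⟩ ⟨h3, h4, h5⟩ h6
      exact ⟨h1, hc.c5 o' ho' h4 x hx h1 (hA.resp2 x hx _ hq z hz h2 h5 h6)⟩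
    · rw [h.F1 x hx o' ho', h.F31 o' ho' o'' ho'', h.F2 x hx o' ho', h.F2 x hx o'' ho'']
      rintro ⟨h1, h2⟩ h3 ⟨h4, h5, h6⟩
      exact ⟨h1, h5, hA.resp2 x hx o' (hO _ ho') o'' (hO _ ho'') ((hc.c1 x hx h5 o' ho').2 h2) h3 h6⟩
    · intro _ _ h'; exact absurd h' (h.F5 z hz o ho)
    · rw [h.F4 y hy o ho, h.F1 y hy o'' ho'']
      rintro ⟨h1, -⟩ ⟨h2, -⟩
      exact absurd h2 (not_lt.2 h1)
    · intro _ _ h'; exact absurd h' (h.F5 z hz o ho)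
    · rw [h.F31 o ho o' ho', h.F31 o' ho' o'' ho'', h.F32 o ho o'' ho'', h.F32 o ho o' ho']
      exact hA.resp2 _ (hO _ ho) _ (hO _ ho') _ (hO _ ho'')

/-- which elements become young -/
lemma IsStep.young_iff (h : IsStep S R1 R2 n τ f) {l : ℕ} {p : ℚ} (hl : S l ⊆ S n) (hp : p ∈ S l) (o : ℚ) :
    (f o < p ∧ ∀ y ∈ S l, y < p → y < f o) ↔ (τ.place = p ∨ τ.place ∈ young S l n p) := by
  have hq := Task.place_mem h.valid
  have a : ∀ y ∈ S n, y < f o ↔ y < τ.place := fun y hy => ⟨fun h' => h'.trans (h.lt o), h.gt o y hy⟩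
  have b : f o < p ↔ τ.place ≤ p := by
    have := a p (hl hp)
    have e : f o ≠ p := by
      intro e
      have h1 := h.lt o
      rw [e] at h1
      have := h.gt o p (hl hp) h1
      linarith
    exact ⟨fun h' => not_lt.1 fun hc => absurd (this.2 hc) (not_lt.2 h'.le), fun h' => lt_of_le_of_ne (not_lt.1 fun hc => absurd (this.1 hc) (not_lt.2 h')) e⟩
  rw [b, mem_young]
  constructor
  · rintro ⟨h1, h2⟩
    rcases h1.eq_or_lt with h1 | h1
    · exact .inl h1
    · exact .inr ⟨hq, h1, fun y hy hyp => (a y (hl hy)).1 (h2 y hy hyp)⟩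
  · rintro (h1 | ⟨_, h1, h2⟩)
    · exact ⟨h1.le, fun y hy hyp => (a y (hl hy)).2 (h1 ▸ hyp)⟩
    · exact ⟨h1.le, fun y hy hyp => (a y (hl hy)).2 (h2 y hy hyp)⟩

lemma str_step (h : IsStep S R1 R2 n τ f) (hc : SC S R1 R2 n τ) {l : ℕ} {p : ℚ}
    (hl : S l ⊆ S n) (hp : p ∈ S l) (hs : Str S R1 R2 l n p) : Str S R1 R2 l (n+1) p := by
  have hq := Task.place_mem h.valid
  have hO : ∀ o ∈ τ.O S n, o ∈ S n := fun o => Task.O_sub'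
  have hpn := hl hp
  have hge : ∀ y ∈ S n, ∀ o, f o ≤ y → τ.place ≤ y := fun y hy o hoy => by
    by_contra hlt
    exact absurd (h.gt o y hy (not_le.1 hlt)) (not_lt.2 hoy)
  have hyo : ∀ o ∈ young S l (n+1) p, o ∈ young S l n p ∨
     (∃ o1 ∈ τ.O S n, o = f o1) ∧ (τ.place = p ∨ τ.place ∈ young S l n p) := by
    intro o ho
    rw [mem_young] at ho
    rcases (h.mem_iff o).1 ho.1 with h1 | ⟨o1, ho1, rfl⟩
    · exact .inl (mem_young.2 ⟨h1, ho.2⟩)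
    · exact .inr ⟨⟨o1, ho1, rfl⟩, (h.young_iff hl hp o1).1 ho.2⟩
  constructor
  · intro o ho x hx y0 hy0 hyp hxy
    rcases hyo o ho with ho | ⟨⟨o1, ho1, rfl⟩, hp'⟩ <;> rcases (h.mem_iff x).1 hx with hx | ⟨o', ho', rfl⟩
    · exact hs.c1 o ho x hx y0 hy0 hyp hxy
    · have hq0 := hge y0 (hl hy0) o' hxy
      have ho2 := (mem_young.1 ho)
      rw [h.F4 o ho2.1 o' ho', h.F4 p hpn o' ho', hs.c1 o ho _ hq y0 hy0 hyp hq0]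
      have h1 : τ.place ≤ o := hq0.trans (ho2.2.2 y0 hy0 hyp).le
      have h2 : τ.place ≤ p := hq0.trans hyp.le
      simp [h1, h2]
    · rw [h.F1 x hx o1 ho1]
      rcases hp' with hp' | hp'
      · rw [hp']
        exact ⟨fun h => h.2, fun h => ⟨hxy.trans_lt hyp, h⟩⟩
      · have := (mem_young.1 hp').2.2 y0 hy0 hyp
        rw [hs.c1 _ hp' x hx y0 hy0 hyp hxy]
        exact ⟨fun h => h.2, fun h => ⟨hxy.trans_lt this, h⟩⟩
    · have hq0 := hge y0 (hl hy0) o' hxy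
      rcases hp' with hp' | hp'
      · rw [hp'] at hq0; exact absurd hyp (not_lt.2 hq0)
      · exact absurd ((mem_young.1 hp').2.2 y0 hy0 hyp) (not_lt.2 hq0)
  · intro o ho x hx y0 hy0 hyp hxy
    rcases hyo o ho with ho | ⟨⟨o1, ho1, rfl⟩, hp'⟩ <;> rcases (h.mem_iff x).1 hx with hx | ⟨o', ho', rfl⟩
    · exact hs.c2 o ho x hx y0 hy0 hyp hxy
    · intro h'; exact absurd h' (h.F5 o (mem_young.1 ho).1 o' ho')
    · rw [h.F2 x hx o1 ho1]
      rintro ⟨h1, h2, h3⟩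
      have h4 := hc.c2 x hx h2 o1 ho1 h3
      rcases hp' with hp' | hp'
      · rw [hp'] at h4; exact h4
      · exact hs.c2 _ hp' x hx y0 hy0 hyp hxy h4
    · have hq0 := hge y0 (hl hy0) o' hxy
      rcases hp' with hp' | hp'
      · rw [hp'] at hq0; exact absurd hyp (not_lt.2 hq0)
      · exact absurd ((mem_young.1 hp').2.2 y0 hy0 hyp) (not_lt.2 hq0)
  · intro o ho y hy hpy
    rcases hyo o ho with ho | ⟨⟨o1, ho1, rfl⟩, hp'⟩ <;> rcases (h.mem_iff y).1 hy with hy | ⟨o', ho', rfl⟩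
    · exact hs.c6 o ho y hy hpy
    · have hpq : p < τ.place := hpy.trans_lt (h.lt o')
      rw [h.F1 o (mem_young.1 ho).1 o' ho', h.F1 p hpn o' ho']
      rintro ⟨h1, h2⟩
      exact ⟨hpq, hs.c6 o ho _ hq hpq.le h2⟩
    · rw [h.F4 y hy o1 ho1]
      rintro ⟨h1, h2, h3⟩
      rcases hp' with hp' | hp'
      · rw [hp'] at h3; exact h3
      · exact hs.c6 _ hp' y hy hpy h3
    · have hpq : p < τ.place := hpy.trans_lt (h.lt o')
      rcases hp' with hp' | hp'
      · exact absurd hp' hpq.ne'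
      · exact absurd hpq (not_lt.2 (mem_young.1 hp').2.1.le)
  · intro o ho y hy hpy
    rcases hyo o ho with ho | ⟨⟨o1, ho1, rfl⟩, hp'⟩ <;> rcases (h.mem_iff y).1 hy with hy | ⟨o', ho', rfl⟩
    · exact hs.c7 o ho y hy hpy
    · have hpq : p < τ.place := hpy.trans_lt (h.lt o')
      have ho1 := (mem_young.1 ho).1
      rw [h.F2 o ho1 o' ho']
      rintro ⟨h1, h2, h3⟩
      exact hs.c7 o ho _ hq hpq.le (hc.c2 o ho1 h2 o' ho' h3)
    · exact h.F5 y hy o1 ho1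
    · have hpq : p < τ.place := hpy.trans_lt (h.lt o')
      rcases hp' with hp' | hp'
      · exact absurd hp' hpq.ne'
      · exact absurd hpq (not_lt.2 (mem_young.1 hp').2.1.le)

end

variable {M : ℕ} (G : Gen M)

lemma Gen.sub1 (n : ℕ) : G.S n ⊆ G.S (n+1) := by
  rcases G.step n with h | ⟨τ, f, h⟩
  · rw [h]
  · intro x hx; exact (h.mem_iff x).2 (.inl hx)

lemma Gen.sub {l n : ℕ} (h : l ≤ n) : G.S l ⊆ G.S n :=
  monotone_nat_of_le_succ (f := G.S) G.sub1 h

lemma young_self (S : ℕ → Finset ℚ) (l : ℕ) (p : ℚ) : young S l l p = ∅ := by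
  ext x
  simp only [mem_young, Finset.notMem_empty, iff_false]
  rintro ⟨h1, h2, h3⟩
  exact lt_irrefl _ (h3 x h1 h2)

lemma str_self (S : ℕ → Finset ℚ) (R1 R2 : ℚ → ℚ → Prop) (l : ℕ) (p : ℚ) : Str S R1 R2 l l p := by
  constructor <;> simp [young_self]

lemma Gen.main (n : ℕ) : AxOn (G.S n) G.R1 G.R2 ∧ ∀ l ≤ n, ∀ p ∈ G.S l, Str G.S G.R1 G.R2 l n p := by
  induction n with
  | zero =>
    refine ⟨?_, fun l hl p hp => ?_⟩
    · have h1 := G.R10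
      have h2 := G.R20
      constructor
      · intro x hx; rw [h2 x hx x hx]
      · intro x hx y hy; rw [h2 x hx y hy, h1 x hx y hy]; exact id
      · intro x hx y hy; rw [h1 x hx y hy]; exact id
      · intro x hx y hy z hz; rw [h1 x hx y hy, h1 y hy z hz, h1 x hx z hz]; exact le_trans
      · intro x hx y hy z hz; rw [h2 x hx y hy, h2 y hy z hz, h2 x hx z hz]; exact le_trans
      · intro x hx y hy z hz; rw [h1 x hx y hy]; exact fun h _ _ => h
      · intro x hx y hy z hz; rw [h1 x hx y hy, h2 x hx y hy]; exact fun h _ _ => h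
    · obtain rfl : l = 0 := by omega
      exact str_self _ _ _ _ _
  | succ n ih =>
    obtain ⟨hA, hs⟩ := ih
    rcases G.step n with h | ⟨τ, f, h⟩
    · refine ⟨by rw [h]; exact hA, fun l hl p hp => ?_⟩
      rcases hl.eq_or_lt with rfl | hl
      · exact str_self _ _ _ _ _
      · have := hs l (by omega) p hp
        have e : young G.S l (n+1) p = young G.S l n p := by simp [young, h]
        constructor
        · rw [e, h]; exact this.c1
        · rw [e, h]; exact this.c2
        · rw [e, h]; exact this.c6
        · rw [e, h]; exact this.c7
    · have hc := sc_of hA h.valid (fun l hl => G.sub hl) hs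
      refine ⟨axOn_step h hA hc, fun l hl p hp => ?_⟩
      rcases hl.eq_or_lt with rfl | hl
      · exact str_self _ _ _ _ _
      · exact str_step h hc (G.sub (by omega)) hp (hs l (by omega) p hp)

lemma Gen.ax (n : ℕ) : AxOn (G.S n) G.R1 G.R2 := (G.main n).1
lemma Gen.str {l n : ℕ} (h : l ≤ n) {p : ℚ} (hp : p ∈ G.S l) : Str G.S G.R1 G.R2 l n p := (G.main n).2 l h p hp
lemma Gen.sc {n : ℕ} {τ : Task} (h : τ.Valid G.S G.R1 G.R2 n) : SC G.S G.R1 G.R2 n τ :=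
  sc_of (G.ax n) h (fun _ hl => G.sub hl) (G.main n).2

end R2

namespace R2

structure Cov {T : Type*} [LinearOrder T] (F : Finset ℚ) (R1 R2 : ℚ → ℚ → Prop) (W1 W2 : T → T → Prop)
    (g : ℚ → T) : Prop where
  mono : ∀ x ∈ F, ∀ y ∈ F, x < y → g x < g y
  r1 : ∀ x ∈ F, ∀ y ∈ F, R1 x y → W1 (g x) (g y)
  r2 : ∀ x ∈ F, ∀ y ∈ F, R2 x y → W2 (g x) (g y)

lemma Cov.le {T : Type*} [LinearOrder T] {F : Finset ℚ} {R1 R2 : ℚ → ℚ → Prop} {W1 W2 : T → T → Prop}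
    {g : ℚ → T} (h : Cov F R1 R2 W1 W2 g) {x y : ℚ} (hx : x ∈ F) (hy : y ∈ F) (hxy : x ≤ y) : g x ≤ g y := by
  rcases hxy.eq_or_lt with rfl | h'
  · exact le_rfl
  · exact (h.mono x hx y hy h').le

lemma glue {T : Type*} (F : Finset ℚ) (f : ℚ → ℚ) (hf : Function.Injective f) (hF : ∀ o, f o ∉ F) (g ν : ℚ → T) :
    ∃ g' : ℚ → T, (∀ x ∈ F, g' x = g x) ∧ ∀ o, g' (f o) = ν o := by
  classical
  refine ⟨fun x => if x ∈ F then g x else ν (Function.invFun f x), fun x hx => by simp [hx], fun o => ?_⟩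
  simp [hF o, Function.leftInverse_invFun hf o]

section
variable {T : Type*} [LinearOrder T] {W1 W2 : T → T → Prop} (hT : Tgt W1 W2)
variable {S : ℕ → Finset ℚ} {R1 R2 : ℚ → ℚ → Prop} {n : ℕ} {τ : Task} {f : ℚ → ℚ}

lemma IsStep.nm (h : IsStep S R1 R2 n τ f) (o : ℚ) : f o ∉ S n := fun h' =>
  lt_irrefl _ (h.gt o _ h' (h.lt o))

lemma IsStep.ge (h : IsStep S R1 R2 n τ f) {y o : ℚ} (hy : y ∈ S n) (hoy : f o ≤ y) : τ.place ≤ y := by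
  by_contra hlt
  exact absurd (h.gt o y hy (not_le.1 hlt)) (not_lt.2 hoy)

include hT in
lemma ext_of_copy (h : IsStep S R1 R2 n τ f) (g : ℚ → T) (hg : Cov (S n) R1 R2 W1 W2 g)
    (ν : ℚ → T) (h1 : ∀ o ∈ τ.O S n, ν o < g τ.place)
    (h2 : ∀ o ∈ τ.O S n, ∀ x ∈ S n, x < τ.place → g x < ν o)
    (h3 : ∀ o ∈ τ.O S n, ∀ o' ∈ τ.O S n, o < o' → ν o < ν o')
    (h4 : ∀ o ∈ τ.O S n, ∀ o' ∈ τ.O S n, R1 o o' → W1 (ν o) (ν o'))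
    (h5 : ∀ o ∈ τ.O S n, ∀ o' ∈ τ.O S n, R2 o o' → W2 (ν o) (ν o'))
    (h6 : ∀ o ∈ τ.O S n, ∀ x ∈ S n, x < τ.place → τ.low S x → R2 x o → W2 (g x) (ν o))
    (h7 : ∀ o ∈ τ.O S n, τ.mu R1 o → W1 (ν o) (g τ.place)) :
    ∃ g', Cov (S (n+1)) R1 R2 W1 W2 g' ∧ (∀ x ∈ S n, g' x = g x) ∧ ∀ o, g' (f o) = ν o := by
  obtain ⟨g', e1, e2⟩ := glue (S n) f h.mono.injective h.nm g ν
  have hq := Task.place_mem h.valid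
  refine ⟨g', ⟨?_, ?_, ?_⟩, e1, e2⟩
  · intro x hx y hy hxy
    rcases (h.mem_iff x).1 hx with hx | ⟨o, ho, rfl⟩ <;> rcases (h.mem_iff y).1 hy with hy | ⟨o', ho', rfl⟩
    · rw [e1 x hx, e1 y hy]; exact hg.mono x hx y hy hxy
    · rw [e1 x hx, e2]; exact h2 o' ho' x hx (hxy.trans (h.lt _))
    · rw [e2, e1 y hy]; exact (h1 o ho).trans_le (hg.le hq hy (h.ge hy hxy.le))
    · rw [e2, e2]; exact h3 o ho o' ho' (h.mono.lt_iff_lt.1 hxy)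
  · intro x hx y hy
    rcases (h.mem_iff x).1 hx with hx | ⟨o, ho, rfl⟩ <;> rcases (h.mem_iff y).1 hy with hy | ⟨o', ho', rfl⟩
    · rw [e1 x hx, e1 y hy]; exact hg.r1 x hx y hy
    · rw [e1 x hx, e2, h.F1 x hx o' ho']
      rintro ⟨a, b⟩
      exact hT.resp1 _ _ _ (h2 o' ho' x hx a).le (h1 o' ho').le (hg.r1 x hx _ hq b)
    · rw [e2, e1 y hy, h.F4 y hy o ho]
      rintro ⟨a, b, c⟩
      exact hT.trans1 _ _ _ (h7 o ho b) (hg.r1 _ hq y hy c)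
    · rw [e2, e2, h.F31 o ho o' ho']; exact h4 o ho o' ho'
  · intro x hx y hy
    rcases (h.mem_iff x).1 hx with hx | ⟨o, ho, rfl⟩ <;> rcases (h.mem_iff y).1 hy with hy | ⟨o', ho', rfl⟩
    · rw [e1 x hx, e1 y hy]; exact hg.r2 x hx y hy
    · rw [e1 x hx, e2, h.F2 x hx o' ho']
      rintro ⟨a, b, c⟩
      exact h6 o' ho' x hx a b c
    · intro h'; exact absurd h' (h.F5 y hy o ho)
    · rw [e2, e2, h.F32 o ho o' ho']; exact h5 o ho o' ho'

end

variable {M : ℕ} (G : Gen M) {T : Type*} [LinearOrder T] {W1 W2 : T → T → Prop} (hT : Tgt W1 W2)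

def Good (W1 W2 : T → T → Prop) (l n : ℕ) (p : ℚ) : Prop :=
  ∀ g, Cov (G.S n) G.R1 G.R2 W1 W2 g → ∀ Bd : Finset T, (∀ b ∈ Bd, b < g p) →
    ∃ g', Cov (G.S n) G.R1 G.R2 W1 W2 g' ∧ (∀ x ∈ G.S n, x ∉ young G.S l n p → g' x = g x) ∧
      ∀ o ∈ young G.S l n p, ∀ b ∈ Bd, b < g' o

include hT in
lemma ext_step {n : ℕ} {τ : Task} {f : ℚ → ℚ} (h : IsStep G.S G.R1 G.R2 n τ f)
    (hgood : ∀ l ≤ n, ∀ p ∈ G.S l, Good G W1 W2 l n p) (g : ℚ → T) (hg : Cov (G.S n) G.R1 G.R2 W1 W2 g)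
    (Bd : Finset T) (hB : ∀ b ∈ Bd, b < g τ.place) :
    ∃ g', Cov (G.S (n+1)) G.R1 G.R2 W1 W2 g' ∧ (∀ x ∈ G.S n, g' x = g x) ∧
      ∀ o ∈ τ.O G.S n, ∀ b ∈ Bd, b < g' (f o) := by
  classical
  have hq := Task.place_mem h.valid
  suffices hs : ∃ ν : ℚ → T, (∀ o ∈ τ.O G.S n, ν o < g τ.place) ∧
      (∀ o ∈ τ.O G.S n, ∀ b ∈ Bd ∪ ((G.S n).filter (· < τ.place)).image g, b < ν o) ∧
      (∀ o ∈ τ.O G.S n, ∀ o' ∈ τ.O G.S n, o < o' → ν o < ν o') ∧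
      (∀ o ∈ τ.O G.S n, ∀ o' ∈ τ.O G.S n, G.R1 o o' → W1 (ν o) (ν o')) ∧
      (∀ o ∈ τ.O G.S n, ∀ o' ∈ τ.O G.S n, G.R2 o o' → W2 (ν o) (ν o')) ∧
      (∀ o ∈ τ.O G.S n, ∀ x ∈ G.S n, x < τ.place → τ.low G.S x → G.R2 x o → W2 (g x) (ν o)) ∧
      (∀ o ∈ τ.O G.S n, τ.mu G.R1 o → W1 (ν o) (g τ.place)) by
    obtain ⟨ν, h1, h2, h3, h4, h5, h6, h7⟩ := hs
    obtain ⟨g', k1, k2, k3⟩ := ext_of_copy hT h g hg ν h1 (fun o ho x hx hxq => h2 o ho _ (by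
      simp only [Finset.mem_union, Finset.mem_image, Finset.mem_filter]
      exact .inr ⟨x, ⟨hx, hxq⟩, rfl⟩)) h3 h4 h5 h6 h7
    exact ⟨g', k1, k2, fun o ho b hb => by rw [k3]; exact h2 o ho b (by simp [hb])⟩
  set Bd' := Bd ∪ ((G.S n).filter (· < τ.place)).image g with hBd'
  have hB' : ∀ b ∈ Bd', b < g τ.place := by
    intro b hb
    simp only [hBd', Finset.mem_union, Finset.mem_image, Finset.mem_filter] at hb
    rcases hb with hb | ⟨x, ⟨hx, hxq⟩, rfl⟩
    · exact hB b hb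
    · exact hg.mono x hx _ hq hxq
  have hin : ∀ x ∈ G.S n, x < τ.place → g x ∈ Bd' := by
    intro x hx hxq
    simp only [hBd', Finset.mem_union, Finset.mem_image, Finset.mem_filter]
    exact .inr ⟨x, ⟨hx, hxq⟩, rfl⟩
  have hO : ∀ o ∈ τ.O G.S n, o ∈ G.S n := fun o => Task.O_sub'
  clear_value Bd'
  cases τ with
  | t1 q r =>
    obtain ⟨-, hr, hqr, h1⟩ := h.valid
    obtain ⟨ν, hν⟩ := hT.ax1 (g q) (g r) (hg.r1 q hq r hr h1) (Task.O G.S n (.t1 q r)) g (by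
      intro o ho
      have := hO o ho
      simp only [Task.O, Finset.mem_filter] at ho
      exact ⟨hg.le hq this ho.2.1, hg.mono _ this _ hr ho.2.2⟩)
      (fun o ho o' ho' => hg.mono o (hO _ ho) o' (hO _ ho')) Bd' hB'
    refine ⟨ν, hν.lt, hν.gt, hν.mono, ?_, ?_, ?_, ?_⟩
    · exact fun o ho o' ho' hh => hν.d1 o ho o' ho' (hg.r1 _ (hO _ ho) _ (hO _ ho') hh)
    · exact fun o ho o' ho' hh => hν.d2 o ho o' ho' (hg.r2 _ (hO _ ho) _ (hO _ ho') hh)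
    · exact fun o ho x hx hxq _ hh => hν.e _ (hin x hx hxq) o ho (hg.r2 _ hx _ (hO _ ho) hh)
    · exact fun o ho hh => hh.elim
  | t2 q r =>
    obtain ⟨-, hr, hqr, h1⟩ := h.valid
    obtain ⟨ν, hν, hm⟩ := hT.ax2 (g q) (g r) (hg.r2 q hq r hr h1) (Task.O G.S n (.t2 q r)) g (by
      intro o ho
      have := hO o ho
      simp only [Task.O, Finset.mem_filter] at ho
      exact ⟨hg.le hq this ho.2.1, hg.mono _ this _ hr ho.2.2⟩)
      (fun o ho o' ho' => hg.mono o (hO _ ho) o' (hO _ ho')) Bd' hB'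
    refine ⟨ν, hν.lt, hν.gt, hν.mono, ?_, ?_, ?_, ?_⟩
    · exact fun o ho o' ho' hh => hν.d1 o ho o' ho' (hg.r1 _ (hO _ ho) _ (hO _ ho') hh)
    · exact fun o ho o' ho' hh => hν.d2 o ho o' ho' (hg.r2 _ (hO _ ho) _ (hO _ ho') hh)
    · exact fun o ho x hx hxq _ hh => hν.e _ (hin x hx hxq) o ho (hg.r2 _ hx _ (hO _ ho) hh)
    · exact fun o ho hh => hm o ho (hg.r1 _ (hO _ ho) _ hr hh)
  | t3 p q l =>
    obtain ⟨hl, hp, -, hpq, h2⟩ := h.valid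
    have hpn := G.sub hl hp
    obtain ⟨ν, hν⟩ := hT.ax3 (g p) (g q) (hg.r2 p hpn q hq h2) (young G.S l n p) G.R1 G.R2
      (((G.S n).filter (fun x => ∃ y ∈ G.S l, y < p ∧ x ≤ y)).image g)
      (fun z o => ∃ x ∈ G.S n, (∃ y ∈ G.S l, y < p ∧ x ≤ y) ∧ z = g x ∧ G.R2 x o) (by
        intro z hz
        simp only [Finset.mem_image, Finset.mem_filter] at hz
        obtain ⟨x, ⟨hx, y, hy, hyp, hxy⟩, rfl⟩ := hz
        exact hg.mono x hx p hpn (hxy.trans_lt hyp)) (by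
        intro Bd hBd
        obtain ⟨g', k1, k2, k3⟩ := hgood l hl p hp g hg Bd hBd
        have ep : g' p = g p := k2 p hpn (fun hc => lt_irrefl _ (mem_young.1 hc).2.1)
        have hyo : ∀ o ∈ young G.S l n p, o ∈ G.S n := fun o ho => (mem_young.1 ho).1
        refine ⟨g', ?_, k3, ?_, ?_, ?_, ?_⟩
        · intro o ho; rw [← ep]; exact k1.mono o (hyo o ho) p hpn (mem_young.1 ho).2.1
        · exact fun o ho o' ho' => k1.mono o (hyo o ho) o' (hyo o' ho')
        · exact fun o ho o' ho' => k1.r1 o (hyo o ho) o' (hyo o' ho')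
        · exact fun o ho o' ho' => k1.r2 o (hyo o ho) o' (hyo o' ho')
        · rintro z - o ho ⟨x, hx, ⟨y, hy, hyp, hxy⟩, rfl, hr⟩
          rw [← k2 x hx (fun hc => absurd ((mem_young.1 hc).2.2 y hy hyp) (not_lt.2 hxy))]
          exact k1.r2 x hx o (hyo o ho) hr) Bd' hB'
    refine ⟨ν, hν.lt, hν.gt, hν.mono, hν.d1, hν.d2, ?_, fun o ho hh => hh.elim⟩
    intro o ho x hx hxq hxl hh
    refine hν.e _ ?_ o ho ⟨x, hx, hxl, rfl, hh⟩
    simp only [Finset.mem_image, Finset.mem_filter]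
    exact ⟨x, ⟨hx, hxl⟩, rfl⟩

include hT in
lemma good_step {n : ℕ} {τ : Task} {f : ℚ → ℚ} (h : IsStep G.S G.R1 G.R2 n τ f)
    (hgood : ∀ l ≤ n, ∀ p ∈ G.S l, Good G W1 W2 l n p) {l : ℕ} (hl : l ≤ n) {p : ℚ} (hp : p ∈ G.S l) :
    Good G W1 W2 l (n+1) p := by
  intro g hg Bd hB
  have hq := Task.place_mem h.valid
  have hO : ∀ o ∈ τ.O G.S n, o ∈ G.S n := fun o => Task.O_sub'
  have hS := G.sub1 n
  have hgn : Cov (G.S n) G.R1 G.R2 W1 W2 g := ⟨fun x hx y hy => hg.mono x (hS hx) y (hS hy),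
    fun x hx y hy => hg.r1 x (hS hx) y (hS hy), fun x hx y hy => hg.r2 x (hS hx) y (hS hy)⟩
  obtain ⟨g1, k1, k2, k3⟩ := hgood l hl p hp g hgn Bd hB
  have hpn := G.sub hl hp
  have ep : g1 p = g p := k2 p hpn (fun hc => lt_irrefl _ (mem_young.1 hc).2.1)
  have fmem : ∀ o ∈ τ.O G.S n, f o ∈ G.S (n+1) := fun o ho => (h.mem_iff _).2 (.inr ⟨o, ho, rfl⟩)
  have hyi := h.young_iff (G.sub hl) hp
  have hs := G.str hl hp
  have hc := G.sc h.valid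
  by_cases hy : τ.place = p ∨ τ.place ∈ young G.S l n p
  · obtain ⟨g2, j1, j2, j3⟩ := ext_step G hT h hgood g1 k1 Bd (by
      rcases hy with hy | hy
      · rw [hy, ep]; exact hB
      · exact k3 _ hy)
    refine ⟨g2, j1, ?_, ?_⟩
    · intro x hx hxy
      rcases (h.mem_iff x).1 hx with hx' | ⟨o, ho, rfl⟩
      · rw [j2 x hx', k2 x hx' (fun hc => hxy (mem_young.2 ⟨hx, (mem_young.1 hc).2⟩))]
      · exact absurd (mem_young.2 ⟨hx, (hyi o).2 hy⟩) hxy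
    · intro x hx
      rcases (h.mem_iff x).1 (mem_young.1 hx).1 with hx' | ⟨o, ho, rfl⟩
      · rw [j2 x hx']; exact k3 x (mem_young.2 ⟨hx', (mem_young.1 hx).2⟩)
      · exact j3 o ho
  · have hny : ∀ o, f o < p → ∃ y ∈ G.S l, y < p ∧ f o ≤ y := by
      intro o hop
      by_contra hcon
      push Not at hcon
      exact hy ((hyi o).1 ⟨hop, hcon⟩)
    obtain ⟨g2, e1, e2⟩ := glue (G.S n) f h.mono.injective h.nm g1 (fun o => g (f o))
    have lowok : ∀ y ∈ G.S l, y < p → g1 y = g y := fun y hy hyp =>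
      k2 y (G.sub hl hy) (fun hc => lt_irrefl _ ((mem_young.1 hc).2.2 y hy hyp))
    -- young x below new element: new element is above p
    have ab : ∀ x ∈ young G.S l n p, ∀ o, x < f o → p < f o := by
      intro x hx o hxo
      by_contra hcon
      rcases (not_lt.1 hcon).eq_or_lt with h' | h'
      · exact h.nm o (h' ▸ hpn)
      · obtain ⟨y, hy, hyp, hoy⟩ := hny o h'
        exact absurd ((mem_young.1 hx).2.2 y hy hyp) (not_lt.2 (hxo.le.trans hoy))
    refine ⟨g2, ⟨?_, ?_, ?_⟩, ?_, ?_⟩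
    · intro x hx y hy hxy
      rcases (h.mem_iff x).1 hx with hx | ⟨o, ho, rfl⟩ <;> rcases (h.mem_iff y).1 hy with hy | ⟨o', ho', rfl⟩
      · rw [e1 x hx, e1 y hy]; exact k1.mono x hx y hy hxy
      · rw [e1 x hx, e2]
        by_cases hyx : x ∈ young G.S l n p
        · have := ab x hyx o' hxy
          exact (k1.mono x hx p hpn (mem_young.1 hyx).2.1).trans (ep ▸ hg.mono p (hS hpn) _ (fmem _ ho') this)
        · rw [k2 x hx hyx]; exact hg.mono x (hS hx) _ (fmem _ ho') hxy
      · rw [e2, e1 y hy]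
        by_cases hyy : y ∈ young G.S l n p
        · obtain ⟨y0, hy0, hy0p, hoy⟩ := hny o (hxy.trans (mem_young.1 hyy).2.1)
          refine (hg.le (fmem _ ho) (hS (G.sub hl hy0)) hoy).trans_lt ?_
          rw [← lowok y0 hy0 hy0p]
          exact k1.mono _ (G.sub hl hy0) y hy ((mem_young.1 hyy).2.2 y0 hy0 hy0p)
        · rw [k2 y hy hyy]; exact hg.mono _ (fmem _ ho) y (hS hy) hxy
      · rw [e2, e2]; exact hg.mono _ (fmem _ ho) _ (fmem _ ho') hxy
    · intro x hx y hy
      rcases (h.mem_iff x).1 hx with hx | ⟨o, ho, rfl⟩ <;> rcases (h.mem_iff y).1 hy with hy | ⟨o', ho', rfl⟩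
      · rw [e1 x hx, e1 y hy]; exact k1.r1 x hx y hy
      · rw [e1 x hx, e2]
        by_cases hyx : x ∈ young G.S l n p
        · rw [h.F1 x hx o' ho']
          rintro ⟨a, b⟩
          have a' := ab x hyx o' (h.gt o' x hx a)
          have a2 : p < τ.place := a'.trans (h.lt o')
          have b2 := hs.c6 x hyx _ hq a2.le b
          have b3 : G.R1 p (f o') := (h.F1 p hpn o' ho').2 ⟨a2, b2⟩
          have b4 : G.R1 x p := (G.ax n).resp1 x hx p hpn _ hq (mem_young.1 hyx).2.1.le a2.le b
          exact hT.trans1 _ _ _ (k1.r1 _ hx _ hpn b4) (ep ▸ hg.r1 _ (hS hpn) _ (fmem _ ho') b3)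
        · rw [k2 x hx hyx]; exact hg.r1 x (hS hx) _ (fmem _ ho')
      · rw [e2, e1 y hy]
        by_cases hyy : y ∈ young G.S l n p
        · rw [h.F4 y hy o ho]
          rintro ⟨a, b, c⟩
          have hyp := (mem_young.1 hyy).2.1
          have hqp : τ.place < p := a.trans_lt hyp
          have hop := (h.lt o).trans hqp
          obtain ⟨y0, hy0, hy0p, hoy⟩ := hny o hop
          have c' := (hs.c1 y hyy _ hq y0 hy0 hy0p (h.ge (G.sub hl hy0) hoy)).1 c
          have d := hg.r1 _ (fmem _ ho) p (hS hpn) ((h.F4 p hpn o ho).2 ⟨hqp.le, b, c'⟩)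
          refine hT.resp1 _ _ _ ?_ ?_ d
          · refine (hg.le (fmem _ ho) (hS (G.sub hl hy0)) hoy).trans ?_
            rw [← lowok y0 hy0 hy0p]
            exact (k1.mono _ (G.sub hl hy0) y hy ((mem_young.1 hyy).2.2 y0 hy0 hy0p)).le
          · rw [← ep]; exact (k1.mono _ hy _ hpn hyp).le
        · rw [k2 y hy hyy]; exact hg.r1 _ (fmem _ ho) y (hS hy)
      · rw [e2, e2]; exact hg.r1 _ (fmem _ ho) _ (fmem _ ho')
    · intro x hx y hy
      rcases (h.mem_iff x).1 hx with hx | ⟨o, ho, rfl⟩ <;> rcases (h.mem_iff y).1 hy with hy | ⟨o', ho', rfl⟩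
      · rw [e1 x hx, e1 y hy]; exact k1.r2 x hx y hy
      · rw [e1 x hx, e2]
        by_cases hyx : x ∈ young G.S l n p
        · rw [h.F2 x hx o' ho']
          rintro ⟨a, b, c⟩
          have a' := ab x hyx o' (h.gt o' x hx a)
          exact absurd (hc.c2 x hx b o' ho' c) (hs.c7 x hyx _ hq (a'.trans (h.lt o')).le)
        · rw [k2 x hx hyx]; exact hg.r2 x (hS hx) _ (fmem _ ho')
      · intro h'; exact absurd h' (h.F5 y hy o ho)
      · rw [e2, e2]; exact hg.r2 _ (fmem _ ho) _ (fmem _ ho')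
    · intro x hx hxy
      rcases (h.mem_iff x).1 hx with hx' | ⟨o, ho, rfl⟩
      · rw [e1 x hx', k2 x hx' (fun hc => hxy (mem_young.2 ⟨hx, (mem_young.1 hc).2⟩))]
      · rw [e2]
    · intro x hx
      rcases (h.mem_iff x).1 (mem_young.1 hx).1 with hx' | ⟨o, ho, rfl⟩
      · rw [e1 x hx']; exact k3 x (mem_young.2 ⟨hx', (mem_young.1 hx).2⟩)
      · exact absurd ((hyi o).1 (mem_young.1 hx).2) hy

include hT in
lemma good_all (n : ℕ) : ∀ l ≤ n, ∀ p ∈ G.S l, Good G W1 W2 l n p := by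
  have self : ∀ l p, Good G W1 W2 l l p := fun l p g hg Bd _ =>
    ⟨g, hg, fun _ _ _ => rfl, by simp [young_self]⟩
  induction n with
  | zero =>
    intro l hl p hp
    obtain rfl : l = 0 := by omega
    exact self _ _
  | succ n ih =>
    intro l hl p hp
    rcases hl.eq_or_lt with rfl | hl
    · exact self _ _
    · rcases G.step n with h | ⟨τ, f, h⟩
      · have := ih l (by omega) p hp
        have e : young G.S l (n+1) p = young G.S l n p := by simp [young, h]
        unfold Good at this ⊢
        rw [e, h]; exact this
      · exact good_step G hT h ih (by omega) hp

def Gen.K (x : ℚ) : Prop := ∃ n, x ∈ G.S n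

include hT in
theorem univ {n : ℕ} (g : ℚ → T) (hg : Cov (G.S n) G.R1 G.R2 W1 W2 g) :
    ∃ g' : ℚ → T, (∀ x ∈ G.S n, g' x = g x) ∧ ∀ m, Cov (G.S m) G.R1 G.R2 W1 W2 g' := by
  classical
  have one : ∀ m (g : ℚ → T), Cov (G.S m) G.R1 G.R2 W1 W2 g →
      ∃ g', Cov (G.S (m+1)) G.R1 G.R2 W1 W2 g' ∧ ∀ x ∈ G.S m, g' x = g x := by
    intro m g hg
    rcases G.step m with h | ⟨τ, f, h⟩
    · exact ⟨g, h ▸ hg, fun _ _ => rfl⟩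
    · obtain ⟨g', h1, h2, -⟩ := ext_step G hT h (good_all G hT m) g hg ∅ (by simp)
      exact ⟨g', h1, h2⟩
  choose! nx hnx1 hnx2 using one
  let s : ℕ → ℚ → T := fun k => Nat.rec g (fun k gk => nx (n+k) gk) k
  have hs1 : ∀ k, s (k+1) = nx (n+k) (s k) := fun k => rfl
  have hsc : ∀ k, Cov (G.S (n+k)) G.R1 G.R2 W1 W2 (s k) := by
    intro k
    induction k with
    | zero => exact hg
    | succ k ih => rw [hs1]; exact hnx1 _ _ ih
  have hse : ∀ k d, ∀ x ∈ G.S (n+k), s (k+d) x = s k x := by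
    intro k d x hx
    induction d with
    | zero => rfl
    | succ d ih =>
      rw [← add_assoc, hs1, hnx2 _ _ (hsc _) x (G.sub (by omega) hx), ih]
  have hse' : ∀ k k', ∀ x ∈ G.S (n+k), x ∈ G.S (n+k') → s k x = s k' x := by
    intro k k' x h1 h2
    rw [← hse k k' x h1, ← hse k' k x h2, add_comm]
  refine ⟨fun x => if h : ∃ k, x ∈ G.S (n+k) then s h.choose x else g x, ?_, ?_⟩
  · intro x hx
    have h : ∃ k, x ∈ G.S (n+k) := ⟨0, hx⟩
    simp only [dif_pos h]
    exact hse' _ 0 x h.choose_spec hx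
  · intro m
    have e : ∀ x ∈ G.S m, (if h : ∃ k, x ∈ G.S (n+k) then s h.choose x else g x) = s m x := by
      intro x hx
      have hx' : x ∈ G.S (n+m) := G.sub (by omega) hx
      have h : ∃ k, x ∈ G.S (n+k) := ⟨m, hx'⟩
      simp only [dif_pos h]
      exact hse' _ m x h.choose_spec hx'
    have hS := G.sub (show m ≤ n + m by omega)
    constructor
    · intro x hx y hy; simp only [e x hx, e y hy]; exact (hsc m).mono x (hS hx) y (hS hy)
    · intro x hx y hy; simp only [e x hx, e y hy]; exact (hsc m).r1 x (hS hx) y (hS hy)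
    · intro x hx y hy; simp only [e x hx, e y hy]; exact (hsc m).r2 x (hS hx) y (hS hy)

end R2

namespace R2

variable {M : ℕ} (G : Gen M)

abbrev Gen.T : Type := {x : ℚ // G.K x}

def Gen.Q1 (x y : G.T) : Prop := G.R1 x.1 y.1
def Gen.Q2 (x y : G.T) : Prop := G.R2 x.1 y.1

lemma Gen.lt_iff (x y : G.T) : x < y ↔ x.1 < y.1 := Iff.rfl
lemma Gen.le_iff (x y : G.T) : x ≤ y ↔ x.1 ≤ y.1 := Iff.rfl

lemma Gen.fin {ι : Type*} (s : Finset ι) (y : ι → G.T) : ∃ n, ∀ o ∈ s, (y o).1 ∈ G.S n := by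
  classical
  induction s using Finset.induction_on with
  | empty => exact ⟨0, by simp⟩
  | insert a s ha ih =>
    obtain ⟨n, hn⟩ := ih
    obtain ⟨m, hm⟩ := (y a).2
    refine ⟨max n m, ?_⟩
    intro o ho
    rcases Finset.mem_insert.1 ho with rfl | ho
    · exact G.sub (le_max_right _ _) hm
    · exact G.sub (le_max_left _ _) (hn o ho)

lemma Gen.st2 (x y : G.T) : ∃ n, x.1 ∈ G.S n ∧ y.1 ∈ G.S n := by
  obtain ⟨n, hn⟩ := G.fin {x, y} id
  exact ⟨n, hn x (by simp), hn y (by simp)⟩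

lemma Gen.st3 (x y z : G.T) : ∃ n, x.1 ∈ G.S n ∧ y.1 ∈ G.S n ∧ z.1 ∈ G.S n := by
  obtain ⟨n, hn⟩ := G.fin {x, y, z} id
  exact ⟨n, hn x (by simp), hn y (by simp), hn z (by simp)⟩

variable {G}

lemma q_refl (x : G.T) : G.Q2 x x := by
  obtain ⟨n, h1, -⟩ := G.st2 x x
  exact (G.ax n).refl _ h1
lemma q_sub21 {x y : G.T} : G.Q2 x y → G.Q1 x y := by
  obtain ⟨n, h1, h2⟩ := G.st2 x y
  exact (G.ax n).sub21 _ h1 _ h2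
lemma q_sub10 {x y : G.T} : G.Q1 x y → x ≤ y := by
  obtain ⟨n, h1, h2⟩ := G.st2 x y
  exact (G.ax n).sub10 _ h1 _ h2
lemma q_tr1 {x y z : G.T} : G.Q1 x y → G.Q1 y z → G.Q1 x z := by
  obtain ⟨n, h1, h2, h3⟩ := G.st3 x y z
  exact (G.ax n).tr1 _ h1 _ h2 _ h3
lemma q_tr2 {x y z : G.T} : G.Q2 x y → G.Q2 y z → G.Q2 x z := by
  obtain ⟨n, h1, h2, h3⟩ := G.st3 x y z
  exact (G.ax n).tr2 _ h1 _ h2 _ h3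
lemma q_resp1 {x y z : G.T} : x ≤ y → y ≤ z → G.Q1 x z → G.Q1 x y := by
  obtain ⟨n, h1, h2, h3⟩ := G.st3 x y z
  exact (G.ax n).resp1 _ h1 _ h2 _ h3
lemma q_resp2 {x y z : G.T} : G.Q1 x y → G.Q1 y z → G.Q2 x z → G.Q2 x y := by
  obtain ⟨n, h1, h2, h3⟩ := G.st3 x y z
  exact (G.ax n).resp2 _ h1 _ h2 _ h3
lemma q_refl1 (x : G.T) : G.Q1 x x := q_sub21 (q_refl x)

lemma valid_mono {τ : Task} {m n : ℕ} (h : m ≤ n) (hv : τ.Valid G.S G.R1 G.R2 m) : τ.Valid G.S G.R1 G.R2 n := by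
  cases τ with
  | t1 q r => exact ⟨G.sub h hv.1, G.sub h hv.2.1, hv.2.2⟩
  | t2 q r => exact ⟨G.sub h hv.1, G.sub h hv.2.1, hv.2.2⟩
  | t3 p q l => exact ⟨hv.1.trans h, hv.2.1, G.sub h hv.2.2.1, hv.2.2.2⟩

lemma late {τ : Task} {m0 : ℕ} (hv : τ.Valid G.S G.R1 G.R2 m0) (m : ℕ) :
    ∃ n ≥ m, ∃ f, IsStep G.S G.R1 G.R2 n τ f := by
  obtain ⟨n, hn, f, h⟩ := G.fair τ (max m0 m) (valid_mono (le_max_left _ _) hv)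
  exact ⟨n, (le_max_right _ _).trans hn, f, h⟩

lemma late1 {q r : G.T} (hqr : q < r) (h : G.Q1 q r) (m : ℕ) :
    ∃ n ≥ m, ∃ f, IsStep G.S G.R1 G.R2 n (.t1 q.1 r.1) f := by
  obtain ⟨n, h1, h2⟩ := G.st2 q r
  exact late (G := G) (τ := .t1 q.1 r.1) (m0 := n) ⟨h1, h2, hqr, h⟩ m

lemma late2 {q r : G.T} (hqr : q < r) (h : G.Q2 q r) (m : ℕ) :
    ∃ n ≥ m, ∃ f, IsStep G.S G.R1 G.R2 n (.t2 q.1 r.1) f := by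
  obtain ⟨n, h1, h2⟩ := G.st2 q r
  exact late (G := G) (τ := .t2 q.1 r.1) (m0 := n) ⟨h1, h2, hqr, h⟩ m

lemma late3 {p q : G.T} (hqr : p < q) (h : G.Q2 p q) {l : ℕ} (hl : p.1 ∈ G.S l) (m : ℕ) :
    ∃ n ≥ m, ∃ f, IsStep G.S G.R1 G.R2 n (.t3 p.1 q.1 l) f := by
  obtain ⟨n, h1, h2⟩ := G.st2 p q
  exact late (G := G) (τ := .t3 p.1 q.1 l) (m0 := max l n) ⟨le_max_left _ _, hl, G.sub (le_max_right _ _) h2, hqr, h⟩ m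

lemma step_K {n : ℕ} {τ : Task} {f : ℚ → ℚ} (h : IsStep G.S G.R1 G.R2 n τ f) {o : ℚ} (ho : o ∈ τ.O G.S n) :
    G.K (f o) := ⟨n+1, (h.mem_iff _).2 (.inr ⟨o, ho, rfl⟩)⟩

open Classical in
/-- the value of a step as an element of `G.T` -/
noncomputable def fT (f : ℚ → ℚ) (d : G.T) (o : G.T) : G.T := if h : G.K (f o.1) then ⟨f o.1, h⟩ else d

lemma fT_val {n : ℕ} {τ : Task} {f : ℚ → ℚ} (h : IsStep G.S G.R1 G.R2 n τ f) {o : G.T} (ho : o.1 ∈ τ.O G.S n)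
    (d : G.T) : (fT f d o).1 = f o.1 := by
  rw [fT, dif_pos (step_K h ho)]

lemma mem_O1 {n : ℕ} {q r x : ℚ} : x ∈ Task.O G.S n (.t1 q r) ↔ x ∈ G.S n ∧ q ≤ x ∧ x < r := by
  simp [Task.O]
lemma mem_O2 {n : ℕ} {q r x : ℚ} : x ∈ Task.O G.S n (.t2 q r) ↔ x ∈ G.S n ∧ q ≤ x ∧ x < r := by
  simp [Task.O]
lemma mem_O3 {n l : ℕ} {p q x : ℚ} : x ∈ Task.O G.S n (.t3 p q l) ↔ x ∈ G.S n ∧ x < p ∧ ∀ y ∈ G.S l, y < p → y < x := by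
  simp [Task.O, young]

theorem tgtK : Tgt G.Q1 G.Q2 where
  refl := q_refl
  sub21 := fun _ _ => q_sub21
  sub10 := fun _ _ => q_sub10
  trans1 := fun _ _ _ => q_tr1
  resp1 := fun _ _ _ => q_resp1
  ax1 := by
    intro p r hpr O y hy hmono X hX
    rcases (q_sub10 hpr).eq_or_lt with rfl | hlt
    · have : ∀ o ∈ O, False := fun o ho => absurd (hy o ho).2 (not_lt.2 (hy o ho).1)
      refine ⟨fun _ => p, ?_, ?_, ?_, ?_, ?_, ?_⟩ <;> first | exact fun o ho => (this o ho).elim | exact fun x hx o ho => (this o ho).elim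
    obtain ⟨n1, hn1⟩ := G.fin O y
    obtain ⟨n2, hn2⟩ := G.fin X id
    obtain ⟨n, hn, f, h⟩ := late1 hlt hpr (max n1 n2)
    have hO : ∀ o ∈ O, (y o).1 ∈ Task.O G.S n (.t1 p.1 r.1) := fun o ho =>
      mem_O1.2 ⟨G.sub ((le_max_left _ _).trans hn) (hn1 o ho), hy o ho⟩
    have hXn : ∀ x ∈ X, x.1 ∈ G.S n := fun x hx => G.sub ((le_max_right _ _).trans hn) (hn2 x hx)
    have e : ∀ o ∈ O, (fT f p (y o)).1 = f (y o).1 := fun o ho => fT_val h (hO o ho) p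
    refine ⟨fun o => fT f p (y o), ?_, ?_, ?_, ?_, ?_, ?_⟩
    · intro o ho; rw [G.lt_iff, e o ho]; exact h.lt _
    · intro o ho x hx; rw [G.lt_iff, e o ho]; exact h.gt _ _ (hXn x hx) (hX x hx)
    · intro o ho o' ho' hh; rw [G.lt_iff, e o ho, e o' ho']; exact h.mono (hmono o ho o' ho' hh)
    · intro o ho o' ho' hh; rw [Gen.Q1, e o ho, e o' ho']; exact (h.F31 _ (hO o ho) _ (hO o' ho')).2 hh
    · intro o ho o' ho' hh; rw [Gen.Q2, e o ho, e o' ho']; exact (h.F32 _ (hO o ho) _ (hO o' ho')).2 hh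
    · intro x hx o ho hh; rw [Gen.Q2, e o ho]; exact (h.F2 _ (hXn x hx) _ (hO o ho)).2 ⟨hX x hx, hX x hx, hh⟩
  ax2 := by
    intro p r hpr O y hy hmono X hX
    rcases (q_sub10 (q_sub21 hpr)).eq_or_lt with rfl | hlt
    · have : ∀ o ∈ O, False := fun o ho => absurd (hy o ho).2 (not_lt.2 (hy o ho).1)
      refine ⟨fun _ => p, ⟨?_, ?_, ?_, ?_, ?_, ?_⟩, ?_⟩ <;> first | exact fun o ho => (this o ho).elim | exact fun x hx o ho => (this o ho).elim
    obtain ⟨n1, hn1⟩ := G.fin O y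
    obtain ⟨n2, hn2⟩ := G.fin X id
    obtain ⟨n, hn, f, h⟩ := late2 hlt hpr (max n1 n2)
    have hO : ∀ o ∈ O, (y o).1 ∈ Task.O G.S n (.t2 p.1 r.1) := fun o ho =>
      mem_O2.2 ⟨G.sub ((le_max_left _ _).trans hn) (hn1 o ho), hy o ho⟩
    have hXn : ∀ x ∈ X, x.1 ∈ G.S n := fun x hx => G.sub ((le_max_right _ _).trans hn) (hn2 x hx)
    have e : ∀ o ∈ O, (fT f p (y o)).1 = f (y o).1 := fun o ho => fT_val h (hO o ho) p
    refine ⟨fun o => fT f p (y o), ⟨?_, ?_, ?_, ?_, ?_, ?_⟩, ?_⟩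
    · intro o ho; rw [G.lt_iff, e o ho]; exact h.lt _
    · intro o ho x hx; rw [G.lt_iff, e o ho]; exact h.gt _ _ (hXn x hx) (hX x hx)
    · intro o ho o' ho' hh; rw [G.lt_iff, e o ho, e o' ho']; exact h.mono (hmono o ho o' ho' hh)
    · intro o ho o' ho' hh; rw [Gen.Q1, e o ho, e o' ho']; exact (h.F31 _ (hO o ho) _ (hO o' ho')).2 hh
    · intro o ho o' ho' hh; rw [Gen.Q2, e o ho, e o' ho']; exact (h.F32 _ (hO o ho) _ (hO o' ho')).2 hh
    · intro x hx o ho hh; rw [Gen.Q2, e o ho]; exact (h.F2 _ (hXn x hx) _ (hO o ho)).2 ⟨hX x hx, hX x hx, hh⟩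
    · intro o ho hh; rw [Gen.Q1, e o ho]
      exact (h.F4 _ h.valid.1 _ (hO o ho)).2 ⟨le_rfl, hh, q_refl1 p⟩
  ax3 := by
    intro p q hpq O D1 D2 X E hX hcp Bd hBd
    rcases (q_sub10 (q_sub21 hpq)).eq_or_lt with rfl | hlt
    · exact hcp Bd hBd
    classical
    obtain ⟨l0, hl0⟩ := p.2
    obtain ⟨l1, hl1⟩ := G.fin X id
    set L := max l0 l1 with hL
    have hpL : p.1 ∈ G.S L := G.sub (le_max_left _ _) hl0
    have hXL : ∀ x ∈ X, x.1 ∈ G.S L := fun x hx => G.sub (le_max_right _ _) (hl1 x hx)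
    let B0 : Finset G.T := (G.S L).attach.image (fun x => (⟨x.1, L, x.2⟩ : G.T)) |>.filter (fun z => z < p)
    have hB0 : ∀ x (hx : x ∈ G.S L), x < p.1 → (⟨x, L, hx⟩ : G.T) ∈ B0 := by
      intro x hx hxp
      exact Finset.mem_filter.2 ⟨Finset.mem_image.2 ⟨⟨x, hx⟩, Finset.mem_attach _ _, rfl⟩, hxp⟩
    obtain ⟨ν, hν⟩ := hcp B0 (by intro b hb; exact (Finset.mem_filter.1 hb).2)
    obtain ⟨n1, hn1⟩ := G.fin O ν
    obtain ⟨n2, hn2⟩ := G.fin Bd id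
    obtain ⟨n, hn, f, h⟩ := late3 hlt hpq hpL (max (max n1 n2) L)
    have hnL : L ≤ n := (le_max_right _ _).trans hn
    have hn' : max n1 n2 ≤ n := (le_max_left _ _).trans hn
    have hO : ∀ o ∈ O, (ν o).1 ∈ Task.O G.S n (.t3 p.1 q.1 L) := fun o ho =>
      mem_O3.2 ⟨G.sub ((le_max_left _ _).trans hn') (hn1 o ho), hν.lt o ho, fun y hy hyp =>
        hν.gt o ho _ (hB0 y hy hyp)⟩
    have hBn : ∀ x ∈ Bd, x.1 ∈ G.S n := fun x hx => G.sub ((le_max_right _ _).trans hn') (hn2 x hx)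
    have e : ∀ o ∈ O, (fT f p (ν o)).1 = f (ν o).1 := fun o ho => fT_val h (hO o ho) p
    refine ⟨fun o => fT f p (ν o), ?_, ?_, ?_, ?_, ?_, ?_⟩
    · intro o ho; rw [G.lt_iff, e o ho]; exact h.lt _
    · intro o ho x hx; rw [G.lt_iff, e o ho]; exact h.gt _ _ (hBn x hx) (hBd x hx)
    · intro o ho o' ho' hh; rw [G.lt_iff, e o ho, e o' ho']; exact h.mono (hν.mono o ho o' ho' hh)
    · intro o ho o' ho' hh; rw [Gen.Q1, e o ho, e o' ho']; exact (h.F31 _ (hO o ho) _ (hO o' ho')).2 (hν.d1 o ho o' ho' hh)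
    · intro o ho o' ho' hh; rw [Gen.Q2, e o ho, e o' ho']; exact (h.F32 _ (hO o ho) _ (hO o' ho')).2 (hν.d2 o ho o' ho' hh)
    · intro x hx o ho hh; rw [Gen.Q2, e o ho]
      exact (h.F2 _ (G.sub hnL (hXL x hx)) _ (hO o ho)).2 ⟨(hX x hx).trans hlt, ⟨x.1, hXL x hx, hX x hx, le_rfl⟩, hν.e x hx o ho hh⟩

/-- extension of finite coverings into arbitrary targets, as maps on `G.T` -/
theorem univT {T : Type*} [LinearOrder T] {W1 W2 : T → T → Prop} (hT : Tgt W1 W2) {n : ℕ} (g : ℚ → T)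
    (hg : Cov (G.S n) G.R1 G.R2 W1 W2 g) : ∃ g' : G.T → T, StrictMono g' ∧ ∀ x : G.T, x.1 ∈ G.S n → g' x = g x.1 := by
  obtain ⟨g', h1, h2⟩ := univ G hT g hg
  refine ⟨fun x => g' x.1, ?_, fun x hx => h1 _ hx⟩
  intro x y hxy
  obtain ⟨m, hx, hy⟩ := G.st2 x y
  exact (h2 m).mono _ hx _ hy hxy

lemma no_lower [WellFoundedLT G.T] {n : ℕ} (g : ℚ → G.T) (hg : Cov (G.S n) G.R1 G.R2 G.Q1 G.Q2 g) (x : G.T)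
    (hx : x.1 ∈ G.S n) : x ≤ g x.1 := by
  obtain ⟨g', h1, h2⟩ := univT tgtK g hg
  rw [← h2 x hx]
  exact h1.le_apply

/-- exact reflection for `Q1`: finite version with index types -/
lemma p1 {a b : G.T} (hab : a < b) (h1 : G.Q1 a b) {κ δ : Type} [Finite κ] [Finite δ] (x : κ → G.T) (y : δ → G.T)
    (hx : ∀ i, x i < a) (hy : ∀ i, y i < b) : ∃ y' : δ → G.T, (∀ i, y' i < a) ∧
      ∀ i j, let u := Sum.elim x y; let u' := Sum.elim x y'
        (u' i ≤ u' j ↔ u i ≤ u j) ∧ (G.Q1 (u' i) (u' j) ↔ G.Q1 (u i) (u j)) ∧ (G.Q2 (u' i) (u' j) ↔ G.Q2 (u i) (u j)) := by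
  classical
  have := Fintype.ofFinite κ
  have := Fintype.ofFinite δ
  obtain ⟨n1, hn1⟩ := G.fin (Finset.univ : Finset (κ ⊕ δ)) (Sum.elim x y)
  obtain ⟨n, hn, f, h⟩ := late1 hab h1 n1
  have hu : ∀ i, (Sum.elim x y i).1 ∈ G.S n := fun i => G.sub hn (hn1 i (by simp))
  have han : a.1 ∈ G.S n := h.valid.1
  have hbn : b.1 ∈ G.S n := h.valid.2.1
  have hub : ∀ i, Sum.elim x y i < b := by rintro (i | i); exacts [(hx i).trans hab, hy i]
  have hO : ∀ z : G.T, z.1 ∈ G.S n → a ≤ z → z < b → z.1 ∈ Task.O G.S n (.t1 a.1 b.1) :=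
    fun z h1 h2 h3 => mem_O1.2 ⟨h1, h2, h3⟩
  let φ : G.T → G.T := fun z => if z < a then z else fT f a z
  have φ1 : ∀ z, z < a → φ z = z := fun z hz => by simp [φ, hz]
  have φ2 : ∀ z : G.T, z.1 ∈ G.S n → a ≤ z → z < b → (φ z).1 = f z.1 := fun z h1 h2 h3 => by
    simp only [φ, if_neg (not_lt.2 h2)]; exact fT_val h (hO z h1 h2 h3) a
  have φlt : ∀ z : G.T, z.1 ∈ G.S n → z < b → φ z < a := by
    intro z h1 h3
    by_cases hz : z < a
    · rw [φ1 z hz]; exact hz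
    · rw [G.lt_iff, φ2 z h1 (not_lt.1 hz) h3]; exact h.lt _
  have key : ∀ z w : G.T, z.1 ∈ G.S n → w.1 ∈ G.S n → z < b → w < b →
      (φ z ≤ φ w ↔ z ≤ w) ∧ (G.Q1 (φ z) (φ w) ↔ G.Q1 z w) ∧ (G.Q2 (φ z) (φ w) ↔ G.Q2 z w) := by
    intro z w hz hw hzb hwb
    by_cases hza : z < a <;> by_cases hwa : w < a
    · rw [φ1 z hza, φ1 w hwa]; exact ⟨Iff.rfl, Iff.rfl, Iff.rfl⟩
    · rw [φ1 z hza]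
      have hwa := not_lt.1 hwa
      have e := φ2 w hw hwa hwb
      have hwO := hO w hw hwa hwb
      refine ⟨?_, ?_, ?_⟩
      · rw [G.le_iff, e]
        exact iff_of_true (h.gt _ _ hz hza).le (hza.le.trans hwa)
      · rw [Gen.Q1, e, h.F1 _ hz _ hwO]
        exact ⟨fun hh => q_resp1 (hza.le.trans hwa) hwb.le (q_tr1 (x := z) (y := a) hh.2 h1),
          fun hh => ⟨hza, q_resp1 (x := z) (y := a) (z := w) hza.le hwa hh⟩⟩
      · rw [Gen.Q2, e, h.F2 _ hz _ hwO]
        exact ⟨fun hh => hh.2.2, fun hh => ⟨hza, hza, hh⟩⟩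
    · have hza := not_lt.1 hza
      rw [φ1 w hwa]
      have e := φ2 z hz hza hzb
      have hzO := hO z hz hza hzb
      have hn : ¬ z ≤ w := not_le.2 (hwa.trans_le hza)
      refine ⟨?_, ?_, ?_⟩
      · rw [G.le_iff, e]
        exact iff_of_false (fun hc => absurd (h.gt z.1 w.1 hw hwa) (not_lt.2 hc)) hn
      · rw [Gen.Q1, e, h.F4 _ hw _ hzO]
        exact iff_of_false (fun hc => hc.2.1) (fun hc => hn (q_sub10 hc))
      · rw [Gen.Q2, e]
        exact iff_of_false (h.F5 _ hw _ hzO) (fun hc => hn (q_sub10 (q_sub21 hc)))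
    · have hza := not_lt.1 hza
      have hwa := not_lt.1 hwa
      rw [G.le_iff, Gen.Q1, Gen.Q2, φ2 z hz hza hzb, φ2 w hw hwa hwb, h.F31 _ (hO z hz hza hzb) _ (hO w hw hwa hwb),
        h.F32 _ (hO z hz hza hzb) _ (hO w hw hwa hwb)]
      exact ⟨h.mono.le_iff_le, Iff.rfl, Iff.rfl⟩
  refine ⟨fun i => φ (y i), fun i => φlt _ (hu (.inr i)) (hy i), ?_⟩
  intro i j
  have eu : ∀ i, Sum.elim x (fun i => φ (y i)) i = φ (Sum.elim x y i) := by
    rintro (i | i)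
    · simp [φ1 _ (hx i)]
    · rfl
  simp only [eu]
  exact key _ _ (hu i) (hu j) (hub i) (hub j)

end R2

namespace R2

variable {M : ℕ} {G : Gen M}

lemma gl {n : ℕ} {τ : Task} {f : ℚ → ℚ} (h : IsStep G.S G.R1 G.R2 n τ f) {o : ℚ} (ho : o ∈ τ.O G.S n) {y : ℚ}
    (hy : G.K y) (hqy : τ.place ≤ y) : (G.R1 (f o) y ↔ τ.mu G.R1 o ∧ G.R1 τ.place y) ∧ ¬ G.R2 (f o) y := by
  obtain ⟨N0, hN0⟩ := hy
  obtain ⟨N, hN, hyN⟩ : ∃ N, n + 1 ≤ N ∧ y ∈ G.S N := ⟨max N0 (n+1), le_max_right _ _, G.sub (le_max_left _ _) hN0⟩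
  have hq := Task.place_mem h.valid
  have hqN := G.sub (show n ≤ N by omega) hq
  have hf : f o ∈ G.S N := G.sub hN ((h.mem_iff _).2 (.inr ⟨o, ho, rfl⟩))
  have hyo : f o ∈ young G.S n N τ.place := mem_young.2 ⟨hf, h.lt o, fun y hy hyq => h.gt o y hy hyq⟩
  have hs := G.str (show n ≤ N by omega) hq
  have hF := h.F4 _ hq o ho
  have hr : G.R1 τ.place τ.place := (G.ax n).sub21 _ hq _ hq ((G.ax n).refl _ hq)
  refine ⟨⟨fun h1 => ⟨?_, hs.c6 _ hyo y hyN hqy h1⟩, fun ⟨h1, h2⟩ => ?_⟩, hs.c7 _ hyo y hyN hqy⟩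
  · exact (hF.1 ((G.ax N).resp1 _ hf _ hqN _ hyN (h.lt o).le hqy h1)).2.1
  · exact (G.ax N).tr1 _ hf _ hqN _ hyN (hF.2 ⟨le_rfl, h1, hr⟩) h2

variable (G) in
structure Ctx (a b c t a0 : ℚ) (l n : ℕ) (f0 ι : ℚ → ℚ) (Y : Finset ℚ) : Prop where
  st : IsStep G.S G.R1 G.R2 l (.t2 a b) f0
  cm : c ∈ G.S (l+1)
  ca : c < a
  cmax : ∀ x ∈ G.S (l+1), x < a → x ≤ c
  Y1 : ∀ y ∈ Y, G.K y ∧ c < y ∧ y < a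
  Y2 : ∀ x ∈ G.S n, c < x → x < a → x ∈ Y
  tmax : ∀ r ∈ G.S n, G.R1 a r → r ≤ t
  i1 : ∀ o ∈ G.S n, a ≤ o → o < t → ι o ∈ Y ∧ ι o < a0
  i2 : StrictMono ι
  i3 : ∀ x ∈ G.S n, x < a → ∀ o ∈ G.S n, a ≤ o → o < t →
    x < ι o ∧ (G.R1 x (ι o) ↔ G.R1 x a) ∧ (G.R2 x (ι o) ↔ G.R2 x o)
  i4 : ∀ o ∈ G.S n, a ≤ o → o < t → ∀ o' ∈ G.S n, a ≤ o' → o' < t →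
    (G.R1 (ι o) (ι o') ↔ G.R1 o o') ∧ (G.R2 (ι o) (ι o') ↔ G.R2 o o')
  i5 : a0 ∈ Y
  i6 : ∀ x ∈ G.S n, x < a → x < a0 ∧ (G.R1 x a → G.R1 x a0)

variable (G) in
def Dom (c : ℚ) (Y : Finset ℚ) (m : ℕ) (x : ℚ) : Prop := (x ∈ G.S m ∧ x ≤ c) ∨ x ∈ Y

variable (G) in
structure Inv (a b c : ℚ) (l : ℕ) (f0 : ℚ → ℚ) (Y : Finset ℚ) (m : ℕ) (h : ℚ → ℚ) (L : ℕ → ℕ) : Prop where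
  mono : ∀ x y, Dom G c Y m x → Dom G c Y m y → x < y → h x < h y
  r1 : ∀ x y, Dom G c Y m x → Dom G c Y m y → (G.R1 (h x) (h y) ↔ G.R1 x y)
  r2 : ∀ x y, Dom G c Y m x → Dom G c Y m y → (G.R2 (h x) (h y) ↔ G.R2 x y)
  id : ∀ x, Dom G c Y m x → x < f0 a → h x = x
  base : ∀ v ∈ Task.O G.S l (.t2 a b), h (f0 v) = v
  mem : ∀ m', l + 1 ≤ m' → m' ≤ m → ∀ x, Dom G c Y m' x → h x ∈ G.S (L m')
  bk : ∀ m', l + 1 ≤ m' → m' ≤ m → ∀ p ∈ G.S m', f0 a < p → p ≤ c → ∀ o ∈ young G.S m' m p,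
    ∀ z ∈ G.S (L m'), z < h p → z < h o
  lb : ∀ x, Dom G c Y m x → h x < b

section
variable {a b c t a0 : ℚ} {l n : ℕ} {f0 ι : ℚ → ℚ} {Y : Finset ℚ} (X : Ctx G a b c t a0 l n f0 ι Y)
include X

lemma Ctx.aO : a ∈ Task.O G.S l (.t2 a b) := mem_O2.2 ⟨X.st.valid.1, le_rfl, X.st.valid.2.2.1⟩
lemma Ctx.am : f0 a ∈ G.S (l+1) := (X.st.mem_iff _).2 (.inr ⟨a, X.aO, rfl⟩)
lemma Ctx.aa : f0 a < a := X.st.lt a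
lemma Ctx.ac : f0 a ≤ c := X.cmax _ X.am X.aa
lemma Ctx.lo {x : ℚ} (hx : x ∈ G.S l) (h : x < a) : x < f0 a := X.st.gt a x hx h
lemma Ctx.lo' {x : ℚ} (hx : x ∈ G.S (l+1)) (h : x < f0 a) : x ∈ G.S l := by
  rcases (X.st.mem_iff _).1 hx with h' | ⟨o, ho, rfl⟩
  · exact h'
  · exact absurd h (not_lt.2 (X.st.mono.monotone (mem_O2.1 ho).2.1))
lemma Ctx.amn (m : ℕ) (hm : l + 1 ≤ m) : f0 a ∈ G.S m := G.sub hm X.am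
lemma Ctx.domS {m : ℕ} (hmn : m ≤ n) {x : ℚ} (hx : x ∈ G.S m) (hxa : x < a) : Dom G c Y m x := by
  by_cases hc : x ≤ c
  · exact .inl ⟨hx, hc⟩
  · exact .inr (X.Y2 x (G.sub hmn hx) (not_le.1 hc) hxa)
lemma Ctx.domK {m : ℕ} {x : ℚ} (hx : Dom G c Y m x) : G.K x := by
  rcases hx with hx | hx
  · exact ⟨m, hx.1⟩
  · exact (X.Y1 x hx).1
lemma Ctx.doma {m : ℕ} {x : ℚ} (hx : Dom G c Y m x) : x < a := by
  rcases hx with hx | hx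
  · exact hx.2.trans_lt X.ca
  · exact (X.Y1 x hx).2.2
lemma Ctx.domlow {m : ℕ} {x : ℚ} (hx : Dom G c Y m x) (hc : x ≤ c) : x ∈ G.S m := by
  rcases hx with hx | hx
  · exact hx.1
  · exact absurd (X.Y1 x hx).2.1 (not_lt.2 hc)
omit X in
lemma dom_sub {m m' : ℕ} (h : m ≤ m') {x : ℚ} (hx : Dom G c Y m x) : Dom G c Y m' x := by
  rcases hx with hx | hx
  · exact .inl ⟨G.sub h hx.1, hx.2⟩
  · exact .inr hx
/-- elements strictly between `f0 a` and `c` are young over `a` -/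
lemma Ctx.yg {m : ℕ} {q : ℚ} (hq : q ∈ G.S m) (h1 : f0 a ≤ q) (h2 : q < a) : q ∈ young G.S l m a :=
  mem_young.2 ⟨hq, h2, fun _ hy hya => (X.lo hy hya).trans_le h1⟩

lemma ext_triv {m : ℕ} {h : ℚ → ℚ} {L : ℕ → ℕ} (hI : Inv G a b c l f0 Y m h L)
    (hm : l + 1 ≤ m) (hS : ∀ x ∈ G.S (m+1), x ≤ c → x ∈ G.S m) : ∃ L', Inv G a b c l f0 Y (m+1) h L' := by
  have hD : ∀ x, Dom G c Y (m+1) x → Dom G c Y m x := by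
    rintro x (hx | hx)
    · exact .inl ⟨hS x hx.1 hx.2, hx.2⟩
    · exact .inr hx
  refine ⟨fun m' => if m' = m + 1 then L m else L m', ?_, ?_, ?_, ?_, hI.base, ?_, ?_, ?_⟩
  · exact fun x y hx hy => hI.mono x y (hD x hx) (hD y hy)
  · exact fun x y hx hy => hI.r1 x y (hD x hx) (hD y hy)
  · exact fun x y hx hy => hI.r2 x y (hD x hx) (hD y hy)
  · exact fun x hx => hI.id x (hD x hx)
  · intro m' h1 h2 x hx
    by_cases e : m' = m + 1
    · subst e; simp only [if_true]; exact hI.mem m hm le_rfl x (hD x hx)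
    · simp only [if_neg e]; exact hI.mem m' h1 (by omega) x hx
  · intro m' h1 h2 p hp hap hpc o ho
    by_cases e : m' = m + 1
    · subst e; simp [young_self] at ho
    · simp only [if_neg e]
      have := mem_young.1 ho
      exact hI.bk m' h1 (by omega) p hp hap hpc o (mem_young.2 ⟨hS o this.1 (this.2.1.le.trans hpc), this.2⟩)
  · exact fun x hx => hI.lb x (hD x hx)

lemma ext_gen {m : ℕ} {h : ℚ → ℚ} {L : ℕ → ℕ} (hI : Inv G a b c l f0 Y m h L) (hm : l + 1 ≤ m)
    {τ : Task} {f : ℚ → ℚ} (hst : IsStep G.S G.R1 G.R2 m τ f) (hqc : τ.place ≤ c) (ν : ℚ → ℚ) (Ln : ℕ)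
    (hLn : L m ≤ Ln)
    (g1 : ∀ o ∈ τ.O G.S m, ∀ x ∈ G.S m, x < τ.place → h x < ν o)
    (g1' : ∀ o ∈ τ.O G.S m, ν o < h τ.place)
    (g2 : ∀ o ∈ τ.O G.S m, ∀ o' ∈ τ.O G.S m, o < o' → ν o < ν o')
    (g3 : ∀ o ∈ τ.O G.S m, ∀ x ∈ G.S m, x < τ.place → (G.R1 (h x) (ν o) ↔ G.R1 x τ.place) ∧
      (G.R2 (h x) (ν o) ↔ τ.low G.S x ∧ G.R2 x o))
    (g4 : ∀ o ∈ τ.O G.S m, ∀ o' ∈ τ.O G.S m, (G.R1 (ν o) (ν o') ↔ G.R1 o o') ∧ (G.R2 (ν o) (ν o') ↔ G.R2 o o'))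
    (g5 : ∀ o ∈ τ.O G.S m, ∀ x, Dom G c Y m x → τ.place ≤ x →
      (G.R1 (ν o) (h x) ↔ τ.mu G.R1 o ∧ G.R1 τ.place x) ∧ ¬ G.R2 (ν o) (h x))
    (g6 : ∀ o ∈ τ.O G.S m, ν o ∈ G.S Ln)
    (g6' : ∀ o ∈ τ.O G.S m, f o < f0 a → ν o = f o)
    (g7 : f0 a < τ.place → ∀ o ∈ τ.O G.S m, ∀ m', l + 1 ≤ m' → m' ≤ m → ∀ z ∈ G.S (L m'), z < h τ.place → z < ν o) :
    ∃ h' L', Inv G a b c l f0 Y (m+1) h' L' := by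
  classical
  have hq := Task.place_mem hst.valid
  have hqD : Dom G c Y m τ.place := .inl ⟨hq, hqc⟩
  obtain ⟨h', e1, e2⟩ := glue ((G.S m).filter (· ≤ c) ∪ Y) f hst.mono.injective (by
    intro o ho
    simp only [Finset.mem_union, Finset.mem_filter] at ho
    rcases ho with ho | ho
    · exact hst.nm o ho.1
    · exact absurd (X.Y1 _ ho).2.1 (not_lt.2 ((hst.lt o).le.trans hqc))) h ν
  have e1 : ∀ x, Dom G c Y m x → h' x = h x := fun x hx => e1 x (by
    simp only [Finset.mem_union, Finset.mem_filter]; exact hx)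
  have hD : ∀ x, Dom G c Y (m+1) x → Dom G c Y m x ∨ ∃ o ∈ τ.O G.S m, f o = x := by
    rintro x (hx | hx)
    · rcases (hst.mem_iff x).1 hx.1 with h' | h'
      · exact .inl (.inl ⟨h', hx.2⟩)
      · exact .inr h'
    · exact .inl (.inr hx)
  have dl : ∀ x, Dom G c Y m x → x < τ.place → x ∈ G.S m := fun x hx hxq => X.domlow hx (hxq.le.trans hqc)
  have hlt : ∀ x, Dom G c Y m x → ∀ o, (x < f o ↔ x < τ.place) := by
    intro x hx o
    exact ⟨fun h' => h'.trans (hst.lt o), fun h' => hst.gt o x (dl x hx h') h'⟩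
  have hne : ∀ x, Dom G c Y m x → ∀ o, x < f o ∨ τ.place ≤ x := by
    intro x hx o
    rcases lt_or_ge x τ.place with h1 | h1
    · exact .inl ((hlt x hx o).2 h1)
    · exact .inr h1
  have hle : ∀ x, Dom G c Y m x → τ.place ≤ x → h τ.place ≤ h x := by
    intro x hx hqx
    rcases hqx.eq_or_lt with rfl | h'
    · exact le_rfl
    · exact (hI.mono _ _ hqD hx h').le
  have f1 : ∀ x, Dom G c Y m x → ∀ o ∈ τ.O G.S m,
      (x < f o → h x < ν o) ∧ (G.R1 (h x) (ν o) ↔ G.R1 x (f o)) ∧ (G.R2 (h x) (ν o) ↔ G.R2 x (f o)) := by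
    intro x hx o ho
    rcases lt_or_ge x τ.place with hxq | hxq
    · have hxm := dl x hx hxq
      have := g3 o ho x hxm hxq
      rw [hst.F1 x hxm o ho, hst.F2 x hxm o ho, this.1, this.2]
      exact ⟨fun _ => g1 o ho x hxm hxq, by simp [hxq], by simp [hxq]⟩
    · have A : ¬ x ≤ f o := not_le.2 ((hst.lt o).trans_le hxq)
      have B : ¬ h x ≤ ν o := not_le.2 ((g1' o ho).trans_le (hle x hx hxq))
      have Kx := X.domK hx
      have Kh : G.K (h x) := ⟨_, hI.mem m hm le_rfl x hx⟩
      have Kf := step_K hst ho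
      have Kν : G.K (ν o) := ⟨_, g6 o ho⟩
      refine ⟨fun h' => absurd h'.le A, iff_of_false (fun h' => B ?_) (fun h' => A ?_),
        iff_of_false (fun h' => B ?_) (fun h' => A ?_)⟩
      · exact q_sub10 (x := (⟨_, Kh⟩ : G.T)) (y := ⟨_, Kν⟩) h'
      · exact q_sub10 (x := (⟨_, Kx⟩ : G.T)) (y := ⟨_, Kf⟩) h'
      · exact q_sub10 (q_sub21 (x := (⟨_, Kh⟩ : G.T)) (y := ⟨_, Kν⟩) h')
      · exact q_sub10 (q_sub21 (x := (⟨_, Kx⟩ : G.T)) (y := ⟨_, Kf⟩) h')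
  have f2 : ∀ x, Dom G c Y m x → ∀ o ∈ τ.O G.S m,
      (f o < x → ν o < h x) ∧ (G.R1 (ν o) (h x) ↔ G.R1 (f o) x) ∧ (G.R2 (ν o) (h x) ↔ G.R2 (f o) x) := by
    intro x hx o ho
    have Kx := X.domK hx
    rcases lt_or_ge x τ.place with hxq | hxq
    · have A : ¬ f o ≤ x := not_le.2 ((hlt x hx o).2 hxq)
      have B : ¬ ν o ≤ h x := not_le.2 (g1 o ho x (dl x hx hxq) hxq)
      have Kh : G.K (h x) := ⟨_, hI.mem m hm le_rfl x hx⟩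
      have Kf := step_K hst ho
      have Kν : G.K (ν o) := ⟨_, g6 o ho⟩
      refine ⟨fun h' => absurd h'.le A, iff_of_false (fun h' => B ?_) (fun h' => A ?_),
        iff_of_false (fun h' => B ?_) (fun h' => A ?_)⟩
      · exact q_sub10 (x := (⟨_, Kν⟩ : G.T)) (y := ⟨_, Kh⟩) h'
      · exact q_sub10 (x := (⟨_, Kf⟩ : G.T)) (y := ⟨_, Kx⟩) h'
      · exact q_sub10 (q_sub21 (x := (⟨_, Kν⟩ : G.T)) (y := ⟨_, Kh⟩) h')
      · exact q_sub10 (q_sub21 (x := (⟨_, Kf⟩ : G.T)) (y := ⟨_, Kx⟩) h')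
    · have := gl hst ho Kx hxq
      have h5 := g5 o ho x hx hxq
      refine ⟨fun _ => (g1' o ho).trans_le (hle x hx hxq), h5.1.trans this.1.symm, iff_of_false h5.2 this.2⟩
  refine ⟨h', fun m' => if m' = m + 1 then Ln else L m', ?_, ?_, ?_, ?_, ?_, ?_, ?_, ?_⟩
  · intro x y hx hy hxy
    rcases hD x hx with hx | ⟨o, ho, rfl⟩ <;> rcases hD y hy with hy | ⟨o', ho', rfl⟩
    · rw [e1 x hx, e1 y hy]; exact hI.mono x y hx hy hxy
    · rw [e1 x hx, e2]; exact (f1 x hx o' ho').1 hxy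
    · rw [e2, e1 y hy]; exact (f2 y hy o ho).1 hxy
    · rw [e2, e2]; exact g2 o ho o' ho' (hst.mono.lt_iff_lt.1 hxy)
  · intro x y hx hy
    rcases hD x hx with hx | ⟨o, ho, rfl⟩ <;> rcases hD y hy with hy | ⟨o', ho', rfl⟩
    · rw [e1 x hx, e1 y hy]; exact hI.r1 x y hx hy
    · rw [e1 x hx, e2]; exact (f1 x hx o' ho').2.1
    · rw [e2, e1 y hy]; exact (f2 y hy o ho).2.1
    · rw [e2, e2, hst.F31 o ho o' ho']; exact (g4 o ho o' ho').1
  · intro x y hx hy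
    rcases hD x hx with hx | ⟨o, ho, rfl⟩ <;> rcases hD y hy with hy | ⟨o', ho', rfl⟩
    · rw [e1 x hx, e1 y hy]; exact hI.r2 x y hx hy
    · rw [e1 x hx, e2]; exact (f1 x hx o' ho').2.2
    · rw [e2, e1 y hy]; exact (f2 y hy o ho).2.2
    · rw [e2, e2, hst.F32 o ho o' ho']; exact (g4 o ho o' ho').2
  · intro x hx hxa
    rcases hD x hx with hx | ⟨o, ho, rfl⟩
    · rw [e1 x hx]; exact hI.id x hx hxa
    · rw [e2]; exact g6' o ho hxa
  · intro v hv
    have hv1 : f0 v ∈ G.S (l+1) := (X.st.mem_iff _).2 (.inr ⟨v, hv, rfl⟩)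
    rw [e1 _ (.inl ⟨G.sub hm hv1, X.cmax _ hv1 (X.st.lt v)⟩)]
    exact hI.base v hv
  · intro m' h1 h2 x hx
    by_cases e : m' = m + 1
    · subst e
      simp only [if_true]
      rcases hD x hx with hx | ⟨o, ho, rfl⟩
      · rw [e1 x hx]; exact G.sub hLn (hI.mem m hm le_rfl x hx)
      · rw [e2]; exact g6 o ho
    · simp only [if_neg e]
      rw [e1 x (dom_sub (by omega) hx)]
      exact hI.mem m' h1 (by omega) x hx
  · intro m' h1 h2 p hp hap hpc o ho z hz
    by_cases e : m' = m + 1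
    · subst e; simp [young_self] at ho
    · simp only [if_neg e] at hz
      have hm' : m' ≤ m := by omega
      have hpm := G.sub hm' hp
      rw [e1 p (.inl ⟨hpm, hpc⟩)]
      have hyo := mem_young.1 ho
      rcases (hst.mem_iff o).1 hyo.1 with hom | ⟨o1, ho1, rfl⟩
      · rw [e1 o (.inl ⟨hom, hyo.2.1.le.trans hpc⟩)]
        exact hI.bk m' h1 hm' p hp hap hpc o (mem_young.2 ⟨hom, hyo.2⟩) z hz
      · rw [e2]
        have haq : f0 a < τ.place := (hyo.2.2 _ (X.amn m' h1) hap).trans (hst.lt o1)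
        intro hzp
        refine g7 haq o1 ho1 m' h1 hm' z hz ?_
        rcases (hst.young_iff (G.sub hm') hp o1).1 hyo.2 with h' | h'
        · rw [h']; exact hzp
        · exact hI.bk m' h1 hm' p hp hap hpc _ h' z hz hzp
  · intro x hx
    rcases hD x hx with hx | ⟨o, ho, rfl⟩
    · rw [e1 x hx]; exact hI.lb x hx
    · rw [e2]; exact (g1' o ho).trans (hI.lb _ hqD)

end
end R2

namespace R2

variable {M : ℕ} {G : Gen M}

lemma k_refl {x : ℚ} (hx : G.K x) : G.R2 x x := q_refl (⟨x, hx⟩ : G.T)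
lemma k_refl1 {x : ℚ} (hx : G.K x) : G.R1 x x := q_refl1 (⟨x, hx⟩ : G.T)
lemma k_21 {x y : ℚ} (hx : G.K x) (hy : G.K y) (h : G.R2 x y) : G.R1 x y :=
  q_sub21 (x := (⟨x, hx⟩ : G.T)) (y := ⟨y, hy⟩) h
lemma k_10 {x y : ℚ} (hx : G.K x) (hy : G.K y) (h : G.R1 x y) : x ≤ y :=
  q_sub10 (x := (⟨x, hx⟩ : G.T)) (y := ⟨y, hy⟩) h
lemma k_tr1 {x y z : ℚ} (hx : G.K x) (hy : G.K y) (hz : G.K z) (h : G.R1 x y) (h' : G.R1 y z) : G.R1 x z :=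
  q_tr1 (x := (⟨x, hx⟩ : G.T)) (y := ⟨y, hy⟩) (z := ⟨z, hz⟩) h h'
lemma k_resp1 {x y z : ℚ} (hx : G.K x) (hy : G.K y) (hz : G.K z) (h1 : x ≤ y) (h2 : y ≤ z) (h : G.R1 x z) : G.R1 x y :=
  q_resp1 (x := (⟨x, hx⟩ : G.T)) (y := ⟨y, hy⟩) (z := ⟨z, hz⟩) h1 h2 h

section
variable {a b c t a0 : ℚ} {l n : ℕ} {f0 ι : ℚ → ℚ} {Y : Finset ℚ} (X : Ctx G a b c t a0 l n f0 ι Y)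
include X

lemma Ctx.ka : G.K a := ⟨_, X.st.valid.1⟩
lemma Ctx.kb : G.K b := ⟨_, X.st.valid.2.1⟩
lemma Ctx.r2ab : G.R2 a b := X.st.valid.2.2.2
lemma Ctx.r1ab : G.R1 a b := k_21 X.ka X.kb X.r2ab
lemma Ctx.aa1 : G.R1 (f0 a) a :=
  (X.st.F4 _ X.st.valid.1 a X.aO).2 ⟨le_rfl, X.r1ab, k_refl1 X.ka⟩
lemma Ctx.aR {y : ℚ} (hy : G.K y) (hay : a ≤ y) : G.R1 (f0 a) y ↔ G.R1 a y := by
  refine ⟨fun h => ((gl X.st X.aO hy hay).1.1 h).2, fun h => k_tr1 ⟨_, X.am⟩ X.ka hy X.aa1 h⟩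

lemma ext_lo {m : ℕ} {h : ℚ → ℚ} {L : ℕ → ℕ} (hI : Inv G a b c l f0 Y m h L) (hm : l + 1 ≤ m)
    {τ : Task} {f : ℚ → ℚ} (hst : IsStep G.S G.R1 G.R2 m τ f) (hqa : τ.place ≤ f0 a) :
    ∃ h' L', Inv G a b c l f0 Y (m+1) h' L' := by
  have hq := Task.place_mem hst.valid
  have hqc := hqa.trans X.ac
  have hqD : Dom G c Y m τ.place := .inl ⟨hq, hqc⟩
  have haD : Dom G c Y m (f0 a) := .inl ⟨X.amn m hm, X.ac⟩
  have hid : ∀ x ∈ G.S m, x < τ.place → h x = x := fun x hx hxq =>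
    hI.id x (.inl ⟨hx, hxq.le.trans hqc⟩) (hxq.trans_le hqa)
  have hha : h (f0 a) = a := hI.base a X.aO
  have hqh : τ.place ≤ h τ.place := by
    rcases hqa.lt_or_eq with h1 | h1
    · rw [hI.id _ hqD h1]
    · rw [h1, hha]; exact X.aa.le
  have hKh : ∀ x, Dom G c Y m x → G.K (h x) := fun x hx => ⟨_, hI.mem m hm le_rfl x hx⟩
  have hle : ∀ x, Dom G c Y m x → τ.place ≤ x → h τ.place ≤ h x := by
    intro x hx hqx
    rcases hqx.eq_or_lt with rfl | h'
    · exact le_rfl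
    · exact (hI.mono _ _ hqD hx h').le
  refine ext_gen X hI hm hst hqc f (max (L m) (m+1)) (le_max_left _ _) ?_ ?_ ?_ ?_ ?_ ?_ ?_ ?_ ?_
  · intro o ho x hx hxq; rw [hid x hx hxq]; exact hst.gt o x hx hxq
  · intro o ho; exact (hst.lt o).trans_le hqh
  · intro o ho o' ho' hh; exact hst.mono hh
  · intro o ho x hx hxq
    rw [hid x hx hxq, hst.F1 x hx o ho, hst.F2 x hx o ho]
    simp [hxq]
  · intro o ho o' ho'; exact ⟨hst.F31 o ho o' ho', hst.F32 o ho o' ho'⟩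
  · intro o ho x hx hqx
    have hl := hle x hx hqx
    obtain ⟨k1, k2⟩ := gl hst ho (hKh x hx) (hqh.trans hl)
    refine ⟨k1.trans (and_congr_right fun _ => ?_), k2⟩
    rcases hqa.lt_or_eq with h1 | h1
    · have := hI.r1 _ _ hqD hx
      rwa [hI.id _ hqD h1] at this
    · have := hI.r1 _ _ haD hx
      rw [hha] at this
      rw [h1, hha] at hl
      rw [h1, ← this, X.aR (hKh x hx) hl]
  · intro o ho; exact G.sub (le_max_right _ _) ((hst.mem_iff _).2 (.inr ⟨o, ho, rfl⟩))
  · intro o ho _; rfl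
  · intro h'; exact absurd h' (not_lt.2 hqa)

lemma ext_hi {m : ℕ} {h : ℚ → ℚ} {L : ℕ → ℕ} (hI : Inv G a b c l f0 Y m h L) (hm : l + 1 ≤ m)
    {τ : Task} {f : ℚ → ℚ} (hst : IsStep G.S G.R1 G.R2 m τ f) (haq : f0 a < τ.place) (hqc : τ.place ≤ c)
    {τs : Task} {m0 : ℕ} (hv : τs.Valid G.S G.R1 G.R2 m0) (hpl : τs.place = h τ.place) (κ : ℚ → ℚ)
    (k1 : ∀ o ∈ τ.O G.S m, Dom G c Y m (κ o))
    (k2 : ∀ o ∈ τ.O G.S m, ∀ o' ∈ τ.O G.S m, (o < o' → κ o < κ o') ∧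
      (G.R1 (κ o) (κ o') ↔ G.R1 o o') ∧ (G.R2 (κ o) (κ o') ↔ G.R2 o o'))
    (k3 : ∀ N, m0 ≤ N → L m ≤ N → ∀ o ∈ τ.O G.S m, h (κ o) ∈ τs.O G.S N)
    (k4 : ∀ o ∈ τ.O G.S m, (τs.mu G.R1 (h (κ o)) ↔ τ.mu G.R1 o))
    (k5 : ∀ o ∈ τ.O G.S m, ∀ x ∈ G.S m, x < τ.place →
      ((τs.low G.S (h x) ∧ G.R2 x (κ o)) ↔ (τ.low G.S x ∧ G.R2 x o))) :
    ∃ h' L', Inv G a b c l f0 Y (m+1) h' L' := by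
  have hq := Task.place_mem hst.valid
  have hqD : Dom G c Y m τ.place := .inl ⟨hq, hqc⟩
  obtain ⟨N, hN, g, hg⟩ := late hv (max m0 ((Finset.range (m+1)).sup L))
  have hN0 : m0 ≤ N := (le_max_left _ _).trans hN
  have hNL : ∀ m' ≤ m, L m' ≤ N := fun m' hm' =>
    (Finset.le_sup (f := L) (Finset.mem_range.2 (by omega))).trans ((le_max_right _ _).trans hN)
  have hxD : ∀ x ∈ G.S m, x < τ.place → Dom G c Y m x := fun x hx hxq => .inl ⟨hx, hxq.le.trans hqc⟩
  have hmem : ∀ x, Dom G c Y m x → h x ∈ G.S N := fun x hx => G.sub (hNL m le_rfl) (hI.mem m hm le_rfl x hx)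
  have hO := k3 N hN0 (hNL m le_rfl)
  have hle : ∀ x, Dom G c Y m x → τ.place ≤ x → h τ.place ≤ h x := by
    intro x hx hqx
    rcases hqx.eq_or_lt with rfl | h'
    · exact le_rfl
    · exact (hI.mono _ _ hqD hx h').le
  refine ext_gen X hI hm hst hqc (fun o => g (h (κ o))) (N+1) ((hNL m le_rfl).trans (by omega)) ?_ ?_ ?_ ?_ ?_ ?_ ?_ ?_ ?_
  · intro o ho x hx hxq
    exact hg.gt _ _ (hmem x (hxD x hx hxq)) (by rw [hpl]; exact hI.mono _ _ (hxD x hx hxq) hqD hxq)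
  · intro o ho; rw [← hpl]; exact hg.lt _
  · intro o ho o' ho' hh
    exact hg.mono (hI.mono _ _ (k1 o ho) (k1 o' ho') ((k2 o ho o' ho').1 hh))
  · intro o ho x hx hxq
    have hd := hxD x hx hxq
    have hh := hI.mono _ _ hd hqD hxq
    rw [hg.F1 _ (hmem x hd) _ (hO o ho), hg.F2 _ (hmem x hd) _ (hO o ho), hpl, hI.r1 _ _ hd hqD,
      hI.r2 _ _ hd (k1 o ho), k5 o ho x hx hxq]
    simp [hh]
  · intro o ho o' ho'
    rw [hg.F31 _ (hO o ho) _ (hO o' ho'), hg.F32 _ (hO o ho) _ (hO o' ho'), hI.r1 _ _ (k1 o ho) (k1 o' ho'),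
      hI.r2 _ _ (k1 o ho) (k1 o' ho')]
    exact (k2 o ho o' ho').2
  · intro o ho x hx hqx
    have := gl hg (hO o ho) ⟨_, hmem x hx⟩ (by rw [hpl]; exact hle x hx hqx)
    rw [hpl, hI.r1 _ _ hqD hx, k4 o ho] at this
    exact this
  · intro o ho; exact (hg.mem_iff _).2 (.inr ⟨_, hO o ho, rfl⟩)
  · intro o ho hlt; exact absurd hlt (not_lt.2 (hst.gt o _ (X.amn m hm) haq).le)
  · intro _ o ho m' h1 h2 z hz hzq
    exact hg.gt _ z (G.sub (hNL m' h2) hz) (by rw [hpl]; exact hzq)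

end
end R2

namespace R2

variable {M : ℕ} {G : Gen M}
section
variable {a b c t a0 : ℚ} {l n : ℕ} {f0 ι : ℚ → ℚ} {Y : Finset ℚ} (X : Ctx G a b c t a0 l n f0 ι Y)
include X

lemma ext_any {m : ℕ} {h : ℚ → ℚ} {L : ℕ → ℕ} (hI : Inv G a b c l f0 Y m h L) (hm : l + 1 ≤ m) (hmn : m ≤ n) :
    ∃ h' L', Inv G a b c l f0 Y (m+1) h' L' := by
  rcases G.step m with hS | ⟨τ, f, hst⟩
  · obtain ⟨L', h'⟩ := ext_triv X hI hm (by intro x hx _; rwa [hS] at hx)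
    exact ⟨h, L', h'⟩
  have hcm : c ∈ G.S m := G.sub hm X.cm
  rcases lt_or_ge c τ.place with hcq | hqc
  · obtain ⟨L', h'⟩ := ext_triv X hI hm (by
      intro x hx hxc
      rcases (hst.mem_iff x).1 hx with h1 | ⟨o, ho, rfl⟩
      · exact h1
      · exact absurd (hst.gt o c hcm hcq) (not_lt.2 hxc))
    exact ⟨h, L', h'⟩
  rcases le_or_gt τ.place (f0 a) with hqa | haq
  · exact ext_lo X hI hm hst hqa
  have hhl : ∀ x y, Dom G c Y m x → Dom G c Y m y → x ≤ y → h x ≤ h y := by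
    intro x y hx hy hxy
    rcases hxy.eq_or_lt with rfl | h'
    · exact le_rfl
    · exact (hI.mono _ _ hx hy h').le
  have hmem := hI.mem m hm le_rfl
  have hha : h (f0 a) = a := hI.base a X.aO
  have haD : Dom G c Y m (f0 a) := .inl ⟨X.amn m hm, X.ac⟩
  have hsub : ∀ x ∈ G.S m, x ∈ G.S n := fun x hx => G.sub hmn hx
  have hK : ∀ x ∈ G.S m, G.K x := fun x hx => ⟨m, hx⟩
  cases τ with
  | t1 q r =>
    obtain ⟨hq, hr, hqr, h1⟩ := hst.valid
    have hqD : Dom G c Y m q := .inl ⟨hq, hqc⟩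
    have hqa : q < a := X.doma hqD
    rcases lt_or_ge r a with hra | har
    · have hrD := X.domS hmn hr hra
      refine ext_hi X hI hm hst haq hqc (τs := .t1 (h q) (h r)) (m0 := L m)
        ⟨hmem q hqD, hmem r hrD, hI.mono _ _ hqD hrD hqr, (hI.r1 _ _ hqD hrD).2 h1⟩ rfl id ?_ ?_ ?_ ?_ ?_
      · intro o ho; have := mem_O1.1 ho; exact X.domS hmn this.1 (this.2.2.trans hra)
      · intro o ho o' ho'; exact ⟨fun h => h, Iff.rfl, Iff.rfl⟩
      · intro N hN hLN o ho
        have ho := mem_O1.1 ho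
        have hoD := X.domS hmn ho.1 (ho.2.2.trans hra)
        exact mem_O1.2 ⟨G.sub hLN (hmem o hoD), hhl _ _ hqD hoD ho.2.1, hI.mono _ _ hoD hrD ho.2.2⟩
      · intro o ho; exact Iff.rfl
      · intro o ho x hx hxq
        have hxD : Dom G c Y m x := .inl ⟨hx, (le_of_lt hxq).trans hqc⟩
        have := hI.mono _ _ hxD hqD hxq
        exact and_congr_left fun _ => iff_of_true this hxq
    · have hqn := hsub q hq
      have har1 : G.R1 a r := (G.str (show l ≤ m by omega) X.st.valid.1).c6 q (X.yg hq (le_of_lt haq) hqa) r hr har h1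
      have hqa1 : G.R1 q a := k_resp1 (hK q hq) X.ka (hK r hr) hqa.le har h1
      have hrt := X.tmax r (hsub r hr) har1
      have ha0D : Dom G c Y m a0 := .inr X.i5
      have hqa0 := X.i6 q hqn hqa
      classical
      let κ : ℚ → ℚ := fun o => if o < a then o else ι o
      have κ1 : ∀ o, o < a → κ o = o := fun o ho => by simp [κ, ho]
      have κ2 : ∀ o, a ≤ o → κ o = ι o := fun o ho => by simp [κ, not_lt.2 ho]
      have k1 : ∀ o ∈ Task.O G.S m (.t1 q r), Dom G c Y m (κ o) ∧ q ≤ κ o ∧ κ o < a0 := by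
        intro o ho
        have ho := mem_O1.1 ho
        rcases lt_or_ge o a with h' | h'
        · rw [κ1 o h']; exact ⟨X.domS hmn ho.1 h', ho.2.1, (X.i6 o (hsub o ho.1) h').1⟩
        · rw [κ2 o h']
          have := X.i1 o (hsub o ho.1) h' (ho.2.2.trans_le hrt)
          exact ⟨.inr this.1, (X.i3 q hqn hqa o (hsub o ho.1) h' (ho.2.2.trans_le hrt)).1.le, this.2⟩
      refine ext_hi X hI hm hst haq hqc (τs := .t1 (h q) (h a0)) (m0 := L m)
        ⟨hmem q hqD, hmem a0 ha0D, hI.mono _ _ hqD ha0D hqa0.1, (hI.r1 _ _ hqD ha0D).2 (hqa0.2 hqa1)⟩ rfl κ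
        (fun o ho => (k1 o ho).1) ?_ ?_ (fun _ _ => Iff.rfl) ?_
      · intro o ho o' ho'
        have ho := mem_O1.1 ho
        have ho' := mem_O1.1 ho'
        have hot := ho.2.2.trans_le hrt
        have hot' := ho'.2.2.trans_le hrt
        rcases lt_or_ge o a with h1 | h1 <;> rcases lt_or_ge o' a with h2 | h2
        · rw [κ1 o h1, κ1 o' h2]; exact ⟨fun h => h, Iff.rfl, Iff.rfl⟩
        · rw [κ1 o h1, κ2 o' h2]
          obtain ⟨e1, e2, e3⟩ := X.i3 o (hsub o ho.1) h1 o' (hsub o' ho'.1) h2 hot'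
          refine ⟨fun _ => e1, e2.trans ⟨fun hh => ?_, fun hh => ?_⟩, e3⟩
          · exact k_resp1 (hK o ho.1) (hK o' ho'.1) (hK r hr) (h1.le.trans h2) ho'.2.2.le
              (k_tr1 (hK o ho.1) X.ka (hK r hr) hh har1)
          · exact k_resp1 (hK o ho.1) X.ka (hK o' ho'.1) h1.le h2 hh
        · rw [κ2 o h1, κ1 o' h2]
          have e1 := (X.i3 o' (hsub o' ho'.1) h2 o (hsub o ho.1) h1 hot).1
          have ki := (X.Y1 _ (X.i1 o (hsub o ho.1) h1 hot).1).1
          have Ko := hK o ho.1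
          have Ko' := hK o' ho'.1
          refine ⟨fun hh => absurd hh (not_lt.2 (h2.le.trans h1)), iff_of_false ?_ ?_, iff_of_false ?_ ?_⟩
          · exact fun hh => absurd (k_10 ki Ko' hh) (not_le.2 e1)
          · exact fun hh => absurd (k_10 Ko Ko' hh) (not_le.2 (h2.trans_le h1))
          · exact fun hh => absurd (k_10 ki Ko' (k_21 ki Ko' hh)) (not_le.2 e1)
          · exact fun hh => absurd (k_10 Ko Ko' (k_21 Ko Ko' hh)) (not_le.2 (h2.trans_le h1))
        · rw [κ2 o h1, κ2 o' h2]
          exact ⟨fun hh => X.i2 hh, X.i4 o (hsub o ho.1) h1 hot o' (hsub o' ho'.1) h2 hot'⟩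
      · intro N hN hLN o ho
        obtain ⟨e1, e2, e3⟩ := k1 o ho
        exact mem_O1.2 ⟨G.sub hLN (hmem _ e1), hhl _ _ hqD e1 e2, hI.mono _ _ e1 ha0D e3⟩
      · intro o ho x hx hxq
        have ho := mem_O1.1 ho
        have hxD : Dom G c Y m x := .inl ⟨hx, (le_of_lt hxq).trans hqc⟩
        refine and_congr (iff_of_true (hI.mono _ _ hxD hqD hxq) hxq) ?_
        rcases lt_or_ge o a with h' | h'
        · rw [κ1 o h']
        · rw [κ2 o h']
          exact (X.i3 x (hsub x hx) (X.doma hxD) o (hsub o ho.1) h' (ho.2.2.trans_le hrt)).2.2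
  | t2 q r =>
    obtain ⟨hq, hr, hqr, h2⟩ := hst.valid
    have hqD : Dom G c Y m q := .inl ⟨hq, hqc⟩
    have hqa : q < a := X.doma hqD
    have hra : r < a := by
      by_contra hh
      exact (G.str (show l ≤ m by omega) X.st.valid.1).c7 q (X.yg hq (le_of_lt haq) hqa) r hr (not_lt.1 hh) h2
    have hrD := X.domS hmn hr hra
    have hoD : ∀ o ∈ Task.O G.S m (.t2 q r), Dom G c Y m o := by
      intro o ho; have := mem_O2.1 ho; exact X.domS hmn this.1 (this.2.2.trans hra)
    refine ext_hi X hI hm hst haq hqc (τs := .t2 (h q) (h r)) (m0 := L m)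
      ⟨hmem q hqD, hmem r hrD, hI.mono _ _ hqD hrD hqr, (hI.r2 _ _ hqD hrD).2 h2⟩ rfl id hoD ?_ ?_ ?_ ?_
    · intro o ho o' ho'; exact ⟨fun h => h, Iff.rfl, Iff.rfl⟩
    · intro N hN hLN o ho
      have hoD := hoD o ho
      have ho := mem_O2.1 ho
      exact mem_O2.2 ⟨G.sub hLN (hmem o hoD), hhl _ _ hqD hoD ho.2.1, hI.mono _ _ hoD hrD ho.2.2⟩
    · intro o ho; exact hI.r1 _ _ (hoD o ho) hrD
    · intro o ho x hx hxq
      have hxD : Dom G c Y m x := .inl ⟨hx, (le_of_lt hxq).trans hqc⟩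
      have := hI.mono _ _ hxD hqD hxq
      exact and_congr_left fun _ => iff_of_true this hxq
  | t3 p q l' =>
    obtain ⟨hl', hp, hq, hpq, h2⟩ := hst.valid
    have hqD : Dom G c Y m q := .inl ⟨hq, hqc⟩
    have hpm : p ∈ G.S m := G.sub hl' hp
    have hpc : p ≤ c := hpq.le.trans hqc
    have hpD : Dom G c Y m p := .inl ⟨hpm, hpc⟩
    have hxD : ∀ x ∈ G.S m, x < q → Dom G c Y m x := fun x hx hxq => .inl ⟨hx, hxq.le.trans hqc⟩
    have hoD : ∀ o ∈ Task.O G.S m (.t3 p q l'), Dom G c Y m o := by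
      intro o ho; have := mem_O3.1 ho; exact hxD o this.1 (this.2.1.trans hpq)
    have k2 : ∀ o ∈ Task.O G.S m (.t3 p q l'), ∀ o' ∈ Task.O G.S m (.t3 p q l'), (o < o' → id o < id o') ∧
      (G.R1 (id o) (id o') ↔ G.R1 o o') ∧ (G.R2 (id o) (id o') ↔ G.R2 o o') :=
      fun o ho o' ho' => ⟨fun h => h, Iff.rfl, Iff.rfl⟩
    have hal : f0 a ≤ p → l + 1 ≤ l' := by
      intro hap
      by_contra hh
      have : p ∈ G.S l := G.sub (by omega) hp
      exact absurd (X.lo this (hpc.trans_lt X.ca)) (not_lt.2 hap)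
    have hge : ∀ x, Dom G c Y m x → f0 a ≤ x → a ≤ h x := by
      intro x hx hax; rw [← hha]; exact hhl _ _ haD hx hax
    rcases lt_trichotomy p (f0 a) with hpa | hpa | hpa
    · have hhp := hI.id p hpD hpa
      refine ext_hi X hI hm hst haq hqc (τs := .t3 p (h q) l') (m0 := max (L m) l')
        ⟨le_max_right _ _, hp, G.sub (le_max_left _ _) (hmem q hqD), ?_, ?_⟩ rfl id hoD k2 ?_ (fun _ _ => Iff.rfl) ?_
      · have := hI.mono _ _ hpD hqD hpq; rwa [hhp] at this
      · have := (hI.r2 _ _ hpD hqD).2 h2; rwa [hhp] at this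
      · intro N hN hLN o ho
        have hd := hoD o ho
        have ho := mem_O3.1 ho
        have e := hI.id o hd (ho.2.1.trans hpa)
        have hm' := hmem o hd
        rw [e] at hm'
        refine mem_O3.2 ?_
        rw [id, e]
        exact ⟨G.sub hLN hm', ho.2⟩
      · intro o ho x hx hxq
        have hd := hxD x hx hxq
        refine and_congr_left fun _ => ?_
        rcases lt_or_ge x (f0 a) with hxa | hxa
        · rw [hI.id x hd hxa]; exact Iff.rfl
        · refine iff_of_false ?_ ?_
          · rintro ⟨y, hy, hyp, hxy⟩
            linarith [hge x hd hxa, X.aa]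
          · rintro ⟨y, hy, hyp, hxy⟩
            linarith
    · have hll := hal hpa.ge
      have hhp : h p = a := by rw [hpa, hha]
      refine ext_hi X hI hm hst haq hqc (τs := .t3 a (h q) l) (m0 := max (L m) l)
        ⟨le_max_right _ _, X.st.valid.1, G.sub (le_max_left _ _) (hmem q hqD), ?_, ?_⟩ rfl id hoD k2 ?_ (fun _ _ => Iff.rfl) ?_
      · have := hI.mono _ _ hpD hqD hpq; rwa [hhp] at this
      · have := (hI.r2 _ _ hpD hqD).2 h2; rwa [hhp] at this
      · intro N hN hLN o ho
        have hd := hoD o ho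
        have ho := mem_O3.1 ho
        have e := hI.id o hd (ho.2.1.trans_eq hpa)
        have hm' := hmem o hd
        rw [e] at hm'
        refine mem_O3.2 ?_
        rw [id, e]
        refine ⟨G.sub hLN hm', X.doma hd, fun y hy hya => ho.2.2 y (G.sub (by omega) hy) ?_⟩
        rw [hpa]; exact X.lo hy hya
      · intro o ho x hx hxq
        have hd := hxD x hx hxq
        refine and_congr_left fun hxo => ⟨?_, ?_⟩
        · rintro ⟨y, hy, hya, hxy⟩
          have hxa : x < f0 a := by
            by_contra hh
            linarith [hge x hd (not_lt.1 hh)]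
          rw [hI.id x hd hxa] at hxy
          exact ⟨y, G.sub (by omega) hy, by rw [hpa]; exact X.lo hy hya, hxy⟩
        · rintro ⟨y, hy, hyp, hxy⟩
          have hxa : x < f0 a := by linarith
          rw [hI.id x hd hxa]
          by_contra hh
          have hyg : x ∈ young G.S (l+1) m (f0 a) := by
            refine mem_young.2 ⟨hx, hxa, fun z hz hza => ?_⟩
            by_contra hzx
            exact hh ⟨z, X.lo' hz hza, hza.trans X.aa, not_lt.1 hzx⟩
          have h3 := (G.str hl' hp).c2 o ho x hx y hy hyp hxy hxo
          exact (G.str hm X.am).c7 x hyg p hpm hpa.ge h3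
    · have hll := hal hpa.le
      have hpD' : Dom G c Y l' p := .inl ⟨hp, hpc⟩
      refine ext_hi X hI hm hst haq hqc (τs := .t3 (h p) (h q) (L l')) (m0 := max (L m) (L l'))
        ⟨le_max_right _ _, hI.mem l' hll hl' p hpD', G.sub (le_max_left _ _) (hmem q hqD),
          hI.mono _ _ hpD hqD hpq, (hI.r2 _ _ hpD hqD).2 h2⟩ rfl id hoD k2 ?_ (fun _ _ => Iff.rfl) ?_
      · intro N hN hLN o ho
        have hd := hoD o ho
        refine mem_O3.2 ⟨G.sub hLN (hmem o hd), hI.mono _ _ hd hpD (mem_O3.1 ho).2.1, ?_⟩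
        exact hI.bk l' hll hl' p hp hpa hpc o ho
      · intro o ho x hx hxq
        have hd := hxD x hx hxq
        refine and_congr_left fun _ => ⟨?_, ?_⟩
        · rintro ⟨z, hz, hzp, hxz⟩
          by_contra hh
          rcases lt_or_ge x p with hxp | hxp
          · have := hI.bk l' hll hl' p hp hpa hpc x (mem_young.2 ⟨hx, hxp, fun y hy hyp => by
              by_contra hyx
              exact hh ⟨y, hy, hyp, not_lt.1 hyx⟩⟩) z hz hzp
            linarith
          · linarith [hhl _ _ hpD hd hxp]
        · rintro ⟨y, hy, hyp, hxy⟩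
          have hyc : y ≤ c := hyp.le.trans hpc
          have hyD : Dom G c Y m y := .inl ⟨G.sub hl' hy, hyc⟩
          exact ⟨h y, hI.mem l' hll hl' y (.inl ⟨hy, hyc⟩), hI.mono _ _ hyD hpD hyp, hhl _ _ hd hyD hxy⟩

lemma ext_all {h : ℚ → ℚ} {L : ℕ → ℕ} (hI : Inv G a b c l f0 Y (l+1) h L) (m : ℕ) (hm : l + 1 ≤ m) (hmn : m ≤ n) :
    ∃ h' L', Inv G a b c l f0 Y m h' L' := by
  induction m, hm using Nat.le_induction with
  | base => exact ⟨h, L, hI⟩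
  | succ m hm ih =>
    obtain ⟨h', L', hI'⟩ := ih (by omega)
    exact ext_any X hI' hm (by omega)

end
end R2

namespace R2

variable {M : ℕ} {G : Gen M}

section
variable {a b c t a0 : ℚ} {l n : ℕ} {f0 ι : ℚ → ℚ} {Y : Finset ℚ} (X : Ctx G a b c t a0 l n f0 ι Y)
include X

lemma base_inv {n' : ℕ} (hY : Y ⊆ G.S n') : ∃ h L, Inv G a b c l f0 Y (l+1) h L := by
  classical
  have hal := X.st.valid.1
  have hbl := X.st.valid.2.1
  have hab := X.st.valid.2.2.1
  have hlc : ∀ x ∈ G.S (l+1), x < a → x ≤ c := X.cmax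
  obtain ⟨N, hN, g, hg⟩ := late (G := G) (τ := .t3 a b l) (m0 := l) ⟨le_rfl, hal, hbl, hab, X.r2ab⟩ (max (l+1) n')
  have hlN : l + 1 ≤ N := (le_max_left _ _).trans hN
  have hYN : ∀ y ∈ Y, y ∈ G.S N := fun y hy => G.sub ((le_max_right _ _).trans hN) (hY hy)
  have hlN' : l ≤ N := by omega
  have hYy : ∀ y ∈ Y, y ∈ young G.S (l+1) N a := fun y hy => mem_young.2 ⟨hYN y hy, (X.Y1 y hy).2.2,
    fun z hz hza => (hlc z hz hza).trans_lt (X.Y1 y hy).2.1⟩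
  have hYO : ∀ y ∈ Y, y ∈ Task.O G.S N (.t3 a b l) := fun y hy => mem_O3.2 ⟨hYN y hy, (X.Y1 y hy).2.2,
    fun z hz hza => (hlc z (G.sub (by omega) hz) hza).trans_lt (X.Y1 y hy).2.1⟩
  obtain ⟨h0, e1, e2⟩ := glue (G.S l) f0 X.st.mono.injective X.st.nm id id
  let h : ℚ → ℚ := fun x => if x ∈ Y then g x else h0 x
  have hYn : ∀ x, x ≤ c → x ∉ Y := fun x hx hxY => absurd (X.Y1 x hxY).2.1 (not_lt.2 hx)
  have hs1 : ∀ x ∈ G.S l, x < a → h x = x := by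
    intro x hx hxa
    have := hYn x (hlc x (G.sub (by omega) hx) hxa)
    simp only [h, if_neg this]; exact e1 x hx
  have hO1 : ∀ v ∈ Task.O G.S l (.t2 a b), f0 v ∈ G.S (l+1) := fun v hv => (X.st.mem_iff _).2 (.inr ⟨v, hv, rfl⟩)
  have hs2 : ∀ v ∈ Task.O G.S l (.t2 a b), h (f0 v) = v := by
    intro v hv
    have := hYn _ (hlc _ (hO1 v hv) (X.st.lt v))
    simp only [h, if_neg this]; exact e2 v
  have hs3 : ∀ y ∈ Y, h y = g y := fun y hy => by simp [h, hy]
  have hcl : ∀ x, Dom G c Y (l+1) x → (x ∈ G.S l ∧ x < a) ∨ (∃ v ∈ Task.O G.S l (.t2 a b), x = f0 v) ∨ x ∈ Y := by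
    rintro x (⟨hx, hxc⟩ | hx)
    · rcases (X.st.mem_iff x).1 hx with h' | ⟨v, hv, rfl⟩
      · exact .inl ⟨h', hxc.trans_lt X.ca⟩
      · exact .inr (.inl ⟨v, hv, rfl⟩)
    · exact .inr (.inr hx)
  have sc := G.sc X.st.valid
  have s0 := G.str hlN' hal
  have s1 := G.str hlN (G.sub (by omega) hal : a ∈ G.S (l+1))
  have kab := X.r1ab
  have hmem : ∀ x, Dom G c Y (l+1) x → h x ∈ G.S (N+1) := by
    intro x hx
    rcases hcl x hx with ⟨hx, hxa⟩ | ⟨v, hv, rfl⟩ | hx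
    · rw [hs1 x hx hxa]; exact G.sub (by omega) hx
    · rw [hs2 v hv]; exact G.sub (by omega) (mem_O2.1 hv).1
    · rw [hs3 x hx]; exact (hg.mem_iff _).2 (.inr ⟨x, hYO x hx, rfl⟩)
  have key : ∀ x y, Dom G c Y (l+1) x → Dom G c Y (l+1) y → x < y →
      h x < h y ∧ (G.R1 (h x) (h y) ↔ G.R1 x y) ∧ (G.R2 (h x) (h y) ↔ G.R2 x y) := by
    intro x y hx hy hxy
    rcases hcl x hx with ⟨hx1, hxa⟩ | ⟨v, hv, rfl⟩ | hx1 <;> rcases hcl y hy with ⟨hy1, hya⟩ | ⟨w, hw, rfl⟩ | hy1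
    · rw [hs1 x hx1 hxa, hs1 y hy1 hya]; exact ⟨hxy, Iff.rfl, Iff.rfl⟩
    · rw [hs1 x hx1 hxa, hs2 w hw, X.st.F1 x hx1 w hw, X.st.F2 x hx1 w hw, sc.c1 x hx1 hxa w hw]
      exact ⟨hxa.trans_le (mem_O2.1 hw).2.1, by simp only [Task.place]; tauto, by simp only [Task.place, Task.low]; tauto⟩
    · rw [hs1 x hx1 hxa, hs3 y hy1]
      have hxN := G.sub hlN' hx1
      rw [hg.F1 x hxN y (hYO y hy1), hg.F2 x hxN y (hYO y hy1), s0.c1 y (hYO y hy1) x hxN x hx1 hxa le_rfl]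
      refine ⟨hg.gt _ x hxN (hxa.trans hab), ⟨fun hh => ?_, fun hh => ⟨hxa.trans hab, ?_⟩⟩, ⟨fun hh => hh.2.2, fun hh => ⟨hxa.trans hab, ⟨x, hx1, hxa, le_rfl⟩, hh⟩⟩⟩
      · exact k_resp1 ⟨l, hx1⟩ X.ka X.kb hxa.le hab.le hh.2
      · exact k_tr1 ⟨l, hx1⟩ X.ka X.kb hh kab
    · exact absurd (X.st.gt v y hy1 hya) (not_lt.2 hxy.le)
    · rw [hs2 v hv, hs2 w hw, X.st.F31 v hv w hw, X.st.F32 v hv w hw]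
      exact ⟨X.st.mono.lt_iff_lt.1 hxy, Iff.rfl, Iff.rfl⟩
    · rw [hs2 v hv, hs3 y hy1]
      have hv' := mem_O2.1 hv
      have hvN := G.sub hlN' hv'.1
      have hfN := G.sub hlN (hO1 v hv)
      rw [hg.F1 v hvN y (hYO y hy1), hg.F2 v hvN y (hYO y hy1),
        s1.c1 y (hYy y hy1) (f0 v) hfN (f0 v) (hO1 v hv) (X.st.lt v) le_rfl, X.st.F4 a hal v hv]
      refine ⟨hg.gt _ v hvN hv'.2.2, ?_, iff_of_false ?_ ?_⟩
      · simp only [Task.place, Task.mu, hv'.2.2, le_rfl, true_and, k_refl1 X.ka, and_true]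
      · rintro ⟨-, ⟨z, hz, hza, hvz⟩, -⟩
        linarith [hv'.2.1]
      · intro hh
        exact X.st.F5 a hal v hv (s1.c2 y (hYy y hy1) (f0 v) hfN (f0 v) (hO1 v hv) (X.st.lt v) le_rfl hh)
    · exact absurd (X.Y1 x hx1).2.1 (not_lt.2 (hxy.le.trans (hlc y (G.sub (by omega) hy1) hya)))
    · exact absurd (X.Y1 x hx1).2.1 (not_lt.2 (hxy.le.trans (hlc _ (hO1 w hw) (X.st.lt w))))
    · rw [hs3 x hx1, hs3 y hy1, hg.F31 _ (hYO x hx1) _ (hYO y hy1), hg.F32 _ (hYO x hx1) _ (hYO y hy1)]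
      exact ⟨hg.mono hxy, Iff.rfl, Iff.rfl⟩
  refine ⟨h, fun _ => N + 1, fun x y hx hy hxy => (key x y hx hy hxy).1, ?_, ?_, ?_, hs2, ?_, ?_, ?_⟩
  · intro x y hx hy
    have kx : G.K (h x) := ⟨_, hmem x hx⟩
    have ky : G.K (h y) := ⟨_, hmem y hy⟩
    rcases lt_trichotomy x y with hh | rfl | hh
    · exact (key x y hx hy hh).2.1
    · exact iff_of_true (k_refl1 kx) (k_refl1 (X.domK hx))
    · exact iff_of_false (fun h' => absurd (k_10 kx ky h') (not_le.2 (key y x hy hx hh).1))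
        (fun h' => absurd (k_10 (X.domK hx) (X.domK hy) h') (not_le.2 hh))
  · intro x y hx hy
    have kx : G.K (h x) := ⟨_, hmem x hx⟩
    have ky : G.K (h y) := ⟨_, hmem y hy⟩
    rcases lt_trichotomy x y with hh | rfl | hh
    · exact (key x y hx hy hh).2.2
    · exact iff_of_true (k_refl kx) (k_refl (X.domK hx))
    · exact iff_of_false (fun h' => absurd (k_10 kx ky (k_21 kx ky h')) (not_le.2 (key y x hy hx hh).1))
        (fun h' => absurd (k_10 (X.domK hx) (X.domK hy) (k_21 (X.domK hx) (X.domK hy) h')) (not_le.2 hh))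
  · intro x hx hxa
    have hxc := hxa.le.trans X.ac
    exact hs1 x (X.lo' (X.domlow hx hxc) hxa) (X.doma hx)
  · intro m' h1 h2 x hx
    obtain rfl : m' = l + 1 := by omega
    exact hmem x hx
  · intro m' h1 h2 p hp _ _ o ho
    obtain rfl : m' = l + 1 := by omega
    simp [young_self] at ho
  · intro x hx
    rcases hcl x hx with ⟨hx, hxa⟩ | ⟨v, hv, rfl⟩ | hx
    · rw [hs1 x hx hxa]; exact hxa.trans hab
    · rw [hs2 v hv]; exact (mem_O2.1 hv).2.2
    · rw [hs3 x hx]; exact hg.lt _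
end

lemma mk_ctx {a b : ℚ} {l n : ℕ} {f0 : ℚ → ℚ} (hst : IsStep G.S G.R1 G.R2 l (.t2 a b) f0) (hn : l + 1 ≤ n) :
    ∃ c t a0 ι Y n', Ctx G a b c t a0 l n f0 ι Y ∧ Y ⊆ G.S n' := by
  classical
  obtain ⟨hal, hbl, hab, h2⟩ := hst.valid
  have ka : G.K a := ⟨l, hal⟩
  have kb : G.K b := ⟨l, hbl⟩
  have h1 := k_21 ka kb h2
  have haO : a ∈ Task.O G.S l (.t2 a b) := mem_O2.2 ⟨hal, le_rfl, hab⟩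
  have hf : f0 a ∈ G.S (l+1) := (hst.mem_iff _).2 (.inr ⟨a, haO, rfl⟩)
  have hne : ((G.S (l+1)).filter (· < a)).Nonempty := ⟨f0 a, Finset.mem_filter.2 ⟨hf, hst.lt a⟩⟩
  obtain ⟨c, hc, hcm⟩ : ∃ c ∈ (G.S (l+1)).filter (· < a), ∀ x ∈ (G.S (l+1)).filter (· < a), x ≤ c :=
    ⟨_, Finset.max'_mem _ hne, fun x hx => Finset.le_max' _ x hx⟩
  have hbn : b ∈ (G.S n).filter (G.R1 a) := Finset.mem_filter.2 ⟨G.sub (by omega) hbl, h1⟩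
  obtain ⟨t, ht, htm⟩ : ∃ t ∈ (G.S n).filter (G.R1 a), ∀ x ∈ (G.S n).filter (G.R1 a), x ≤ t :=
    ⟨_, Finset.max'_mem _ ⟨b, hbn⟩, fun x hx => Finset.le_max' _ x hx⟩
  rw [Finset.mem_filter] at hc ht
  have hat : a < t := hab.trans_le (htm b hbn)
  have hv : Task.Valid G.S G.R1 G.R2 n (.t1 a t) := ⟨G.sub (by omega) hal, ht.1, hat, ht.2⟩
  obtain ⟨n1, hn1, ι, hι⟩ := late hv n
  obtain ⟨n2, hn2, f2, hf2⟩ := late hv (n1+1)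
  have hO1 : ∀ o ∈ G.S n, a ≤ o → o < t → o ∈ Task.O G.S n1 (.t1 a t) := fun o ho h1 h2 =>
    mem_O1.2 ⟨G.sub hn1 ho, h1, h2⟩
  have hO2 : a ∈ Task.O G.S n2 (.t1 a t) := mem_O1.2 ⟨G.sub (by omega) hal, le_rfl, hat⟩
  have hι1 : ∀ o ∈ G.S n, a ≤ o → o < t → ι o ∈ G.S (n1+1) := fun o ho h1 h2 =>
    (hι.mem_iff _).2 (.inr ⟨o, hO1 o ho h1 h2, rfl⟩)
  refine ⟨c, t, f2 a, ι, (G.S (n2+1)).filter (fun x => c < x ∧ x < a), n2+1, ?_, Finset.filter_subset _ _⟩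
  refine ⟨hst, hc.1, hc.2, fun x hx hxa => hcm x (Finset.mem_filter.2 ⟨hx, hxa⟩), ?_, ?_,
    fun r hr har => htm r (Finset.mem_filter.2 ⟨hr, har⟩), ?_, hι.mono, ?_, ?_, ?_, ?_⟩
  · intro y hy
    rw [Finset.mem_filter] at hy
    exact ⟨⟨_, hy.1⟩, hy.2⟩
  · intro x hx h1 h2
    exact Finset.mem_filter.2 ⟨G.sub (by omega) hx, h1, h2⟩
  · intro o ho h1 h2
    refine ⟨Finset.mem_filter.2 ⟨G.sub (by omega) (hι1 o ho h1 h2), hι.gt o c (G.sub (by omega) hc.1) hc.2, hι.lt o⟩, ?_⟩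
    exact hf2.gt a _ (G.sub (by omega) (hι1 o ho h1 h2)) (hι.lt o)
  · intro x hx hxa o ho h1 h2
    have hx1 := G.sub hn1 hx
    have hoO := hO1 o ho h1 h2
    rw [hι.F1 x hx1 o hoO, hι.F2 x hx1 o hoO]
    exact ⟨hι.gt o x hx1 hxa, by simp only [Task.place]; tauto, by simp only [Task.place, Task.low]; tauto⟩
  · intro o ho h1 h2 o' ho' h1' h2'
    exact ⟨hι.F31 _ (hO1 o ho h1 h2) _ (hO1 o' ho' h1' h2'), hι.F32 _ (hO1 o ho h1 h2) _ (hO1 o' ho' h1' h2')⟩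
  · exact Finset.mem_filter.2 ⟨(hf2.mem_iff _).2 (.inr ⟨a, hO2, rfl⟩), hf2.gt a c (G.sub (by omega) hc.1) hc.2, hf2.lt a⟩
  · intro x hx hxa
    have hx2 : x ∈ G.S n2 := G.sub (by omega) hx
    exact ⟨hf2.gt a x hx2 hxa, fun hh => (hf2.F1 x hx2 a hO2).2 ⟨hxa, hh⟩⟩

/-- exact `Σ₂`-type reflection for `Q2` -/
theorem p2 {a b : G.T} (hab : a < b) (h2 : G.Q2 a b) {κ δ : Type} [Finite κ] [Finite δ] (x : κ → G.T) (y : δ → G.T)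
    (hx : ∀ i, x i < a) (hy : ∀ i, y i < b) : ∃ y' : δ → G.T, (∀ i, y' i < a) ∧
      ∀ (ε : Type) [Finite ε] (w' : ε → G.T), (∀ i, w' i < a) → ∃ w : ε → G.T, (∀ i, w i < b) ∧
      ∀ i j, let u := Sum.elim (Sum.elim x y) w; let u' := Sum.elim (Sum.elim x y') w'
        (u' i ≤ u' j ↔ u i ≤ u j) ∧ (G.Q1 (u' i) (u' j) ↔ G.Q1 (u i) (u j)) ∧ (G.Q2 (u' i) (u' j) ↔ G.Q2 (u i) (u j)) := by
  classical
  have := Fintype.ofFinite κ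
  have := Fintype.ofFinite δ
  obtain ⟨n1, hn1⟩ := G.fin (Finset.univ : Finset (κ ⊕ δ)) (Sum.elim x y)
  obtain ⟨l, hl, f0, hst⟩ := late2 hab h2 n1
  have hu : ∀ i, (Sum.elim x y i).1 ∈ G.S l := fun i => G.sub hl (hn1 i (by simp))
  have hO : ∀ i, ¬ y i < a → (y i).1 ∈ Task.O G.S l (.t2 a.1 b.1) := fun i hi =>
    mem_O2.2 ⟨hu (.inr i), not_lt.1 hi, hy i⟩
  let y' : δ → G.T := fun i => if y i < a then y i else fT f0 a (y i)
  have y1 : ∀ i, y i < a → y' i = y i := fun i hi => by simp [y', hi]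
  have y2 : ∀ i, ¬ y i < a → (y' i).1 = f0 (y i).1 := fun i hi => by
    simp only [y', if_neg hi]; exact fT_val hst (hO i hi) a
  have hy' : ∀ i, y' i < a := by
    intro i
    by_cases hi : y i < a
    · rw [y1 i hi]; exact hi
    · rw [G.lt_iff, y2 i hi]; exact hst.lt _
  refine ⟨y', hy', ?_⟩
  intro ε _ w' hw'
  have := Fintype.ofFinite ε
  obtain ⟨n2, hn2⟩ := G.fin (Finset.univ : Finset ε) w'
  set n := max (l+1) n2 with hn
  have hln : l + 1 ≤ n := le_max_left _ _
  obtain ⟨c, t, a0, ι, Y, n', X, hY⟩ := mk_ctx hst hln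
  obtain ⟨h0, L0, hI0⟩ := base_inv X hY
  obtain ⟨h, L, hI⟩ := ext_all X hI0 n hln le_rfl
  let u' := Sum.elim (Sum.elim x y') w'
  have hu'n : ∀ i, (u' i).1 ∈ G.S n := by
    rintro ((i | i) | i)
    · exact G.sub (by omega) (hu (.inl i))
    · change (y' i).1 ∈ _
      by_cases hi : y i < a
      · rw [y1 i hi]; exact G.sub (by omega) (hu (.inr i))
      · rw [y2 i hi]; exact G.sub hln ((hst.mem_iff _).2 (.inr ⟨_, hO i hi, rfl⟩))
    · exact G.sub (le_max_right _ _) (hn2 i (by simp))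
  have hu'a : ∀ i, u' i < a := by
    rintro ((i | i) | i)
    exacts [hx i, hy' i, hw' i]
  have hD : ∀ i, Dom G c Y n (u' i).1 := fun i => X.domS le_rfl (hu'n i) (hu'a i)
  let hT : G.T → G.T := fun z => if hz : Dom G c Y n z.1 then ⟨h z.1, _, hI.mem n hln le_rfl _ hz⟩ else a
  have hTv : ∀ i, (hT (u' i)).1 = h (u' i).1 := fun i => by simp [hT, hD i]
  refine ⟨fun i => hT (w' i), fun i => ?_, ?_⟩
  · have := hTv (.inr i)
    rw [G.lt_iff]
    exact this ▸ hI.lb _ (hD (.inr i))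
  have eid : ∀ z ∈ G.S l, z < a.1 → h z = z := fun z hz hza =>
    hI.id z (X.domS le_rfl (G.sub (by omega) hz) hza) (X.lo hz hza)
  have eu : ∀ i, Sum.elim (Sum.elim x y) (fun i => hT (w' i)) i = hT (u' i) := by
    rintro ((i | i) | i)
    · apply Subtype.ext
      rw [hTv]
      exact (eid _ (hu (.inl i)) (hx i)).symm
    · apply Subtype.ext
      rw [hTv]
      change (y i).1 = h (y' i).1
      by_cases hi : y i < a
      · rw [y1 i hi]; exact (eid _ (hu (.inr i)) hi).symm
      · rw [y2 i hi, hI.base _ (hO i hi)]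
    · rfl
  intro i j
  simp only [eu]
  change (u' i ≤ u' j ↔ _) ∧ (G.Q1 (u' i) (u' j) ↔ _) ∧ (G.Q2 (u' i) (u' j) ↔ _)
  rw [G.le_iff, G.le_iff, Gen.Q1, Gen.Q2, Gen.Q1, Gen.Q2, hTv, hTv, hI.r1 _ _ (hD i) (hD j), hI.r2 _ _ (hD i) (hD j)]
  refine ⟨?_, Iff.rfl, Iff.rfl⟩
  rcases lt_trichotomy (u' i).1 (u' j).1 with hh | hh | hh
  · exact iff_of_true hh.le (hI.mono _ _ (hD i) (hD j) hh).le
  · rw [hh]; exact iff_of_true le_rfl le_rfl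
  · exact iff_of_false (not_le.2 hh) (not_le.2 (hI.mono _ _ (hD j) (hD i) hh))

end R2

namespace R2

variable {M : ℕ} {G : Gen M}

def EqT {ι : Type} (u v : ι → G.T) : Prop := ∀ i j, (u i ≤ u j ↔ v i ≤ v j) ∧
  (G.Q1 (u i) (u j) ↔ G.Q1 (v i) (v j)) ∧ (G.Q2 (u i) (u j) ↔ G.Q2 (v i) (v j))

def RF1 (a b : G.T) : Prop := ∀ (κ δ : Type) [Finite κ] [Finite δ] (x : κ → G.T) (y : δ → G.T),
  (∀ i, x i < a) → (∀ i, y i < b) → ∃ y' : δ → G.T, (∀ i, y' i < a) ∧ EqT (Sum.elim x y') (Sum.elim x y)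

def MK (a b : G.T) : Prop := ∀ (κ δ : Type) [Finite κ] [Finite δ] (x : κ → G.T) (y : δ → G.T),
  (∀ i, x i < a) → (∀ i, y i < b) → ∃ y' : δ → G.T, (∀ i, y' i < a) ∧ EqT (Sum.elim x y') (Sum.elim x y) ∧
    ∀ i, G.Q1 (y i) b → G.Q1 (y' i) a

def RF2 (a b : G.T) : Prop := ∀ (κ δ ε : Type) [Finite κ] [Finite δ] [Finite ε] (x : κ → G.T) (y : δ → G.T),
  (∀ i, x i < a) → (∀ i, y i < b) → ∃ y' : δ → G.T, (∀ i, y' i < a) ∧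
    ∀ w' : ε → G.T, (∀ i, w' i < a) → ∃ w : ε → G.T, (∀ i, w i < b) ∧
      EqT (Sum.elim (Sum.elim x y') w') (Sum.elim (Sum.elim x y) w)

lemma rf1_of_q1 {a b : G.T} (hab : a < b) (h : G.Q1 a b) : RF1 a b :=
  fun _ _ _ _ x y hx hy => p1 hab h x y hx hy

lemma EqT.lt {ι : Type} {u v : ι → G.T} (h : EqT u v) (i j : ι) : u i < u j ↔ v i < v j := by
  rw [← not_le, ← not_le, (h j i).1]

variable (G) in
open Classical in
noncomputable def ST (n : ℕ) : Finset G.T := (G.S n).attach.image (fun x => (⟨x.1, n, x.2⟩ : G.T))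

lemma mem_ST {n : ℕ} {x : G.T} : x ∈ ST G n ↔ x.1 ∈ G.S n := by
  unfold ST
  simp only [Finset.mem_image, Finset.mem_attach, true_and, Subtype.exists]
  constructor
  · rintro ⟨y, hy, e⟩
    rw [← e]; exact hy
  · intro hx; exact ⟨x.1, hx, rfl⟩

lemma univG {T : Type*} [LinearOrder T] {W1 W2 : T → T → Prop} (hT : Tgt W1 W2) {n : ℕ} (d : T) (g : G.T → T)
    (h0 : ∀ x ∈ ST G n, ∀ y ∈ ST G n, x < y → g x < g y)
    (h1 : ∀ x ∈ ST G n, ∀ y ∈ ST G n, G.Q1 x y → W1 (g x) (g y))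
    (h2 : ∀ x ∈ ST G n, ∀ y ∈ ST G n, G.Q2 x y → W2 (g x) (g y)) :
    ∃ g' : G.T → T, StrictMono g' ∧ ∀ x ∈ ST G n, g' x = g x := by
  classical
  let g0 : ℚ → T := fun x => if h : G.K x then g ⟨x, h⟩ else d
  have e : ∀ x : G.T, g0 x.1 = g x := fun x => by simp [g0, x.2]
  have eT : ∀ x, ∀ h : x ∈ G.S n, ∃ z : G.T, z ∈ ST G n ∧ z.1 = x := fun x hx => ⟨⟨x, n, hx⟩, mem_ST.2 hx, rfl⟩
  have hg : Cov (G.S n) G.R1 G.R2 W1 W2 g0 := by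
    constructor <;>
    · intro x hx y hy hxy
      obtain ⟨x, kx, rfl⟩ := eT x hx
      obtain ⟨y, ky, rfl⟩ := eT y hy
      rw [e, e]
      first | exact h0 x kx y ky hxy | exact h1 x kx y ky hxy | exact h2 x kx y ky hxy
  obtain ⟨g', hg', hh⟩ := univT (G := G) hT (n := n) g0 hg
  exact ⟨g', hg', fun x hx => (hh x (mem_ST.1 hx)).trans (e x)⟩

lemma no_low [WellFoundedLT G.T] {n : ℕ} (g : G.T → G.T)
    (h0 : ∀ x ∈ ST G n, ∀ y ∈ ST G n, x < y → g x < g y)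
    (h1 : ∀ x ∈ ST G n, ∀ y ∈ ST G n, G.Q1 x y → G.Q1 (g x) (g y))
    (h2 : ∀ x ∈ ST G n, ∀ y ∈ ST G n, G.Q2 x y → G.Q2 (g x) (g y)) (x : G.T) (hx : x ∈ ST G n) : x ≤ g x := by
  obtain ⟨g', hg', e⟩ := univG tgtK x g h0 h1 h2
  rw [← e x hx]
  exact hg'.le_apply

lemma finm {a b : G.T} (hab : a < b) (P : G.T → G.T → Prop)
    (H : ∀ (κ δ : Type) [Finite κ] [Finite δ] (x : κ → G.T) (y : δ → G.T),
  (∀ i, x i < a) → (∀ i, y i < b) → ∃ y' : δ → G.T, (∀ i, y' i < a) ∧ EqT (Sum.elim x y') (Sum.elim x y) ∧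
    ∀ i, P (y i) (y' i)) (F : Finset G.T) : ∃ φ : G.T → G.T, (∀ x ∈ F, x < a → φ x = x) ∧
      (∀ x ∈ F, x < b → φ x < a ∧ P x (φ x)) ∧ ∀ x ∈ F, x < b → ∀ y ∈ F, y < b →
        (φ x < φ y ↔ x < y) ∧ (G.Q1 (φ x) (φ y) ↔ G.Q1 x y) ∧ (G.Q2 (φ x) (φ y) ↔ G.Q2 x y) := by
  classical
  have : Finite {x // x ∈ F ∧ x < a} := F.finite_toSet.subset (fun _ h => h.1)
  have : Finite {x // x ∈ F ∧ x < b} := F.finite_toSet.subset (fun _ h => h.1)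
  obtain ⟨y', h1, h2, h3⟩ := H {x // x ∈ F ∧ x < a} {x // x ∈ F ∧ x < b} (fun i => i.1) (fun i => i.1)
    (fun i => i.2.2) (fun i => i.2.2)
  let φ : G.T → G.T := fun x => if h : x ∈ F ∧ x < b then y' ⟨x, h⟩ else x
  have e : ∀ x (hx : x ∈ F) (hb : x < b), φ x = y' ⟨x, hx, hb⟩ := fun x hx hb => by simp [φ, hx, hb]
  refine ⟨φ, ?_, ?_, ?_⟩
  · intro x hx hxa
    rw [e x hx (hxa.trans hab)]
    have A := (h2 (.inl ⟨x, hx, hxa⟩) (.inr ⟨x, hx, hxa.trans hab⟩)).1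
    have B := (h2 (.inr ⟨x, hx, hxa.trans hab⟩) (.inl ⟨x, hx, hxa⟩)).1
    simp only [Sum.elim_inl, Sum.elim_inr, le_rfl, iff_true] at A B
    exact le_antisymm B A
  · intro x hx hb
    rw [e x hx hb]
    exact ⟨h1 _, h3 ⟨x, hx, hb⟩⟩
  · intro x hx hxb y hy hyb
    rw [e x hx hxb, e y hy hyb]
    exact ⟨h2.lt (.inr ⟨x, hx, hxb⟩) (.inr ⟨y, hy, hyb⟩), (h2 (.inr ⟨x, hx, hxb⟩) (.inr ⟨y, hy, hyb⟩)).2⟩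

lemma fin1 {a b : G.T} (hab : a < b) (H : RF1 a b) (F : Finset G.T) : ∃ φ : G.T → G.T, (∀ x ∈ F, x < a → φ x = x) ∧
      (∀ x ∈ F, x < b → φ x < a) ∧ ∀ x ∈ F, x < b → ∀ y ∈ F, y < b →
        (φ x < φ y ↔ x < y) ∧ (G.Q1 (φ x) (φ y) ↔ G.Q1 x y) ∧ (G.Q2 (φ x) (φ y) ↔ G.Q2 x y) := by
  obtain ⟨φ, h1, h2, h3⟩ := finm hab (fun _ _ => True) (fun κ δ _ _ x y hx hy => by
    obtain ⟨y', h1, h2⟩ := H κ δ x y hx hy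
    exact ⟨y', h1, h2, fun _ => trivial⟩) F
  exact ⟨φ, h1, fun x hx hb => (h2 x hx hb).1, h3⟩

theorem n1 [WellFoundedLT G.T] {a b : G.T} (hab : a < b) (H : RF1 a b) : G.Q1 a b := by
  classical
  by_contra hn
  obtain ⟨n, ha, hb⟩ := G.st2 a b
  have ha := mem_ST.2 ha
  have hb := mem_ST.2 hb
  let A : Finset G.T := (ST G n).filter (fun t => a < t ∧ t ≤ b ∧ ∃ s ∈ ST G n, b ≤ s ∧ G.Q1 t s)
  have hA : A.Nonempty := ⟨b, Finset.mem_filter.2 ⟨hb, hab, le_rfl, b, hb, le_rfl, q_refl1 b⟩⟩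
  obtain ⟨t, ht, htm⟩ : ∃ t ∈ A, ∀ x ∈ A, t ≤ x := ⟨_, Finset.min'_mem _ hA, fun x hx => Finset.min'_le _ x hx⟩
  obtain ⟨htn, hat, htb, s', hs', hbs', hts'⟩ := Finset.mem_filter.1 ht
  have no : ∀ x ∈ ST G n, a ≤ x → x < t → ∀ s ∈ ST G n, t ≤ s → ¬ G.Q1 x s := by
    intro x hx hax hxt s hs hts hq
    have : ∃ s ∈ ST G n, b ≤ s ∧ G.Q1 x s := by
      rcases le_or_gt b s with h' | h'
      · exact ⟨s, hs, h', hq⟩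
      · exact ⟨s', hs', hbs', q_tr1 (q_resp1 hxt.le hts hq) hts'⟩
    obtain ⟨s1, hs1, hb1, hq1⟩ := this
    rcases hax.eq_or_lt with rfl | hax
    · exact hn (q_resp1 hab.le hb1 hq1)
    · exact absurd (htm x (Finset.mem_filter.2 ⟨hx, hax, hxt.le.trans htb, s1, hs1, hb1, hq1⟩)) (not_le.2 hxt)
  obtain ⟨φ, f1, f2, f3⟩ := fin1 hab H (ST G n)
  have hl : ∀ x, x < t → x < b := fun x hx => hx.trans_le htb
  have := no_low (n := n) (fun x => if x < t then φ x else x) ?_ ?_ ?_ a ha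
  · simp only [if_pos hat] at this
    exact absurd (f2 a ha hab) (not_lt.2 this)
  · intro x hx y hy hxy
    by_cases h1 : x < t <;> by_cases h2 : y < t <;> simp only [h1, h2, if_true, if_false]
    · exact (f3 x hx (hl x h1) y hy (hl y h2)).1.2 hxy
    · exact ((f2 x hx (hl x h1)).trans hat).trans_le (not_lt.1 h2)
    · exact absurd (hxy.trans h2) h1
    · exact hxy
  · intro x hx y hy hxy
    by_cases h1 : x < t <;> by_cases h2 : y < t <;> simp only [h1, h2, if_true, if_false]
    · exact (f3 x hx (hl x h1) y hy (hl y h2)).2.1.2 hxy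
    · rcases lt_or_ge x a with hxa | hxa
      · rw [f1 x hx hxa]; exact hxy
      · exact absurd hxy (no x hx hxa h1 y hy (not_lt.1 h2))
    · exact absurd ((q_sub10 hxy).trans_lt h2) h1
    · exact hxy
  · intro x hx y hy hxy
    by_cases h1 : x < t <;> by_cases h2 : y < t <;> simp only [h1, h2, if_true, if_false]
    · exact (f3 x hx (hl x h1) y hy (hl y h2)).2.2.2 hxy
    · rcases lt_or_ge x a with hxa | hxa
      · rw [f1 x hx hxa]; exact hxy
      · exact absurd (q_sub21 hxy) (no x hx hxa h1 y hy (not_lt.1 h2))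
    · exact absurd ((q_sub10 (q_sub21 hxy)).trans_lt h2) h1
    · exact hxy

lemma t3 {a b : G.T} (H : RF2 a b) (O : Finset ℚ) (D1 D2 : ℚ → ℚ → Prop)
    (X : Finset G.T) (E : G.T → ℚ → Prop) (hX : ∀ x ∈ X, x < a)
    (hc : ∀ Bd : Finset G.T, (∀ b ∈ Bd, b < a) → ∃ ν, Copy G.Q1 G.Q2 O D1 D2 X E a Bd ν)
    (Bd : Finset G.T) (hBd : ∀ z ∈ Bd, z < b) : ∃ ν, Copy G.Q1 G.Q2 O D1 D2 X E b Bd ν := by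
  classical
  obtain ⟨y', hy', H⟩ := H {x // x ∈ X} {x // x ∈ Bd} {o // o ∈ O} (fun i => i.1) (fun i => i.1)
    (fun i => hX _ i.2) (fun i => hBd _ i.2)
  obtain ⟨ν, hν⟩ := hc (Finset.univ.image y') (by
    intro z hz; obtain ⟨i, -, rfl⟩ := Finset.mem_image.1 hz; exact hy' i)
  obtain ⟨w, hw, e⟩ := H (fun o => ν o.1) (fun o => hν.lt _ o.2)
  refine ⟨fun o => if ho : o ∈ O then w ⟨o, ho⟩ else a, ?_, ?_, ?_, ?_, ?_, ?_⟩
  · intro o ho; simp only [ho, dite_true]; exact hw _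
  · intro o ho x hx; simp only [ho, dite_true]
    exact (e.lt (.inl (.inr ⟨x, hx⟩)) (.inr ⟨o, ho⟩)).1 (hν.gt o ho _ (by simp))
  · intro o ho o' ho' hoo; simp only [ho, ho', dite_true]
    exact (e.lt (.inr ⟨o, ho⟩) (.inr ⟨o', ho'⟩)).1 (hν.mono o ho o' ho' hoo)
  · intro o ho o' ho' hoo; simp only [ho, ho', dite_true]
    exact (e (.inr ⟨o, ho⟩) (.inr ⟨o', ho'⟩)).2.1.1 (hν.d1 o ho o' ho' hoo)
  · intro o ho o' ho' hoo; simp only [ho, ho', dite_true]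
    exact (e (.inr ⟨o, ho⟩) (.inr ⟨o', ho'⟩)).2.2.1 (hν.d2 o ho o' ho' hoo)
  · intro x hx o ho hxo; simp only [ho, dite_true]
    exact (e (.inl (.inl ⟨x, hx⟩)) (.inr ⟨o, ho⟩)).2.2.1 (hν.e x hx o ho hxo)

end R2

namespace R2

variable {M : ℕ} {G : Gen M}

abbrev Sb (a b : G.T) := {x : G.T // x < a ∨ b ≤ x}

section
variable {a b : G.T} {O : Finset ℚ} {D1 D2 : ℚ → ℚ → Prop}

open Classical in
lemma copy_dn {X : Finset (Sb a b)} {E : Sb a b → ℚ → Prop} {E' : G.T → ℚ → Prop} {p : Sb a b}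
    {Bd : Finset (Sb a b)} {Bd' : Finset G.T} {ν : ℚ → G.T} {p' : G.T}
    (h : Copy G.Q1 G.Q2 O D1 D2 (X.image (fun x => x.1)) E' p' Bd' ν) (hp : p' ≤ p.1)
    (hE : ∀ x o, E x o → E' x.1 o) (hB : ∀ z ∈ Bd, z.1 ∈ Bd') (hν : ∀ o ∈ O, ν o < a ∨ b ≤ ν o) :
    ∃ ν' : ℚ → Sb a b, (∀ o ∈ O, (ν' o).1 = ν o) ∧
      Copy (fun x y : Sb a b => G.Q1 x.1 y.1) (fun x y : Sb a b => G.Q2 x.1 y.1) O D1 D2 X E p Bd ν' := by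
  have e : ∀ o ∈ O, ((fun o => if h : ν o < a ∨ b ≤ ν o then (⟨ν o, h⟩ : Sb a b) else p) o).1 = ν o := by
    intro o ho; simp only [hν o ho, dite_true]
  generalize (fun o => if h : ν o < a ∨ b ≤ ν o then (⟨ν o, h⟩ : Sb a b) else p) = ν' at e
  refine ⟨ν', e, ?_, ?_, ?_, ?_, ?_, ?_⟩
  · intro o ho; show (ν' o).1 < p.1; rw [e o ho]; exact (h.lt o ho).trans_le hp
  · intro o ho z hz; show z.1 < (ν' o).1; rw [e o ho]; exact h.gt o ho _ (hB z hz)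
  · intro o ho o' ho' hh; show (ν' o).1 < (ν' o').1; rw [e o ho, e o' ho']; exact h.mono o ho o' ho' hh
  · intro o ho o' ho' hh; show G.Q1 (ν' o).1 (ν' o').1; rw [e o ho, e o' ho']; exact h.d1 o ho o' ho' hh
  · intro o ho o' ho' hh; show G.Q2 (ν' o).1 (ν' o').1; rw [e o ho, e o' ho']; exact h.d2 o ho o' ho' hh
  · intro x hx o ho hh; show G.Q2 x.1 (ν' o).1; rw [e o ho]
    exact h.e _ (Finset.mem_image_of_mem _ hx) o ho (hE x o hh)

lemma ax12 (hab : a < b) (h1 : G.Q1 a b) (hM : MK a b) (X : Finset G.T) {E : G.T → ℚ → Prop} {p : G.T} (hp : p < a ∨ b ≤ p)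
    (mark : ℚ → Prop) (H : ∀ X : Finset G.T, (∀ x ∈ X, x < p) → ∃ ν, Copy G.Q1 G.Q2 O D1 D2 X E p X ν ∧
      ∀ o ∈ O, mark o → G.Q1 (ν o) p) (hX : ∀ x ∈ X, x < p) (hS : ∀ x ∈ X, x < a ∨ b ≤ x) :
    ∃ ν, Copy G.Q1 G.Q2 O D1 D2 X E p X ν ∧ (∀ o ∈ O, mark o → G.Q1 (ν o) p) ∧ ∀ o ∈ O, ν o < a ∨ b ≤ ν o := by
  classical
  rcases hp with hp | hp
  · obtain ⟨ν, h, h'⟩ := H X hX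
    exact ⟨ν, h, h', fun o ho => .inl ((h.lt o ho).trans hp)⟩
  rcases hp.eq_or_lt with rfl | hp
  · obtain ⟨ν, h, h'⟩ := H X hX
    obtain ⟨φ, f1, f2, f3⟩ := finm hab (fun z z' => G.Q1 z b → G.Q1 z' a) hM (X ∪ O.image ν)
    have hXa : ∀ x ∈ X, x < a := fun x hx => (hS x hx).resolve_right (not_le.2 (hX x hx))
    have mx : ∀ x ∈ X, x ∈ X ∪ O.image ν := fun x hx => Finset.mem_union_left _ hx
    have mo : ∀ o ∈ O, ν o ∈ X ∪ O.image ν := fun o ho => Finset.mem_union_right _ (Finset.mem_image_of_mem _ ho)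
    refine ⟨fun o => φ (ν o), ⟨?_, ?_, ?_, ?_, ?_, ?_⟩, ?_, ?_⟩
    · intro o ho; exact (f2 _ (mo o ho) (h.lt o ho)).1.trans hab
    · intro o ho x hx
      rw [← f1 x (mx x hx) (hXa x hx)]
      exact (f3 _ (mx x hx) (hX x hx) _ (mo o ho) (h.lt o ho)).1.2 (h.gt o ho x hx)
    · intro o ho o' ho' hh
      exact (f3 _ (mo o ho) (h.lt o ho) _ (mo o' ho') (h.lt o' ho')).1.2 (h.mono o ho o' ho' hh)
    · intro o ho o' ho' hh
      exact (f3 _ (mo o ho) (h.lt o ho) _ (mo o' ho') (h.lt o' ho')).2.1.2 (h.d1 o ho o' ho' hh)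
    · intro o ho o' ho' hh
      exact (f3 _ (mo o ho) (h.lt o ho) _ (mo o' ho') (h.lt o' ho')).2.2.2 (h.d2 o ho o' ho' hh)
    · intro x hx o ho hh
      rw [← f1 x (mx x hx) (hXa x hx)]
      exact (f3 _ (mx x hx) (hX x hx) _ (mo o ho) (h.lt o ho)).2.2.2 (h.e x hx o ho hh)
    · intro o ho hm
      exact q_tr1 ((f2 _ (mo o ho) (h.lt o ho)).2 (h' o ho hm)) h1
    · intro o ho; exact .inl (f2 _ (mo o ho) (h.lt o ho)).1
  · obtain ⟨ν, h, h'⟩ := H (insert b X) (by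
      intro x hx; rcases Finset.mem_insert.1 hx with rfl | hx
      exacts [hp, hX x hx])
    exact ⟨ν, ⟨h.lt, fun o ho x hx => h.gt o ho x (Finset.mem_insert_of_mem hx), h.mono, h.d1, h.d2,
      fun x hx => h.e x (Finset.mem_insert_of_mem hx)⟩, h', fun o ho => .inr (h.gt o ho b (Finset.mem_insert_self _ _)).le⟩

end

lemma tgtSub {a b : G.T} (hab : a < b) (h1 : G.Q1 a b) (hR : RF2 a b) (hM : MK a b) :
    Tgt (fun x y : Sb a b => G.Q1 x.1 y.1) (fun x y : Sb a b => G.Q2 x.1 y.1) where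
  refl := fun x => q_refl _
  sub21 := fun _ _ => q_sub21
  sub10 := fun _ _ h => q_sub10 h
  trans1 := fun _ _ _ => q_tr1
  resp1 := fun _ _ _ h h' => q_resp1 h h'
  ax1 := by
    classical
    intro p r hpr O y hy hm X hX
    obtain ⟨ν, h, -, h3⟩ := ax12 hab h1 hM (X.image (fun x => x.1)) p.2 (fun _ => False) (fun X hX => by
      obtain ⟨ν, h⟩ := tgtK.ax1 p.1 r.1 hpr O (fun o => (y o).1) hy hm X hX
      exact ⟨ν, h, fun _ _ h => h.elim⟩) (by
        intro x hx; obtain ⟨x, kx, rfl⟩ := Finset.mem_image.1 hx; exact hX x kx) (by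
        intro x hx; obtain ⟨x, kx, rfl⟩ := Finset.mem_image.1 hx; exact x.2)
    obtain ⟨ν', -, h'⟩ := copy_dn (p := p) (Bd := X) (E := fun x o => G.Q2 x.1 (y o).1) h le_rfl (fun _ _ h => h) (fun z hz => Finset.mem_image_of_mem _ hz) h3
    exact ⟨ν', h'⟩
  ax2 := by
    classical
    intro p r hpr O y hy hm X hX
    obtain ⟨ν, h, h2, h3⟩ := ax12 hab h1 hM (X.image (fun x => x.1)) p.2 (fun o => G.Q1 (y o).1 r.1)
      (tgtK.ax2 p.1 r.1 hpr O (fun o => (y o).1) hy hm) (by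
        intro x hx; obtain ⟨x, kx, rfl⟩ := Finset.mem_image.1 hx; exact hX x kx) (by
        intro x hx; obtain ⟨x, kx, rfl⟩ := Finset.mem_image.1 hx; exact x.2)
    obtain ⟨ν', e, h'⟩ := copy_dn (p := p) (Bd := X) (E := fun x o => G.Q2 x.1 (y o).1) h le_rfl (fun _ _ h => h) (fun z hz => Finset.mem_image_of_mem _ hz) h3
    exact ⟨ν', h', fun o ho hh => by rw [e o ho]; exact h2 o ho hh⟩
  ax3 := by
    classical
    intro p q hpq O D1 D2 X E hX hc Bd hBd
    rcases eq_or_ne p q with rfl | hne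
    · exact hc Bd hBd
    have hlt : p.1 < q.1 := lt_of_le_of_ne (q_sub10 (q_sub21 hpq)) (fun h => hne (Subtype.ext h))
    let E' : G.T → ℚ → Prop := fun z o => ∃ h, E ⟨z, h⟩ o
    have mX : ∀ x ∈ X.image (fun x : Sb a b => x.1), x < p.1 := by
      intro x hx; obtain ⟨x, kx, rfl⟩ := Finset.mem_image.1 hx; exact hX x kx
    have up : ∀ (p' : G.T) (Bd : Finset G.T) (B : Finset (Sb a b)), (∀ z ∈ B, z < p) → (∀ z : Sb a b, z < p → z.1 < p') →
        (∀ t : Sb a b, (∀ z ∈ B, z < t) → ∀ z ∈ Bd, z < t.1) →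
        ∃ ν, Copy G.Q1 G.Q2 O D1 D2 (X.image (fun x : Sb a b => x.1)) E' p' Bd ν := by
      intro p' Bd B hB hp' ht
      obtain ⟨ν, h⟩ := hc B hB
      refine ⟨fun o => (ν o).1, fun o ho => hp' _ (h.lt o ho), fun o ho z hz => ht _ (h.gt o ho) z hz, h.mono, h.d1, h.d2, ?_⟩
      intro x hx o ho hh
      obtain ⟨x, kx, rfl⟩ := Finset.mem_image.1 hx
      exact h.e x kx o ho hh.2
    have key : ∀ Bd : Finset G.T, (∀ z ∈ Bd, z < p.1) →
        ∃ ν, Copy G.Q1 G.Q2 O D1 D2 (X.image (fun x : Sb a b => x.1)) E' p.1 Bd ν := by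
      intro Bd hBd
      rcases p.2 with hp | hp
      · refine up p.1 Bd (Bd.subtype _) (fun z hz => hBd _ (Finset.mem_subtype.1 hz)) (fun _ h => h) ?_
        intro t ht z hz
        exact ht ⟨z, .inl ((hBd z hz).trans hp)⟩ (Finset.mem_subtype.2 hz)
      rcases hp.eq_or_lt with hp | hp
      · rw [← hp] at hBd mX ⊢
        have hl : ∀ z : Sb a b, z < p → z.1 < a := fun z hz => z.2.resolve_right (not_le.2 ((show z.1 < p.1 from hz).trans_eq hp.symm))
        refine t3 hR O D1 D2 _ E' ?_ ?_ Bd hBd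
        · intro x hx; obtain ⟨x, kx, rfl⟩ := Finset.mem_image.1 hx; exact hl x (hX x kx)
        · intro Bd hBd
          refine up a Bd (Bd.subtype _) (fun z hz => ?_) hl ?_
          · show z.1 < p.1
            rw [← hp]; exact (hBd _ (Finset.mem_subtype.1 hz)).trans hab
          · intro t ht z hz
            exact ht ⟨z, .inl (hBd z hz)⟩ (Finset.mem_subtype.2 hz)
      · refine up p.1 Bd ((insert b Bd).subtype _) (fun z hz => ?_) (fun _ h => h) ?_
        · rcases Finset.mem_insert.1 (Finset.mem_subtype.1 hz) with h | h
          · show z.1 < p.1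
            rw [h]; exact hp
          · exact hBd _ h
        · intro t ht z hz
          rcases lt_or_ge z b with hzb | hzb
          · exact hzb.trans (ht ⟨b, .inr le_rfl⟩ (Finset.mem_subtype.2 (Finset.mem_insert_self _ _)))
          · exact ht ⟨z, .inr hzb⟩ (Finset.mem_subtype.2 (Finset.mem_insert_of_mem hz))
    have mB : ∀ z ∈ Bd, z.1 ∈ Bd.image (fun x : Sb a b => x.1) := fun z hz => Finset.mem_image_of_mem _ hz
    have mB' : ∀ z ∈ Bd.image (fun x : Sb a b => x.1), z < q.1 := by
      intro x hx; obtain ⟨x, kx, rfl⟩ := Finset.mem_image.1 hx; exact hBd x kx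
    have hE : ∀ x o, E x o → E' x.1 o := fun x o h => ⟨x.2, h⟩
    rcases q.2 with hq | hq
    · obtain ⟨ν, h⟩ := tgtK.ax3 p.1 q.1 hpq O D1 D2 _ E' mX key _ mB'
      obtain ⟨ν', -, h'⟩ := copy_dn h le_rfl hE mB (fun o ho => .inl ((h.lt o ho).trans hq))
      exact ⟨ν', h'⟩
    rcases hq.eq_or_lt with hq | hq
    · have hpa : p.1 < a := p.2.resolve_right (not_le.2 (hlt.trans_eq hq.symm))
      have hpq' : G.Q2 p.1 b := by
        have h : G.Q2 p.1 q.1 := hpq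
        rwa [← hq] at h
      have h2 : G.Q2 p.1 a := q_resp2 (q_resp1 hpa.le hab.le (q_sub21 hpq')) h1 hpq'
      obtain ⟨ν, h⟩ := tgtK.ax3 p.1 a h2 O D1 D2 _ E' mX key (Bd.image (fun x : Sb a b => x.1)) (by
        intro x hx; obtain ⟨x, kx, rfl⟩ := Finset.mem_image.1 hx
        exact x.2.resolve_right (not_le.2 ((show x.1 < q.1 from hBd x kx).trans_eq hq.symm)))
      obtain ⟨ν', -, h'⟩ := copy_dn (p := q) h (by rw [← hq]; exact hab.le) hE mB (fun o ho => .inl (h.lt o ho))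
      exact ⟨ν', h'⟩
    · obtain ⟨ν, h⟩ := tgtK.ax3 p.1 q.1 hpq O D1 D2 _ E' mX key (insert b (Bd.image (fun x : Sb a b => x.1))) (by
        intro x hx; rcases Finset.mem_insert.1 hx with rfl | hx
        exacts [hq, mB' x hx])
      obtain ⟨ν', -, h'⟩ := copy_dn h le_rfl hE (fun z hz => Finset.mem_insert_of_mem (mB z hz))
        (fun o ho => .inr (h.gt o ho b (Finset.mem_insert_self _ _)).le)
      exact ⟨ν', h'⟩

theorem n2 [WellFoundedLT G.T] {a b : G.T} (hab : a < b) (h1 : G.Q1 a b) (hR : RF2 a b) (hM : MK a b)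
    (hz : ∀ z, a ≤ z → z < b → ¬ G.Q2 z b) : False := by
  classical
  obtain ⟨n, ha, hb⟩ := G.st2 a b
  have ha := mem_ST.2 ha
  have hb := mem_ST.2 hb
  by_cases hs : ∃ s ∈ ST G n, G.Q1 a s ∧ ∀ r ∈ ST G n, G.Q1 b r → r < s
  · obtain ⟨s, hs, has, hsr⟩ := hs
    let B := (ST G n).filter (fun r => G.Q1 b r)
    let O : Finset ℚ := B.image (fun x => x.1)
    let y : ℚ → G.T := fun o => if h : G.K o then ⟨o, h⟩ else a
    have ey : ∀ x : G.T, y x.1 = x := fun x => by simp [y, x.2]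
    have mB : ∀ x ∈ ST G n, G.Q1 b x → x.1 ∈ O := fun x hx hh =>
      Finset.mem_image_of_mem _ (Finset.mem_filter.2 ⟨hx, hh⟩)
    have oB : ∀ o ∈ O, ∃ x ∈ ST G n, G.Q1 b x ∧ o = x.1 := by
      intro o ho; obtain ⟨x, hx, rfl⟩ := Finset.mem_image.1 ho
      exact ⟨x, (Finset.mem_filter.1 hx).1, (Finset.mem_filter.1 hx).2, rfl⟩
    obtain ⟨ν, h⟩ := t3 hR O (fun o o' => G.Q1 (y o) (y o')) (fun o o' => G.Q2 (y o) (y o'))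
      ((ST G n).filter (fun x => x < a)) (fun x o => G.Q2 x (y o)) (fun x hx => (Finset.mem_filter.1 hx).2) (by
        intro Bd hBd
        obtain ⟨ν, h⟩ := tgtK.ax1 a s has O y (by
          intro o ho; obtain ⟨x, hx, hbx, rfl⟩ := oB o ho
          rw [ey]; exact ⟨hab.le.trans (q_sub10 hbx), hsr x hx hbx⟩) (by
          intro o ho o' ho' hh
          obtain ⟨x, hx, hbx, rfl⟩ := oB o ho
          obtain ⟨x', hx', hbx', rfl⟩ := oB o' ho'
          rw [ey, ey]; exact hh) ((ST G n).filter (fun x => x < a) ∪ Bd) (by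
          intro x hx; rcases Finset.mem_union.1 hx with hx | hx
          exacts [(Finset.mem_filter.1 hx).2, hBd x hx])
        exact ⟨ν, h.lt, fun o ho z hz => h.gt o ho z (Finset.mem_union_right _ hz), h.mono, h.d1, h.d2,
          fun x hx => h.e x (Finset.mem_union_left _ hx)⟩) ((ST G n).filter (fun x => x < b))
      (fun x hx => (Finset.mem_filter.1 hx).2)
    have lo : ∀ x z, ¬ G.Q1 b x → G.Q1 b z → x ≤ z → x < b := fun x z hx hz' hxz =>
      not_le.1 fun hbx => hx (q_resp1 hbx hxz hz')
    have := no_low (n := n) (fun x => if G.Q1 b x then ν x.1 else x) ?_ ?_ ?_ b hb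
    · simp only [q_refl1, if_true] at this
      exact absurd (h.lt _ (mB b hb (q_refl1 b))) (not_lt.2 this)
    · intro x hx z hz' hxz
      by_cases k1 : G.Q1 b x <;> by_cases k2 : G.Q1 b z <;> simp only [k1, k2, if_true, if_false]
      · exact h.mono _ (mB x hx k1) _ (mB z hz' k2) hxz
      · exact (h.lt _ (mB x hx k1)).trans ((q_sub10 k1).trans_lt hxz)
      · exact h.gt _ (mB z hz' k2) x (Finset.mem_filter.2 ⟨hx, lo x z k1 k2 hxz.le⟩)
      · exact hxz
    · intro x hx z hz' hxz
      by_cases k1 : G.Q1 b x <;> by_cases k2 : G.Q1 b z <;> simp only [k1, k2, if_true, if_false]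
      · exact h.d1 _ (mB x hx k1) _ (mB z hz' k2) (by rw [ey, ey]; exact hxz)
      · exact absurd (q_tr1 k1 hxz) k2
      · have hxb := lo x z k1 k2 (q_sub10 hxz)
        exact q_resp1 (h.gt _ (mB z hz' k2) x (Finset.mem_filter.2 ⟨hx, hxb⟩)).le
          ((h.lt _ (mB z hz' k2)).le.trans (q_sub10 k2)) hxz
      · exact hxz
    · intro x hx z hz' hxz
      by_cases k1 : G.Q1 b x <;> by_cases k2 : G.Q1 b z <;> simp only [k1, k2, if_true, if_false]
      · exact h.d2 _ (mB x hx k1) _ (mB z hz' k2) (by rw [ey, ey]; exact hxz)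
      · exact absurd (q_tr1 k1 (q_sub21 hxz)) k2
      · have hxb := lo x z k1 k2 (q_sub10 (q_sub21 hxz))
        rcases lt_or_ge x a with hxa | hxa
        · exact h.e x (Finset.mem_filter.2 ⟨hx, hxa⟩) _ (mB z hz' k2) (by rw [ey]; exact hxz)
        · exact absurd (q_resp2 (q_resp1 hxb.le (q_sub10 k2) (q_sub21 hxz)) k2 hxz) (hz x hxa hxb)
      · exact hxz
  · have hst : ∀ s ∈ ST G n, b ≤ s → G.Q1 a s → G.Q1 b s := by
      intro s hs' hbs has
      by_contra hn
      refine hs ⟨s, hs', has, fun r hr hbr => ?_⟩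
      by_contra hrs
      exact hn (q_resp1 hbs (not_lt.1 hrs) hbr)
    obtain ⟨φ, f1, f2, f3⟩ := finm hab (fun z z' => G.Q1 z b → G.Q1 z' a) hM (ST G n)
    let g : G.T → Sb a b := fun x => if hx : b ≤ x then ⟨x, .inr hx⟩ else if hx : φ x < a then ⟨φ x, .inl hx⟩ else ⟨b, .inr le_rfl⟩
    have g1 : ∀ x, b ≤ x → (g x).1 = x := fun x hx => by simp only [g, hx, dite_true]
    have g2 : ∀ x ∈ ST G n, x < b → (g x).1 = φ x := fun x hx hxb => by
      simp only [g, not_le.2 hxb, dite_false, (f2 x hx hxb).1, dite_true]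
    have := univG (n := n) (tgtSub hab h1 hR hM) ⟨b, .inr le_rfl⟩ g ?_ ?_ ?_
    · obtain ⟨g', hg', e⟩ := this
      have hm : StrictMono (fun x => (g' x).1) := fun x y hxy => hg' hxy
      have : a ≤ (g' a).1 := hm.le_apply
      rw [e a ha, g2 a ha hab] at this
      exact absurd (f2 a ha hab).1 (not_lt.2 this)
    · intro x hx z hz' hxz
      show (g x).1 < (g z).1
      rcases lt_or_ge z b with hzb | hzb
      · rw [g2 x hx (hxz.trans hzb), g2 z hz' hzb]; exact (f3 x hx (hxz.trans hzb) z hz' hzb).1.2 hxz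
      rw [g1 z hzb]
      rcases lt_or_ge x b with hxb | hxb
      · rw [g2 x hx hxb]; exact ((f2 x hx hxb).1.trans hab).trans_le hzb
      · rw [g1 x hxb]; exact hxz
    · intro x hx z hz' hxz
      show G.Q1 (g x).1 (g z).1
      have hle := q_sub10 hxz
      rcases lt_or_ge z b with hzb | hzb
      · rw [g2 x hx (hle.trans_lt hzb), g2 z hz' hzb]; exact (f3 x hx (hle.trans_lt hzb) z hz' hzb).2.1.2 hxz
      rw [g1 z hzb]
      rcases lt_or_ge x b with hxb | hxb
      · rw [g2 x hx hxb]
        rcases lt_or_ge x a with hxa | hxa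
        · rw [f1 x hx hxa]; exact hxz
        · exact q_tr1 ((f2 x hx hxb).2 (q_resp1 hxb.le hzb hxz)) (q_tr1 (q_resp1 hxa hxb.le h1) hxz)
      · rw [g1 x hxb]; exact hxz
    · intro x hx z hz' hxz
      show G.Q2 (g x).1 (g z).1
      have hle := q_sub10 (q_sub21 hxz)
      rcases lt_or_ge z b with hzb | hzb
      · rw [g2 x hx (hle.trans_lt hzb), g2 z hz' hzb]; exact (f3 x hx (hle.trans_lt hzb) z hz' hzb).2.2.2 hxz
      rw [g1 z hzb]
      rcases lt_or_ge x b with hxb | hxb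
      · rw [g2 x hx hxb]
        rcases lt_or_ge x a with hxa | hxa
        · rw [f1 x hx hxa]; exact hxz
        · have hbz := hst z hz' hzb (q_tr1 (q_resp1 hxa hxb.le h1) (q_sub21 hxz))
          exact absurd (q_resp2 (q_resp1 hxb.le hzb (q_sub21 hxz)) hbz hxz) (hz x hxa hxb)
      · rw [g1 x hxb]; exact hxz

end R2

namespace R2

variable {M : ℕ} {G : Gen M} {le1 le2 : Ordinal → Ordinal → Prop}

lemma ord_resp2 (h : IsR2Pair le1 le2) {a z b : Ordinal} (h2 : le2 a b) (h1 : le1 a z) (h3 : le1 z b) : le2 a z := by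
  refine le2_of_refl h (ord_sub10 h _ _ h1) (fun κ δ _ _ x y hx hy => le1_reflect h h1 x y hx hy) ?_
  intro κ δ ε _ _ _ x y hx hy
  have hzb := ord_sub10 h _ _ h3
  obtain ⟨y', hy', H⟩ := le2_reflect h h2 (ε := ε) x y hx (fun i => (hy i).trans_le hzb)
  refine ⟨y', hy', fun w' hw' => ?_⟩
  obtain ⟨w, hw, e⟩ := H w' hw'
  obtain ⟨v, hv, e'⟩ := le1_reflect h h3 (Sum.elim x y) w (by
    rintro (i | i)
    exacts [(hx i).trans_le (ord_sub10 h _ _ h1), hy i]) hw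
  exact ⟨v, hv, e.trans e'.symm⟩

theorem ident (h : IsR2Pair le1 le2) [WellFoundedLT G.T] (π : G.T → Ordinal) (hm : StrictMono π)
    (hi : ∀ x o, o < π x → ∃ y, π y = o) (b : G.T) :
    ∀ a, (le1 (π a) (π b) ↔ G.Q1 a b) ∧ (le2 (π a) (π b) ↔ G.Q2 a b) := by
  induction b using WellFoundedLT.induction with
  | _ b ih =>
  have lf : ∀ {κ : Type} (x : κ → Ordinal) (c : G.T), (∀ i, x i < π c) → ∃ x0 : κ → G.T, (∀ i, x0 i < c) ∧ x = π ∘ x0 := by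
    intro κ x c hx
    choose x0 h0 using fun i => hi c (x i) (hx i)
    refine ⟨x0, fun i => ?_, funext fun i => (h0 i).symm⟩
    have := hx i
    rw [← h0 i] at this
    exact hm.lt_iff_lt.1 this
  have tr : ∀ {ι : Type} (u v : ι → G.T), (∀ i, u i < b) → (∀ i, v i < b) →
      (cd le1 le2 (π ∘ u) = cd le1 le2 (π ∘ v) ↔ EqT u v) := by
    intro ι u v hu hv
    have k : ∀ i j, ((π (u i) ≤ π (u j) ↔ π (v i) ≤ π (v j)) ∧ (le1 (π (u i)) (π (u j)) ↔ le1 (π (v i)) (π (v j))) ∧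
      (le2 (π (u i)) (π (u j)) ↔ le2 (π (v i)) (π (v j)))) ↔ ((u i ≤ u j ↔ v i ≤ v j) ∧
        (G.Q1 (u i) (u j) ↔ G.Q1 (v i) (v j)) ∧ (G.Q2 (u i) (u j) ↔ G.Q2 (v i) (v j))) := by
      intro i j
      rw [hm.le_iff_le, hm.le_iff_le, (ih _ (hu j) _).1, (ih _ (hv j) _).1, (ih _ (hu j) _).2, (ih _ (hv j) _).2]
    constructor
    · intro e i j
      exact (k i j).1 ⟨(cd_iff e i j).1, (cd_iff e i j).2.2⟩
    · intro e
      funext i j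
      have := (k i j).2 (e i j)
      simp only [cd, Function.comp_apply, this.1, this.2.1, this.2.2]
  intro a
  rcases lt_trichotomy b a with hba | rfl | hab
  · have hn : ¬ π a ≤ π b := not_le.2 (hm hba)
    have hn' : ¬ a ≤ b := not_le.2 hba
    exact ⟨iff_of_false (fun hh => hn (ord_sub10 h _ _ hh)) (fun hh => hn' (q_sub10 hh)),
      iff_of_false (fun hh => hn (ord_sub10 h _ _ (ord_sub21 h _ _ hh))) (fun hh => hn' (q_sub10 (q_sub21 hh)))⟩
  · exact ⟨iff_of_true (ord_sub21 h _ _ (ord_refl2 h _)) (q_refl1 _), iff_of_true (ord_refl2 h _) (q_refl _)⟩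
  have el : ∀ {κ δ : Type} {x : κ → G.T} {y : δ → G.T}, (∀ i, x i < b) → (∀ i, y i < b) → ∀ i, Sum.elim x y i < b := by
    intro κ δ x y hx hy i
    rcases i with i | i
    exacts [hx i, hy i]
  have A1 : ∀ a, a < b → G.Q1 a b → Refl1 le1 le2 (π a) (π b) := by
    intro a hab hq κ δ _ _ x y hx hy
    obtain ⟨x, k, rfl⟩ := lf x a hx; clear hx; rename' k => hx
    obtain ⟨y, k, rfl⟩ := lf y b hy; clear hy; rename' k => hy
    obtain ⟨y', hy', e⟩ := rf1_of_q1 hab hq κ δ x y hx hy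
    refine ⟨π ∘ y', fun i => hm (hy' i), ?_⟩
    rw [← Sum.comp_elim, ← Sum.comp_elim]
    have hx' := fun i => (hx i).trans hab
    exact (tr _ _ (el hx' (fun i => (hy' i).trans hab)) (el hx' hy)).2 e
  have B1 : ∀ a, a < b → G.Q1 a b → le1 (π a) (π b) := fun a hab hq => le1_of_refl h (hm hab).le (A1 a hab hq)
  have C1 : ∀ a, a < b → le1 (π a) (π b) → G.Q1 a b := by
    intro a hab hl
    refine n1 hab fun κ δ _ _ x y hx hy => ?_
    obtain ⟨y', hy', e⟩ := le1_reflect h hl (π ∘ x) (π ∘ y) (fun i => hm (hx i)) (fun i => hm (hy i))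
    obtain ⟨y', k, rfl⟩ := lf y' a hy'; clear hy'; rename' k => hy'
    refine ⟨y', hy', ?_⟩
    rw [← Sum.comp_elim, ← Sum.comp_elim] at e
    have hx' := fun i => (hx i).trans hab
    exact (tr _ _ (el hx' (fun i => (hy' i).trans hab)) (el hx' hy)).1 e
  refine ⟨⟨C1 a hab, B1 a hab⟩, ?_, ?_⟩
  · intro hl
    have hl1 := ord_sub21 h _ _ hl
    by_contra hn
    refine n2 hab (C1 a hab hl1) ?_ ?_ ?_
    · intro κ δ ε _ _ _ x y hx hy
      obtain ⟨y', hy', H⟩ := le2_reflect h hl (ε := ε) (π ∘ x) (π ∘ y) (fun i => hm (hx i)) (fun i => hm (hy i))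
      obtain ⟨y', k, rfl⟩ := lf y' a hy'; clear hy'; rename' k => hy'
      refine ⟨y', hy', fun w' hw' => ?_⟩
      obtain ⟨w, hw, e⟩ := H (π ∘ w') (fun i => hm (hw' i))
      obtain ⟨w, k, rfl⟩ := lf w b hw; clear hw; rename' k => hw
      refine ⟨w, hw, ?_⟩
      rw [← Sum.comp_elim, ← Sum.comp_elim, ← Sum.comp_elim, ← Sum.comp_elim] at e
      have hx' := fun i => (hx i).trans hab
      exact (tr _ _ (el (el hx' (fun i => (hy' i).trans hab)) (fun i => (hw' i).trans hab)) (el (el hx' hy) hw)).1 e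
    · intro κ δ _ _ x y hx hy
      obtain ⟨y', hy', e, H⟩ := ord_marks h hl (hm hab) (π ∘ x) (π ∘ y) (fun i => hm (hx i)) (fun i => hm (hy i))
      obtain ⟨y', k, rfl⟩ := lf y' a hy'; clear hy'; rename' k => hy'
      rw [← Sum.comp_elim, ← Sum.comp_elim] at e
      have hx' := fun i => (hx i).trans hab
      exact ⟨y', hy', (tr _ _ (el hx' (fun i => (hy' i).trans hab)) (el hx' hy)).1 e,
        fun i hq => (ih a hab _).1.1 (H i (B1 _ (hy i) hq))⟩
    · intro z haz hzb hq
      rcases haz.eq_or_lt with rfl | haz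
      · exact hn hq
      have k1 : G.Q1 a z := q_resp1 haz.le hzb.le (C1 a hab hl1)
      have := ord_resp2 h hl ((ih z hzb a).1.2 k1) (B1 z hzb (q_sub21 hq))
      exact hn (q_tr2 ((ih z hzb a).2.1 this) hq)
  · intro hq
    refine le2_of_refl h (hm hab).le (A1 a hab (q_sub21 hq)) ?_
    intro κ δ ε _ _ _ x y hx hy
    obtain ⟨x, k, rfl⟩ := lf x a hx; clear hx; rename' k => hx
    obtain ⟨y, k, rfl⟩ := lf y b hy; clear hy; rename' k => hy
    obtain ⟨y', hy', H⟩ := p2 hab hq x y hx hy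
    refine ⟨π ∘ y', fun i => hm (hy' i), fun w' hw' => ?_⟩
    obtain ⟨w', k, rfl⟩ := lf w' a hw'; clear hw'; rename' k => hw'
    obtain ⟨w, hw, e⟩ := H ε w' hw'
    refine ⟨π ∘ w, fun i => hm (hw i), ?_⟩
    rw [← Sum.comp_elim, ← Sum.comp_elim, ← Sum.comp_elim, ← Sum.comp_elim]
    have hx' := fun i => (hx i).trans hab
    exact (tr _ _ (el (el hx' (fun i => (hy' i).trans hab)) (fun i => (hw' i).trans hab)) (el (el hx' hy) hw)).2 e

end R2

namespace R2

section
variable {M : ℕ} {G : Gen M}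

lemma K_le (k : ℕ) : ∀ y ∈ G.S k, ∃ i < M, y ≤ (i : ℚ) := by
  induction k with
  | zero =>
    intro y hy
    rw [G.S0] at hy
    obtain ⟨i, hi, rfl⟩ := Finset.mem_image.1 hy
    exact ⟨i, Finset.mem_range.1 hi, le_rfl⟩
  | succ k ih =>
    rcases G.step k with h | ⟨τ, f, h⟩
    · rw [h]; exact ih
    · intro y hy
      rw [h.S_eq] at hy
      rcases Finset.mem_union.1 hy with hy | hy
      · exact ih y hy
      · obtain ⟨o, ho, rfl⟩ := Finset.mem_image.1 hy
        have hp : τ.place ∈ G.S k := by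
          have := h.valid
          cases τ <;> simp only [Task.Valid, Task.place] at this ⊢
          exacts [this.1, this.1, this.2.2.1]
        obtain ⟨i, hi, hle⟩ := ih _ hp
        exact ⟨i, hi, (h.lt o).le.trans hle⟩

variable (G) in
def tp (i : ℕ) (hi : i < M) : G.T := ⟨i, 0, by rw [G.S0]; exact Finset.mem_image_of_mem _ (Finset.mem_range.2 hi)⟩

lemma tp_mem (i : ℕ) (hi : i < M) : tp G i hi ∈ ST G 0 := mem_ST.2 (by
  rw [G.S0]; exact Finset.mem_image_of_mem _ (Finset.mem_range.2 hi))

lemma mem_tp (x : G.T) (hx : x ∈ ST G 0) : ∃ i, ∃ hi : i < M, x = tp G i hi := by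
  have := mem_ST.1 hx
  rw [G.S0] at this
  obtain ⟨i, hi, e⟩ := Finset.mem_image.1 this
  exact ⟨i, Finset.mem_range.1 hi, Subtype.ext e.symm⟩

lemma tp_lt {i j : ℕ} (hi : i < M) (hj : j < M) : tp G i hi < tp G j hj ↔ i < j := by
  rw [Gen.lt_iff]; exact Nat.cast_lt

lemma tp_q2 {i j : ℕ} (hi : i < M) (hj : j < M) (hij : i ≤ j) : G.Q2 (tp G i hi) (tp G j hj) :=
  (G.R20 _ (mem_ST.1 (tp_mem i hi)) _ (mem_ST.1 (tp_mem j hj))).2 (Nat.cast_le.2 hij)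

lemma T_le (y : G.T) : ∃ i, ∃ hi : i < M, y ≤ tp G i hi := by
  obtain ⟨k, hk⟩ := y.2
  obtain ⟨i, hi, h⟩ := K_le k _ hk
  exact ⟨i, hi, h⟩

/-- extend a chain to all of the generated structure -/
lemma ext_chain {T : Type*} [LinearOrder T] {W1 W2 : T → T → Prop} (hT : Tgt W1 W2) (d : T) (f : ℕ → T)
    (h0 : ∀ i j, i < j → j < M → f i < f j) (h2 : ∀ i j, i ≤ j → j < M → W2 (f i) (f j)) :
    ∃ g : G.T → T, StrictMono g ∧ ∀ i hi, g (tp G i hi) = f i := by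
  have e : ∀ i hi, f ⌊(tp G i hi).1⌋₊ = f i := by
    intro i hi
    have : (tp G i hi).1 = (i : ℚ) := rfl
    rw [this, Nat.floor_natCast]
  have key : ∀ x ∈ ST G 0, ∀ y ∈ ST G 0, x ≤ y → W2 (f ⌊x.1⌋₊) (f ⌊y.1⌋₊) := by
    intro x hx y hy hxy
    obtain ⟨i, hi, rfl⟩ := mem_tp x hx
    obtain ⟨j, hj, rfl⟩ := mem_tp y hy
    rw [e, e]
    exact h2 i j (not_lt.1 fun h => not_lt.2 hxy ((tp_lt hj hi).2 h)) hj
  have := univG (G := G) hT (n := 0) d (fun x => f ⌊x.1⌋₊) ?_ ?_ ?_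
  · obtain ⟨g, hg, h⟩ := this
    exact ⟨g, hg, fun i hi => (h _ (tp_mem i hi)).trans (e i hi)⟩
  · intro x hx y hy hxy
    obtain ⟨i, hi, rfl⟩ := mem_tp x hx
    obtain ⟨j, hj, rfl⟩ := mem_tp y hy
    simp only [e]
    exact h0 i j ((tp_lt hi hj).1 hxy) hj
  · intro x hx y hy hxy
    exact hT.sub21 _ _ (key x hx y hy (q_sub10 hxy))
  · intro x hx y hy hxy
    exact key x hx y hy (q_sub10 (q_sub21 hxy))

lemma no_long [WellFoundedLT G.T] (f : ℕ → G.T) (h0 : ∀ i j, i < j → j < M + 1 → f i < f j)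
    (h2 : ∀ i j, i ≤ j → j < M + 1 → G.Q2 (f i) (f j)) : False := by
  obtain ⟨g, hg, e⟩ := ext_chain (G := G) tgtK (f 0) f (fun i j h h' => h0 i j h (by omega)) (fun i j h h' => h2 i j h (by omega))
  obtain ⟨i, hi, hle⟩ := T_le (f M)
  have h1 : tp G i hi ≤ g (tp G i hi) := hg.le_apply
  rw [e] at h1
  exact absurd (h0 i M hi (by omega)) (not_lt.2 (hle.trans h1))

end

def Ch (le2 : Ordinal → Ordinal → Prop) (γ : Ordinal) (n : ℕ) : Prop := ∃ β : Fin n → Ordinal,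
    (∀ i, β i < γ) ∧
    ∀ (i : ℕ) (hi : i + 1 < n), Lt2 le2 (β ⟨i, Nat.lt_of_succ_lt hi⟩) (β ⟨i + 1, hi⟩)

universe u
variable {le1 le2 : Ordinal.{u} → Ordinal.{u} → Prop}

lemma exists_pi (h : IsR2Pair le1 le2) {M : ℕ} (G : Gen M) {ν : Ordinal.{u}} (hc : Ch le2 ν M) :
    ∃ π : G.T → Ordinal.{u}, StrictMono π ∧ ∀ x o, o < π x → ∃ y, π y = o := by
  obtain ⟨β, -, hβ⟩ := hc
  let f : ℕ → Ordinal := fun i => if hi : i < M then β ⟨i, hi⟩ else 0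
  have hf : ∀ i, i + 1 < M → le2 (f i) (f (i + 1)) ∧ f i < f (i + 1) := by
    intro i hi
    have := hβ i hi
    simp only [f, hi, Nat.lt_of_succ_lt hi, dite_true]
    exact ⟨this.1, lt_of_le_of_ne (ord_sub10 h _ _ (ord_sub21 h _ _ this.1)) this.2⟩
  have h2 : ∀ i j, i ≤ j → j < M → le2 (f i) (f j) := by
    intro i j hij
    induction j, hij using Nat.le_induction with
    | base => intro _; exact ord_refl2 h _
    | succ j hij ih => intro hj; exact ord_trans2 h _ _ _ (ih (by omega)) (hf j hj).1
  have h0 : ∀ i j, i < j → j < M → f i < f j := by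
    intro i j hij hj
    exact (hf i (by omega)).2.trans_le (ord_sub10 h _ _ (ord_sub21 h _ _ (h2 (i+1) j hij hj)))
  obtain ⟨g, hg, -⟩ := ext_chain (G := G) (ord_tgt h) 0 f h0 h2
  have : WellFoundedLT G.T := hg.wellFoundedLT
  refine ⟨fun x => Ordinal.lift.{u, 0} (Ordinal.typein (· < · : G.T → G.T → Prop) x), ?_, ?_⟩
  · intro x y hxy
    exact Ordinal.lift_lt.2 ((Ordinal.typein_lt_typein _).2 hxy)
  · intro x o ho
    obtain ⟨o', ho', rfl⟩ := Ordinal.lt_lift_iff.1 ho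
    obtain ⟨y, rfl⟩ := Ordinal.typein_surj (· < · : G.T → G.T → Prop) (ho'.trans (Ordinal.typein_lt_type _ x))
    exact ⟨y, rfl⟩

lemma exists_x (h : IsR2Pair le1 le2) {M : ℕ} {G : Gen M} (π : G.T → Ordinal) (hm : StrictMono π)
    (hi : ∀ x o, o < π x → ∃ y, π y = o) {γ : Ordinal} (hn : ¬ Ch le2 γ M) : ∃ x, π x = γ := by
  by_contra hx
  have : WellFoundedLT G.T := hm.wellFoundedLT
  have hlt : ∀ x, π x < γ := by
    intro x
    by_contra hh
    rcases (not_lt.1 hh).eq_or_lt with e | hh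
    · exact hx ⟨x, e.symm⟩
    · exact hx (hi x γ hh)
  refine hn ⟨fun i => π (tp G i.1 i.2), fun i => hlt _, fun i hi' => ⟨?_, ?_⟩⟩
  · exact (ident h π hm hi _ _).2.2 (tp_q2 _ _ (Nat.le_succ i))
  · exact (hm ((tp_lt _ _).2 (Nat.lt_succ_self i))).ne

section
variable {M : ℕ}

noncomputable def PF (G : Gen M) (n : ℕ) (x : G.T) : RForest where
  P := {y // y ∈ ST G n} ⊕ Fin (M + 1)
  le0
    | .inl s, .inl t => s.1 ≤ t.1
    | .inl s, .inr _ => s.1 ≤ x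
    | .inr _, .inl s => x < s.1
    | .inr c, .inr d => c ≤ d
  le1
    | .inl s, .inl t => G.Q1 s.1 t.1
    | .inl s, .inr _ => G.Q1 s.1 x
    | .inr _, .inl _ => False
    | .inr c, .inr d => c ≤ d
  le2
    | .inl s, .inl t => G.Q2 s.1 t.1
    | .inl _, .inr _ => False
    | .inr _, .inl _ => False
    | .inr c, .inr d => c ≤ d
  le0_refl := by rintro (p | p) <;> simp
  le0_trans := by
    rintro (p | p) (q | q) (r | r) h1 h2 <;> dsimp only at *
    · exact h1.trans h2
    · exact h1.trans h2
    · exact h1.trans h2.le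
    · exact h1
    · exact h1.trans_le h2
    · exact absurd (h1.trans_le h2) (lt_irrefl _)
    · exact h2
    · exact h1.trans h2
  le0_antisymm := by
    rintro (p | p) (q | q) h1 h2 <;> dsimp only at *
    · exact congrArg _ (Subtype.ext (le_antisymm h1 h2))
    · exact absurd (h1.trans_lt h2) (lt_irrefl _)
    · exact absurd (h1.trans_le h2) (lt_irrefl _)
    · exact congrArg _ (le_antisymm h1 h2)
  le0_total := by
    rintro (p | p) (q | q) <;> dsimp only
    · exact le_total _ _
    · exact le_or_gt _ _
    · exact lt_or_ge _ _
    · exact le_total _ _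
  le1_refl := by
    rintro (p | p)
    exacts [q_refl1 _, le_rfl]
  le1_trans := by
    rintro (p | p) (q | q) (r | r) h1 h2 <;> dsimp only at *
    · exact q_tr1 h1 h2
    · exact q_tr1 h1 h2
    · exact h1
    · exact h1.trans h2
  le1_antisymm := by
    rintro (p | p) (q | q) h1 h2 <;> dsimp only at *
    · exact congrArg _ (Subtype.ext (le_antisymm (q_sub10 h1) (q_sub10 h2)))
    · exact congrArg _ (le_antisymm h1 h2)
  le2_refl := by
    rintro (p | p)
    exacts [q_refl _, le_rfl]
  le2_trans := by
    rintro (p | p) (q | q) (r | r) h1 h2 <;> dsimp only at *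
    · exact q_tr2 h1 h2
    · exact h1.trans h2
  le2_antisymm := by
    rintro (p | p) (q | q) h1 h2 <;> dsimp only at *
    · exact congrArg _ (Subtype.ext (le_antisymm (q_sub10 (q_sub21 h1)) (q_sub10 (q_sub21 h2))))
    · exact congrArg _ (le_antisymm h1 h2)
  le2_sub_le1 := by
    rintro (p | p) (q | q) h1 <;> dsimp only at *
    exacts [q_sub21 h1, h1]
  le1_sub_le0 := by
    rintro (p | p) (q | q) h1 <;> dsimp only at *
    exacts [q_sub10 h1, q_sub10 h1, h1]
  forest1 := by
    rintro (p | p) (q | q) (r | r) h1 h2 <;> dsimp only at *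
    · exact (le_total q.1 r.1).imp (fun h => q_resp1 h (q_sub10 h2) h1) (fun h => q_resp1 h (q_sub10 h1) h2)
    · exact (le_total q.1 r.1).imp (fun h => q_resp1 h (q_sub10 h2) h1) (fun h => q_resp1 h (q_sub10 h1) h2)
    · exact .inl h1
    · exact .inr h2
    · exact le_total _ _
  forest2 := by
    rintro (p | p) (q | q) (r | r) h1 h2 <;> dsimp only at *
    · exact (le_total q.1 r.1).imp
        (fun h => q_resp2 (q_resp1 h (q_sub10 (q_sub21 h2)) (q_sub21 h1)) (q_sub21 h2) h1)
        (fun h => q_resp2 (q_resp1 h (q_sub10 (q_sub21 h1)) (q_sub21 h2)) (q_sub21 h1) h2)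
    · exact le_total _ _
  respects1 := by
    rintro (p | p) (q | q) (r | r) h1 h2 h3 <;> dsimp only at *
    · exact q_resp1 h1 h2 h3
    · exact q_resp1 h1 h2 h3
    · exact q_resp1 h1 h2.le h3
    · exact h3
    · exact absurd (h1.trans_le h2) (lt_irrefl _)
    · exact h1
  respects2 := by
    rintro (p | p) (q | q) (r | r) h1 h2 h3 <;> dsimp only at *
    · exact q_resp2 h1 h2 h3
    · exact h1

end

lemma no_cov (G : (M : ℕ) → Gen M) (π : (M : ℕ) → (G M).T → Ordinal.{u}) (hm : ∀ M, StrictMono (π M)) {M M' : ℕ}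
    (hMM : M' ≤ M) {n n' : ℕ} {x : (G M).T} {x' : (G M').T} (hx : x ∈ ST (G M) n) (hlt : π M' x' < π M x)
    (f : (PF (G M) n x).P → (PF (G M') n' x').P) (hf : ForestCovering (PF (G M) n x) (PF (G M') n' x') f) : False := by
  classical
  obtain ⟨f0, f1, f2⟩ := hf
  have : ∀ M, WellFoundedLT (G M).T := fun M => (hm M).wellFoundedLT
  have fl : ∀ p q, ¬ (PF (G M) n x).le0 q p → ¬ (PF (G M') n' x').le0 (f q) (f p) := fun p q h h' => h ((f0 _ _).2 h')
  have c0 : ∃ d, f (.inr 0) = .inr d := by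
    rcases hh : f (.inr 0) with s | d
    swap
    · exact ⟨d, rfl⟩
    exfalso
    have all : ∀ c : Fin (M + 1), ∃ s, f (.inr c) = .inl s := by
      intro c
      have := f2 (.inr 0) (.inr c) (Fin.zero_le c)
      rw [hh] at this
      rcases hc : f (.inr c) with t | d
      · exact ⟨t, rfl⟩
      · rw [hc] at this; exact this.elim
    choose t ht using all
    have lt : ∀ c d : Fin (M + 1), c < d → (t c).1 < (t d).1 := by
      intro c d hcd
      have := fl (.inr c) (.inr d) (not_le.2 hcd)
      rw [ht, ht] at this
      exact not_le.1 this
    have q2 : ∀ c d : Fin (M + 1), c ≤ d → (G M').Q2 (t c).1 (t d).1 := by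
      intro c d hcd
      have := f2 (.inr c) (.inr d) hcd
      rw [ht, ht] at this
      exact this
    refine no_long (fun i => if hi : i < M + 1 then (t ⟨i, hi⟩).1 else (t 0).1) ?_ ?_
    · intro i j hij hj
      have h1 : i < M + 1 := by omega
      have h2 : j < M + 1 := by omega
      simp only [h1, h2, dite_true]
      exact lt _ _ hij
    · intro i j hij hj
      have h1 : i < M + 1 := by omega
      have h2 : j < M + 1 := by omega
      simp only [h1, h2, dite_true]
      exact q2 _ _ hij
  have all : ∀ c : Fin (M + 1), ∃ d, f (.inr c) = .inr d := by
    intro c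
    obtain ⟨d, hd⟩ := c0
    have := f2 (.inr 0) (.inr c) (Fin.zero_le c)
    rw [hd] at this
    rcases hc : f (.inr c) with t | d
    · rw [hc] at this; exact this.elim
    · exact ⟨d, rfl⟩
  choose t ht using all
  have tm : StrictMono t := by
    intro c d hcd
    have := fl (.inr c) (.inr d) (not_le.2 hcd)
    rw [ht, ht] at this
    exact not_le.1 this
  have hcard := Fintype.card_le_of_injective t tm.injective
  simp only [Fintype.card_fin] at hcard
  obtain rfl : M' = M := by omega
  have hxx : x' < x := (hm _).lt_iff_lt.1 hlt
  have t0 : t 0 = 0 := by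
    obtain ⟨c, hc⟩ := Finite.surjective_of_injective tm.injective 0
    exact le_antisymm ((tm.monotone (Fin.zero_le c)).trans_eq hc) (Fin.zero_le _)
  have tl : t (Fin.last M') = Fin.last M' := le_antisymm (Fin.le_last _) tm.le_apply
  have lo : ∀ s : {y // y ∈ ST (G M') n}, s.1 ≤ x → ∃ s' : {y // y ∈ ST (G M') n'}, f (.inl s) = .inl s' ∧ s'.1 ≤ x' := by
    intro s hs
    have h1 := (f0 (.inl s) (.inr 0)).1 hs
    have h2 := fl (.inl s) (.inr 0) (not_lt.2 hs)
    rw [ht, t0] at h1 h2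
    rcases hc : f (.inl s) with r | d <;> rw [hc] at h1 h2
    · exact ⟨r, rfl, h1⟩
    · exact absurd (Fin.zero_le _) h2
  have hi : ∀ s : {y // y ∈ ST (G M') n}, x < s.1 → ∃ s' : {y // y ∈ ST (G M') n'}, f (.inl s) = .inl s' := by
    intro s hs
    have h2 := fl (.inr (Fin.last M')) (.inl s) (not_le.2 hs)
    rw [ht, tl] at h2
    rcases hc : f (.inl s) with r | d <;> rw [hc] at h2
    · exact ⟨r, rfl⟩
    · exact absurd (Fin.le_last _) h2
  have al : ∀ s : {y // y ∈ ST (G M') n}, ∃ s' : {y // y ∈ ST (G M') n'}, f (.inl s) = .inl s' := by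
    intro s
    rcases le_or_gt s.1 x with h | h
    · exact (lo s h).imp fun _ h => h.1
    · exact hi s h
  choose r hr using al
  have e : ∀ y (hy : y ∈ ST (G M') n), (fun y => if hy : y ∈ ST (G M') n then (r ⟨y, hy⟩).1 else y) y = (r ⟨y, hy⟩).1 :=
    fun y hy => by simp only [hy, dite_true]
  generalize (fun y => if hy : y ∈ ST (G M') n then (r ⟨y, hy⟩).1 else y) = g at e
  have := no_low (n := n) g ?_ ?_ ?_ x hx
  · rw [e x hx] at this
    obtain ⟨s', hs', hle⟩ := lo ⟨x, hx⟩ le_rfl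
    rw [hr] at hs'
    rw [Sum.inl.inj hs'] at this
    exact absurd (this.trans hle) (not_le.2 hxx)
  · intro y hy z hz hyz
    rw [e y hy, e z hz]
    have := fl (.inl ⟨y, hy⟩) (.inl ⟨z, hz⟩) (not_le.2 hyz)
    rw [hr, hr] at this
    exact not_le.1 this
  · intro y hy z hz hyz
    rw [e y hy, e z hz]
    have := f1 (.inl ⟨y, hy⟩) (.inl ⟨z, hz⟩) hyz
    rw [hr, hr] at this
    exact this
  · intro y hy z hz hyz
    rw [e y hy, e z hz]
    have := f2 (.inl ⟨y, hy⟩) (.inl ⟨z, hz⟩) hyz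
    rw [hr, hr] at this
    exact this

theorem main (h : IsR2Pair le1 le2) : ∃ P : Ordinal → RForest,
    ∀ α β : Ordinal, α < β → β < OneInfty le2 →
        ¬ ∃ f : (P β).P → (P α).P, ForestCovering (P β) (P α) f := by
  classical
  let E : RForest := ⟨Empty, nofun, nofun, nofun, nofun, nofun, nofun, nofun, nofun, nofun, nofun, nofun, nofun, nofun,
    nofun, nofun, nofun, nofun, nofun, nofun⟩
  by_cases hne : ∃ ν, ∀ n, Ch le2 ν n
  swap
  · refine ⟨fun _ => E, fun α β _ hβ => absurd hβ ?_⟩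
    have : OneInfty le2 = 0 := by
      unfold OneInfty
      have e : {ν : Ordinal | ∀ n : ℕ, Ch le2 ν n} = ∅ := Set.eq_empty_of_forall_notMem fun ν hν => hne ⟨ν, hν⟩
      exact (congrArg sInf e).trans Ordinal.sInf_empty
    rw [this]
    exact not_lt.2 (zero_le)
  obtain ⟨ν, hν⟩ := hne
  let G : (M : ℕ) → Gen M := fun M => (exists_gen M).some
  choose π hm hi using fun M => exists_pi h (G M) (hν M)
  let m : Ordinal → ℕ := fun γ => sInf {n | ¬ Ch le2 γ n}
  have hmn : ∀ γ, γ < OneInfty le2 → ∃ n, ¬ Ch le2 γ n := by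
    intro γ hγ
    by_contra hh
    push Not at hh
    exact absurd (csInf_le' (s := {ν : Ordinal | ∀ n : ℕ, Ch le2 ν n}) hh) (not_le.2 hγ)
  have hms : ∀ γ, γ < OneInfty le2 → ¬ Ch le2 γ (m γ) := fun γ hγ => Nat.sInf_mem (hmn γ hγ)
  have ex : ∀ γ, ∃ F : RForest, γ < OneInfty le2 → ∃ (x : (G (m γ)).T) (n : ℕ), x ∈ ST (G (m γ)) n ∧
      π (m γ) x = γ ∧ F = PF (G (m γ)) n x := by
    intro γ
    by_cases hγ : γ < OneInfty le2
    · obtain ⟨x, hx⟩ := exists_x h (π (m γ)) (hm _) (hi _) (hms γ hγ)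
      obtain ⟨n, hn⟩ := x.2
      exact ⟨PF (G (m γ)) n x, fun _ => ⟨x, n, mem_ST.2 hn, hx, rfl⟩⟩
    · exact ⟨E, fun h => absurd h hγ⟩
  choose P hP using ex
  refine ⟨P, fun α β hab hβ => ?_⟩
  obtain ⟨x, n, hx, ex, eP⟩ := hP β hβ
  obtain ⟨x', n', hx', ex', eP'⟩ := hP α (hab.trans hβ)
  rw [eP, eP']
  rintro ⟨f, hf⟩
  refine no_cov G π hm ?_ hx (by rw [ex, ex']; exact hab) f hf
  refine Nat.sInf_le (fun hc => hms β hβ ?_)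
  obtain ⟨b, hb, hb'⟩ := hc
  exact ⟨b, fun i => (hb i).trans hab, hb'⟩

end R2

theorem stmt13 (le1 le2 : Ordinal → Ordinal → Prop) (h : IsR2Pair le1 le2) :
    ∃ P : Ordinal → RForest,
      (∀ α β : Ordinal, α < β → β < OneInfty le2 →
        ¬ ∃ f : (P β).P → (P α).P, ForestCovering (P β) (P α) f) ∧
      (∀ g : ℕ → Ordinal, (∀ n, g n < OneInfty le2) → (∀ n, g (n + 1) < g n) →
        ∀ m n : ℕ, m < n → ¬ ∃ f : (P (g m)).P → (P (g n)).P,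
          ForestCovering (P (g m)) (P (g n)) f) := by
  obtain ⟨P, hP⟩ := R2.main h
  exact ⟨P, hP, fun g hg hd m n hmn => hP _ _ (strictAnti_nat_of_succ_lt hd hmn) (hg m)⟩
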